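/- Let u₀ satisfy (2.8), for each ε > 0 let u_{0ε} satisfy (3.13), let u_ε ∈ C^{2,1}(Q) ∩ C(Q̄) be the solution of the regularised problem (3.11), and let u be the unique classical solution of the limit problem (2.7). Then u_ε → u uniformly on Q as ε → 0, and moreover u_ε → u in C^{2,1}_loc(Q ∖ N), i.e. on every compact subset of Q ∖ N the functions u_ε, (u_ε)_x, (u_ε)_xx and (u_ε)_t converge uniformly to u, u_x, u_xx and u_t respectively. -/

import Mathlib

open Set Filter MeasureTheory Topology

/-- Partial derivative in `x` of `u(x,t)`. -/
noncomputable def pdx (u : ℝ → ℝ → ℝ) (x t : ℝ) : ℝ := deriv (fun y => u y t) x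

/-- Second partial derivative in `x` of `u(x,t)`. -/
noncomputable def pdxx (u : ℝ → ℝ → ℝ) (x t : ℝ) : ℝ := deriv (fun y => pdx u y t) x

/-- Partial derivative in `t` of `u(x,t)`, one-sided at `t = T`. -/
noncomputable def pdtW (T : ℝ) (u : ℝ → ℝ → ℝ) (x t : ℝ) : ℝ :=
  derivWithin (fun s => u x s) (Set.Iic T) t

/-- `Q = (a,b) × (0,T]`. -/
def QT (a b T : ℝ) : Set (ℝ × ℝ) := Set.Ioo a b ×ˢ Set.Ioc 0 T

/-- `N = N₀ × [0,T]`. -/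
def NSet (N₀ : Set ℝ) (T : ℝ) : Set (ℝ × ℝ) := N₀ ×ˢ Set.Icc 0 T

/-- Condition (2.8): `u₀` is continuous, `u₀(a) = -1`, `u₀(b) = 1`, the zeros of `u₀`
form the finite set `N₀ ⊆ (a,b)`, and `u₀` changes sign at each of its zeros. -/
structure InitData (a b : ℝ) (N₀ : Set ℝ) (u₀ : ℝ → ℝ) : Prop where
  cont : ContinuousOn u₀ (Set.Icc a b)
  bdry_a : u₀ a = -1
  bdry_b : u₀ b = 1
  fin : N₀.Finite
  sub : N₀ ⊆ Set.Ioo a b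
  zeros : ∀ x ∈ Set.Icc a b, (u₀ x = 0 ↔ x ∈ N₀)
  sign_change : ∀ x ∈ N₀, ∀ δ > 0,
    ∃ y ∈ Set.Ioo (x - δ) x, ∃ z ∈ Set.Ioo x (x + δ), u₀ y * u₀ z < 0

/-- A classical solution of the limit problem (2.7): `u ∈ C(Q̄)` vanishing exactly on `N`,
`C^{2,1}` on `Q ∖ N`, with boundary values `∓1`, initial value `u₀`, satisfying
`u_t = |u| u_xx + u(1-|u|)` on `Q ∖ N`. -/
structure IsClassicalSol (a b T : ℝ) (N₀ : Set ℝ) (u₀ : ℝ → ℝ) (u : ℝ → ℝ → ℝ) : Prop where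
  cont : ContinuousOn (fun p : ℝ × ℝ => u p.1 p.2) (Set.Icc a b ×ˢ Set.Icc 0 T)
  zero_iff : ∀ x ∈ Set.Icc a b, ∀ t ∈ Set.Icc 0 T, (u x t = 0 ↔ x ∈ N₀)
  diff_x : ∀ p ∈ QT a b T \ NSet N₀ T, DifferentiableAt ℝ (fun y => u y p.2) p.1
  diff_xx : ∀ p ∈ QT a b T \ NSet N₀ T, DifferentiableAt ℝ (fun y => pdx u y p.2) p.1
  diff_t : ∀ p ∈ QT a b T \ NSet N₀ T,
    DifferentiableWithinAt ℝ (fun s => u p.1 s) (Set.Iic T) p.2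
  cont_x : ContinuousOn (fun p : ℝ × ℝ => pdx u p.1 p.2) (QT a b T \ NSet N₀ T)
  cont_xx : ContinuousOn (fun p : ℝ × ℝ => pdxx u p.1 p.2) (QT a b T \ NSet N₀ T)
  cont_t : ContinuousOn (fun p : ℝ × ℝ => pdtW T u p.1 p.2) (QT a b T \ NSet N₀ T)
  bdry_a : ∀ t ∈ Set.Ioc 0 T, u a t = -1
  bdry_b : ∀ t ∈ Set.Ioc 0 T, u b t = 1
  init : ∀ x ∈ Set.Ioo a b, u x 0 = u₀ x
  pde : ∀ p ∈ QT a b T \ NSet N₀ T,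
    pdtW T u p.1 p.2 = |u p.1 p.2| * pdxx u p.1 p.2 + u p.1 p.2 * (1 - |u p.1 p.2|)

/-- `U_ε(φ) = 2∫₀^φ √(ε + s²) ds` (equation (1.3)); its inverse is `Φ_ε`. -/
noncomputable def Ureg (ε φ : ℝ) : ℝ := 2 * ∫ s in (0:ℝ)..φ, Real.sqrt (ε + s ^ 2)

/-- A (classical) solution of the regularised problem (3.11):
`u ∈ C(Q̄) ∩ C^{2,1}(Q)` with
`u_t = (ε + Φ_ε²(u)) u_xx + Φ_ε(u)(1 - Φ_ε²(u)) √(ε + Φ_ε²(u))` in `Q`,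
boundary values `∓u_{1ε}` and initial value `u_{0ε}`. -/
structure IsRegSol (a b T ε : ℝ) (Φ : ℝ → ℝ) (u1 : ℝ) (u₀ε : ℝ → ℝ)
    (u : ℝ → ℝ → ℝ) : Prop where
  cont : ContinuousOn (fun p : ℝ × ℝ => u p.1 p.2) (Set.Icc a b ×ˢ Set.Icc 0 T)
  diff_x : ∀ p ∈ QT a b T, DifferentiableAt ℝ (fun y => u y p.2) p.1
  diff_xx : ∀ p ∈ QT a b T, DifferentiableAt ℝ (fun y => pdx u y p.2) p.1
  diff_t : ∀ p ∈ QT a b T, DifferentiableWithinAt ℝ (fun s => u p.1 s) (Set.Iic T) p.2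
  cont_x : ContinuousOn (fun p : ℝ × ℝ => pdx u p.1 p.2) (QT a b T)
  cont_xx : ContinuousOn (fun p : ℝ × ℝ => pdxx u p.1 p.2) (QT a b T)
  cont_t : ContinuousOn (fun p : ℝ × ℝ => pdtW T u p.1 p.2) (QT a b T)
  bdry_a : ∀ t ∈ Set.Ioc 0 T, u a t = -u1
  bdry_b : ∀ t ∈ Set.Ioc 0 T, u b t = u1
  init : ∀ x ∈ Set.Icc a b, u x 0 = u₀ε x
  pde : ∀ p ∈ QT a b T,
    pdtW T u p.1 p.2 = (ε + Φ (u p.1 p.2) ^ 2) * pdxx u p.1 p.2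
      + Φ (u p.1 p.2) * (1 - Φ (u p.1 p.2) ^ 2) * Real.sqrt (ε + Φ (u p.1 p.2) ^ 2)

/-- `u` is twice differentiable in `x` and left differentiable in `t` at `(x, t)`, with
`u_t = ut` and `u_xx = uxx` there. -/
structure C21At (u : ℝ → ℝ → ℝ) (x t ut uxx : ℝ) : Prop where
  dx : ∀ᶠ y in 𝓝 x, DifferentiableAt ℝ (fun y => u y t) y
  dxx : HasDerivAt (deriv fun y => u y t) uxx x
  dt : HasDerivWithinAt (fun s => u x s) ut (Iic t) t

theorem IsLocalMax.deriv_deriv_nonpos {f : ℝ → ℝ} {x : ℝ} (h : IsLocalMax f x)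
    (hc : ContinuousAt f x) : deriv (deriv f) x ≤ 0 := by
  by_contra! hpos
  have hmin : IsLocalMin f x := isLocalMin_of_deriv_deriv_pos hpos h.deriv_eq_zero hc
  have hconst : f =ᶠ[𝓝 x] fun _ => f x := by
    filter_upwards [h, hmin] with y h1 h2 using le_antisymm h1 h2
  have h1 : deriv f =ᶠ[𝓝 x] deriv fun _ => f x := hconst.deriv
  rw [h1.deriv_eq] at hpos
  simp at hpos

theorem HasDerivWithinAt.nonneg_of_left_max {g : ℝ → ℝ} {g' t : ℝ}
    (hg : HasDerivWithinAt g g' (Iic t) t) (h : ∀ᶠ s in 𝓝[<] t, g s ≤ g t) : 0 ≤ g' := by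
  rw [← hasDerivWithinAt_Iio_iff_Iic, hasDerivWithinAt_iff_tendsto_slope'
    (by simp)] at hg
  refine ge_of_tendsto hg ?_
  filter_upwards [h, self_mem_nhdsWithin] with s hs hst
  rw [slope_def_field]
  exact div_nonneg_of_nonpos (by linarith) (by linarith [mem_Iio.1 hst])

namespace C21At

variable {u v : ℝ → ℝ → ℝ} {x t ut uxx vt vxx : ℝ}

theorem neg (h : C21At u x t ut uxx) : C21At (fun y s => -u y s) x t (-ut) (-uxx) where
  dx := h.dx.mono fun _ hy => hy.neg
  dxx := by
    have : (deriv fun y => -u y t) = fun y => -deriv (fun y => u y t) y := by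
      funext y; exact deriv.fun_neg
    rw [this]; exact h.dxx.neg
  dt := h.dt.neg

theorem sub (h : C21At u x t ut uxx) (h' : C21At v x t vt vxx) :
    C21At (fun y s => u y s - v y s) x t (ut - vt) (uxx - vxx) where
  dx := by filter_upwards [h.dx, h'.dx] with y h1 h2 using h1.sub h2
  dxx := by
    refine (h.dxx.sub h'.dxx).congr_of_eventuallyEq ?_
    filter_upwards [h.dx, h'.dx] with y h1 h2
    exact deriv_fun_sub h1 h2
  dt := h.dt.sub h'.dt

theorem div_const (h : C21At u x t ut uxx) (c : ℝ) :
    C21At (fun y s => u y s / c) x t (ut / c) (uxx / c) where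
  dx := h.dx.mono fun _ hy => hy.div_const c
  dxx := by
    have : (deriv fun y => u y t / c) = fun y => deriv (fun y => u y t) y / c := by
      funext y; exact deriv_div_const c
    rw [this]; exact h.dxx.div_const c
  dt := h.dt.div_const c

theorem shift {h : ℝ} (hu : C21At u x (t - h) ut uxx) :
    C21At (fun y s => u y (s - h)) x t ut uxx where
  dx := hu.dx
  dxx := hu.dxx
  dt := by
    have h1 : HasDerivWithinAt (fun s : ℝ => s - h) 1 (Iic t) t :=
      ((hasDerivAt_id t).sub_const h).hasDerivWithinAt
    have := HasDerivWithinAt.scomp (g₁ := fun s => u x s) t (hu.dt) h1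
      (fun s hs => by simp only [mem_Iic] at *; linarith)
    simpa [Function.comp_def] using this

theorem add_test {f f' g : ℝ → ℝ} {f'' g' : ℝ} (hf : ∀ y, HasDerivAt f (f' y) y)
    (hf' : HasDerivAt f' f'' x) (hg : HasDerivAt g g' t) :
    C21At (fun y s => f y + g s) x t g' f'' where
  dx := Eventually.of_forall fun y => ((hf y).add_const _).differentiableAt
  dxx := by
    have : (deriv fun y => f y + g t) = f' := by
      funext y; exact ((hf y).add_const _).deriv
    rwa [this]
  dt := (hg.const_add _).hasDerivWithinAt

theorem comp {X X' : ℝ → ℝ} {X'' : ℝ} (hX : ∀ w, HasDerivAt X (X' w) w)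
    (hX' : HasDerivAt X' X'' (u x t)) (h : C21At u x t ut uxx) :
    C21At (fun y s => X (u y s)) x t (X' (u x t) * ut)
      (X'' * deriv (fun y => u y t) x ^ 2 + X' (u x t) * uxx) where
  dx := h.dx.mono fun y hy => ((hX _).comp y hy.hasDerivAt).differentiableAt
  dxx := by
    have h1 : (deriv fun y => X (u y t)) =ᶠ[𝓝 x]
        fun y => X' (u y t) * deriv (fun y => u y t) y := by
      filter_upwards [h.dx] with y hy
      exact ((hX _).comp y hy.hasDerivAt).deriv
    refine HasDerivAt.congr_of_eventuallyEq ?_ h1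
    have h2 := (HasDerivAt.comp (h₂ := X') x hX' h.dx.self_of_nhds.hasDerivAt).mul h.dxx
    refine h2.congr_deriv ?_
    simp only [Function.comp]; ring
  dt := (hX _).comp_hasDerivWithinAt t h.dt

theorem deriv_comp {X : ℝ → ℝ} {X' : ℝ} (hX : HasDerivAt X X' (u x t))
    (h : C21At u x t ut uxx) :
    deriv (fun y => X (u y t)) x = X' * deriv (fun y => u y t) x :=
  (HasDerivAt.comp (h₂ := X) x hX h.dx.self_of_nhds.hasDerivAt).deriv

theorem continuousAt (h : C21At u x t ut uxx) : ContinuousAt (fun y => u y t) x :=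
  h.dx.self_of_nhds.continuousAt

theorem of_max (h : C21At u x t ut uxx) (hx : ∀ᶠ y in 𝓝 x, u y t ≤ u x t)
    (ht : ∀ᶠ s in 𝓝[<] t, u x s ≤ u x t) : uxx ≤ 0 ∧ 0 ≤ ut :=
  ⟨h.dxx.deriv ▸ IsLocalMax.deriv_deriv_nonpos (f := fun y => u y t) hx h.continuousAt,
    h.dt.nonneg_of_left_max ht⟩

end C21At

/-- First-touching comparison with a barrier of the form `f x + g t`. -/
theorem lt_barrier {l r t₀ t₁ : ℝ} {v : ℝ → ℝ → ℝ}
    (hv : ContinuousOn (fun p : ℝ × ℝ => v p.1 p.2) (Icc l r ×ˢ Icc t₀ t₁))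
    {f f' f'' g g' : ℝ → ℝ} (hf : ∀ y, HasDerivAt f (f' y) y)
    (hf' : ∀ y, HasDerivAt f' (f'' y) y) (hg : ∀ s, HasDerivAt g (g' s) s)
    (hl : ∀ t ∈ Icc t₀ t₁, v l t < f l + g t) (hr : ∀ t ∈ Icc t₀ t₁, v r t < f r + g t)
    (h₀ : ∀ x ∈ Icc l r, v x t₀ < f x + g t₀)
    (hint : ∀ x ∈ Ioo l r, ∀ t ∈ Ioc t₀ t₁, v x t = f x + g t →
      ∃ vt vxx, C21At v x t vt vxx ∧
        (deriv (fun y => v y t) x = f' x → vxx ≤ f'' x → vt < g' t)) :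
    ∀ x ∈ Icc l r, ∀ t ∈ Icc t₀ t₁, v x t < f x + g t := by
  by_contra! hcon
  obtain ⟨x₀, hx₀, s₀, hs₀, hle₀⟩ := hcon
  have hfc : Continuous f := continuous_iff_continuousAt.2 fun y => (hf y).continuousAt
  have hgc : Continuous g := continuous_iff_continuousAt.2 fun y => (hg y).continuousAt
  set D : ℝ × ℝ → ℝ := fun p => v p.1 p.2 - (f p.1 + g p.2) with hD
  have hDc : ContinuousOn D (Icc l r ×ˢ Icc t₀ t₁) :=
    hv.sub (by fun_prop)
  set S : Set (ℝ × ℝ) := (Icc l r ×ˢ Icc t₀ t₁) ∩ D ⁻¹' (Ici 0) with hS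
  have hScomp : IsCompact S :=
    (isCompact_Icc.prod isCompact_Icc).of_isClosed_subset
      (hDc.preimage_isClosed_of_isClosed (isClosed_Icc.prod isClosed_Icc) isClosed_Ici)
      inter_subset_left
  have hSne : S.Nonempty := ⟨(x₀, s₀), ⟨hx₀, hs₀⟩, by simp [hD, hle₀]⟩
  obtain ⟨⟨x, t⟩, hxt, hmin⟩ := hScomp.exists_isMinOn hSne continuous_snd.continuousOn
  obtain ⟨⟨hx, ht⟩, hDx⟩ := hxt
  simp only [hD, mem_preimage, mem_Ici] at hx ht hDx
  have hbefore : ∀ y ∈ Icc l r, ∀ s ∈ Icc t₀ t₁, s < t → D (y, s) < 0 := by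
    intro y hy s hs hst
    by_contra! hge
    have := hmin (show (y, s) ∈ S from ⟨⟨hy, hs⟩, hge⟩)
    simp only [mem_ofPred_eq] at this
    linarith
  have ht₀ : t₀ < t := by
    rcases ht.1.lt_or_eq with h | h
    · exact h
    · subst h; linarith [h₀ x hx]
  have hxl : l < x := by
    rcases hx.1.lt_or_eq with h | h
    · exact h
    · subst h; linarith [hl t ht]
  have hxr : x < r := by
    rcases hx.2.lt_or_eq with h | h
    · exact h
    · subst h; linarith [hr t ht]
  have hslice : ∀ y ∈ Icc l r, D (y, t) ≤ 0 := by
    intro y hy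
    have hc : ContinuousWithinAt (fun s => D (y, s)) (Ico t₀ t) t := by
      have h1 : ContinuousWithinAt D (Icc l r ×ˢ Icc t₀ t₁) (y, t) := hDc _ ⟨hy, ht⟩
      refine h1.comp (f := fun s : ℝ => (y, s)) (by fun_prop) ?_
      intro s hs
      exact ⟨hy, hs.1, hs.2.le.trans ht.2⟩
    have hne : (𝓝[Ico t₀ t] t).NeBot := by
      rw [← mem_closure_iff_nhdsWithin_neBot, closure_Ico ht₀.ne]
      exact right_mem_Icc.2 ht₀.le
    refine le_of_tendsto hc ?_
    filter_upwards [self_mem_nhdsWithin] with s hs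
    exact (hbefore y hy s ⟨hs.1, hs.2.le.trans ht.2⟩ hs.2).le
  have heq : v x t = f x + g t := by
    have := hslice x hx
    simp only [hD] at this
    linarith
  obtain ⟨vt, vxx, hC, himp⟩ := hint x ⟨hxl, hxr⟩ t ⟨ht₀, ht.2⟩ heq
  have hloc : ∀ᶠ y in 𝓝 x, v y t - (f y + g t) ≤ v x t - (f x + g t) := by
    filter_upwards [Ioo_mem_nhds hxl hxr] with y hy
    have := hslice y ⟨hy.1.le, hy.2.le⟩
    simp only [hD] at this
    linarith
  have hgrad : deriv (fun y => v y t) x = f' x := by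
    have h1 := IsLocalMax.deriv_eq_zero (f := fun y => v y t - (f y + g t)) hloc
    rw [deriv_fun_sub hC.dx.self_of_nhds ((hf x).add_const _).differentiableAt,
      ((hf x).add_const _).deriv] at h1
    linarith
  have hmax := (hC.sub (C21At.add_test hf (hf' x) (hg t))).of_max hloc
    (by
      filter_upwards [Ioo_mem_nhdsLT ht₀] with s hs
      have := hbefore x hx s ⟨hs.1.le, hs.2.le.trans ht.2⟩ hs.2
      simp only [hD] at this
      linarith)
  linarith [himp hgrad (by linarith [hmax.1])]

theorem hasDerivAt_Ureg (ε φ : ℝ) : HasDerivAt (Ureg ε) (2 * √(ε + φ ^ 2)) φ := by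
  have hc : Continuous fun s : ℝ => √(ε + s ^ 2) := by fun_prop
  exact (intervalIntegral.integral_hasDerivAt_right (hc.intervalIntegrable _ _)
    (hc.stronglyMeasurableAtFilter _ _) hc.continuousAt).const_mul 2

theorem Ureg_zero (ε : ℝ) : Ureg ε 0 = 0 := by simp [Ureg]

theorem Ureg_neg (ε φ : ℝ) : Ureg ε (-φ) = -Ureg ε φ := by
  have h := intervalIntegral.integral_comp_neg (a := 0) (b := φ) fun s : ℝ => √(ε + s ^ 2)
  simp only [even_two, Even.neg_pow, neg_zero] at h
  rw [Ureg, Ureg, h, intervalIntegral.integral_symm]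
  ring

/-- Comparing the growth of `Ureg ε` with that of another function. -/
theorem abs_sub_le_abs_Ureg_sub {ε : ℝ} {k k' : ℝ → ℝ} (hk : ∀ φ, HasDerivAt k (k' φ) φ)
    (hk' : ∀ φ, |k' φ| ≤ 2 * √(ε + φ ^ 2)) (φ ψ : ℝ) :
    |k φ - k ψ| ≤ |Ureg ε φ - Ureg ε ψ| := by
  have h1 : Monotone fun φ => Ureg ε φ - k φ :=
    monotone_of_hasDerivAt_nonneg (fun φ => (hasDerivAt_Ureg ε φ).sub (hk φ))
      fun φ => by simpa using (abs_le.1 (hk' φ)).2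
  have h2 : Monotone fun φ => Ureg ε φ + k φ :=
    monotone_of_hasDerivAt_nonneg (fun φ => (hasDerivAt_Ureg ε φ).add (hk φ))
      fun φ => by simpa using by linarith [(abs_le.1 (hk' φ)).1]
  rcases le_total φ ψ with h | h
  · have a := h1 h
    have b := h2 h
    simp only at a b
    rw [abs_le]; constructor <;> rw [abs_sub_comm (Ureg ε φ)] <;>
      linarith [le_abs_self (Ureg ε ψ - Ureg ε φ)]
  · have a := h1 h
    have b := h2 h
    simp only at a b
    rw [abs_le]; constructor <;> linarith [le_abs_self (Ureg ε φ - Ureg ε ψ)]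

theorem strictMono_Ureg {ε : ℝ} (hε : 0 < ε) : StrictMono (Ureg ε) :=
  strictMono_of_hasDerivAt_pos (hasDerivAt_Ureg ε) fun φ => by positivity

theorem sq_le_abs_Ureg {ε : ℝ} (hε : 0 < ε) (φ : ℝ) : φ ^ 2 ≤ |Ureg ε φ| := by
  have := abs_sub_le_abs_Ureg_sub (ε := ε) (k := fun φ => φ ^ 2) (k' := fun φ => 2 * φ)
    (fun φ => by simpa using hasDerivAt_pow 2 φ)
    (fun φ => by
      rw [abs_mul, abs_two]
      exact mul_le_mul_of_nonneg_left (Real.abs_le_sqrt (by linarith)) (by norm_num)) φ 0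
  simpa [Ureg_zero] using this

theorem sq_sub_sq_le_Ureg_sub {ε : ℝ} (hε : 0 < ε) (φ ψ : ℝ) :
    |φ ^ 2 - ψ ^ 2| ≤ |Ureg ε φ - Ureg ε ψ| :=
  abs_sub_le_abs_Ureg_sub (k := fun φ => φ ^ 2) (k' := fun φ => 2 * φ)
    (fun φ => by simpa using hasDerivAt_pow 2 φ)
    (fun φ => by
      rw [abs_mul, abs_two]
      exact mul_le_mul_of_nonneg_left (Real.abs_le_sqrt (by linarith)) (by norm_num)) φ ψ

theorem mul_sqrt_sub_le_Ureg_sub {ε : ℝ} (hε : 0 < ε) (φ ψ : ℝ) :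
    |φ * √(ε + φ ^ 2) - ψ * √(ε + ψ ^ 2)| ≤ |Ureg ε φ - Ureg ε ψ| := by
  refine abs_sub_le_abs_Ureg_sub (k := fun φ => φ * √(ε + φ ^ 2))
    (k' := fun φ => √(ε + φ ^ 2) + φ ^ 2 / √(ε + φ ^ 2)) (fun φ => ?_) (fun φ => ?_) φ ψ
  · have hpos : 0 < ε + φ ^ 2 := by positivity
    have h1 : HasDerivAt (fun φ : ℝ => ε + φ ^ 2) (2 * φ) φ := by
      simpa using (hasDerivAt_pow 2 φ).const_add ε
    have h2 := (hasDerivAt_id φ).mul (h1.sqrt hpos.ne')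
    refine h2.congr_deriv ?_
    have : √(ε + φ ^ 2) ≠ 0 := (Real.sqrt_pos.2 hpos).ne'
    simp only [id]
    field_simp
  · have hpos : 0 < ε + φ ^ 2 := by positivity
    have hs := Real.sqrt_pos.2 hpos
    rw [abs_of_nonneg (by positivity)]
    have : φ ^ 2 / √(ε + φ ^ 2) ≤ √(ε + φ ^ 2) := by
      rw [div_le_iff₀ hs, Real.mul_self_sqrt hpos.le]; linarith
    linarith

/-- `Ureg ε φ` is bounded by `φ ^ 2 + 2 √ε φ` for `φ ≥ 0`. -/
theorem Ureg_le {ε : ℝ} (hε : 0 < ε) {φ : ℝ} (hφ : 0 ≤ φ) :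
    Ureg ε φ ≤ φ ^ 2 + 2 * √ε * φ := by
  have hd : ∀ x ∈ Ici (0:ℝ), HasDerivAt (fun φ => φ ^ 2 + 2 * √ε * φ - Ureg ε φ)
      (2 * x + 2 * √ε - 2 * √(ε + x ^ 2)) x := fun x _ => by
    have h1 : HasDerivAt (fun φ : ℝ => φ ^ 2) (2 * x) x := by simpa using hasDerivAt_pow 2 x
    have h2 : HasDerivAt (fun φ : ℝ => 2 * √ε * φ) (2 * √ε) x := by
      simpa using (hasDerivAt_id x).const_mul (2 * √ε)
    exact (h1.add h2).sub (hasDerivAt_Ureg ε x)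
  have hmono : MonotoneOn (fun φ => φ ^ 2 + 2 * √ε * φ - Ureg ε φ) (Ici 0) := by
    refine monotoneOn_of_deriv_nonneg (convex_Ici 0)
      (fun x hx => (hd x hx).continuousAt.continuousWithinAt)
      (fun x hx => (hd x (interior_subset hx)).differentiableAt.differentiableWithinAt)
      fun x hx => ?_
    have hx' := interior_subset hx
    rw [(hd x hx').deriv]
    have : √(ε + x ^ 2) ≤ √ε + x := by
      rw [Real.sqrt_le_left (by have := mem_Ici.1 hx'; positivity)]
      have := Real.sq_sqrt hε.le
      nlinarith [Real.sqrt_nonneg ε, mem_Ici.1 hx', mul_nonneg (Real.sqrt_nonneg ε) (mem_Ici.1 hx')]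
    linarith
  have := hmono (show (0:ℝ) ∈ Ici 0 by simp) (show φ ∈ Ici 0 from hφ) hφ
  simp only [Ureg_zero] at this
  linarith

/-- The properties of the coefficients of the regularised equation `v_t = A(v) v_xx + R(v)`
used below. -/
structure RegCoef (ε : ℝ) (A R : ℝ → ℝ) : Prop where
  pos : ∀ w, 0 < A w
  le : ∀ w, A w ≤ ε + |w|
  even : ∀ w, A (-w) = A w
  odd : ∀ w, R (-w) = -R w
  lipA : ∀ w z, |A w - A z| ≤ |w - z|
  lipR : ∀ w z, |R w - R z| ≤ (1 + 2 * |w| + |z|) * |w - z|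
  absR : ∀ w, |R w| ≤ A w * (1 + |w|)
  R_le : ∀ w, 0 ≤ w → R w ≤ A w
  R_nonpos : ∀ w, -1 ≤ w → w ≤ 0 → R w ≤ 0
  R_neg : ∀ w, 1 + 2 * √ε < w → R w < 0
  closeA : ∀ w, |A w - (|w|)| ≤ ε + 2 * √ε * √|w|
  closeR : ∀ w, |R w - w * (1 - |w|)| ≤ 2 * √ε * √|w| * (1 + 2 * |w|)

theorem regCoef {ε : ℝ} (hε : 0 < ε) {Φ : ℝ → ℝ}
    (hr : Function.RightInverse Φ (Ureg ε)) :
    RegCoef ε (fun w => ε + Φ w ^ 2) (fun w => Φ w * (1 - Φ w ^ 2) * √(ε + Φ w ^ 2)) := by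
  have hsm := strictMono_Ureg hε
  have hneg : ∀ w, Φ (-w) = -Φ w := fun w => hsm.injective (by rw [Ureg_neg, hr, hr])
  have hsq : ∀ w, Φ w ^ 2 ≤ |w| := fun w => by simpa [hr w] using sq_le_abs_Ureg hε (Φ w)
  have hΦpos : ∀ w, 0 ≤ w → 0 ≤ Φ w := fun w hw => by
    rwa [← hsm.le_iff_le, Ureg_zero, hr]
  have habs : ∀ w, Φ |w| = |Φ w| := fun w => by
    rcases le_total 0 w with h | h
    · rw [abs_of_nonneg h, abs_of_nonneg (hΦpos w h)]
    · rw [abs_of_nonpos h, hneg, abs_of_nonpos]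
      have := hΦpos (-w) (by linarith)
      rw [hneg] at this; linarith
  have hΦsq : ∀ w, |Φ w| ≤ √|w| := fun w => Real.abs_le_sqrt (hsq w)
  have hup : ∀ w, |w| ≤ Φ w ^ 2 + 2 * √ε * √|w| := fun w => by
    have := Ureg_le hε (hΦpos |w| (abs_nonneg w))
    rw [hr, habs, sq_abs] at this
    have h2 := mul_le_mul_of_nonneg_left (hΦsq w) (show 0 ≤ 2 * √ε by positivity)
    linarith
  have hsqrt : ∀ w, 0 < √(ε + Φ w ^ 2) := fun w => Real.sqrt_pos.2 (by positivity)
  have hss : ∀ w, √(ε + Φ w ^ 2) * √(ε + Φ w ^ 2) = ε + Φ w ^ 2 :=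
    fun w => Real.mul_self_sqrt (by positivity)
  have hΦs : ∀ w, |Φ w| ≤ √(ε + Φ w ^ 2) := fun w => Real.abs_le_sqrt (by linarith)
  have hk : ∀ w, |Φ w * √(ε + Φ w ^ 2)| ≤ ε + Φ w ^ 2 := fun w => by
    rw [abs_mul, abs_of_pos (hsqrt w)]
    refine le_of_le_of_eq ?_ (hss w)
    exact mul_le_mul_of_nonneg_right (hΦs w) (hsqrt w).le
  have hklip : ∀ w z, |Φ w * √(ε + Φ w ^ 2) - Φ z * √(ε + Φ z ^ 2)| ≤ |w - z| := fun w z => by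
    simpa [hr w, hr z] using mul_sqrt_sub_le_Ureg_sub hε (Φ w) (Φ z)
  have hqlip : ∀ w z, |Φ w ^ 2 - Φ z ^ 2| ≤ |w - z| := fun w z => by
    simpa [hr w, hr z] using sq_sub_sq_le_Ureg_sub hε (Φ w) (Φ z)
  have hklew : ∀ w, |Φ w * √(ε + Φ w ^ 2)| ≤ |w| := fun w => by
    have h0 : Φ 0 = 0 := hsm.injective (by rw [hr, Ureg_zero])
    simpa [h0] using hklip w 0
  have hprod : ∀ w, Φ w * (1 - Φ w ^ 2) * √(ε + Φ w ^ 2)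
      = (Φ w * √(ε + Φ w ^ 2)) * (1 - Φ w ^ 2) := fun w => by ring
  refine ⟨fun w => by positivity, fun w => by linarith [hsq w], fun w => by simp [hneg],
    fun w => by simp only [hneg, even_two, Even.neg_pow]; ring, fun w z => ?_, fun w z => ?_,
    fun w => ?_, fun w hw => ?_, fun w h1 h0 => ?_, fun w hw => ?_, fun w => ?_, fun w => ?_⟩
  · simpa using hqlip w z
  · rw [hprod, hprod]
    set k := Φ w * √(ε + Φ w ^ 2)
    set l := Φ z * √(ε + Φ z ^ 2)
    have e : k * (1 - Φ w ^ 2) - l * (1 - Φ z ^ 2)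
        = (k - l) * (1 - Φ z ^ 2) + k * (Φ z ^ 2 - Φ w ^ 2) := by ring
    rw [e]
    have h1 : |1 - Φ z ^ 2| ≤ 1 + |z| := by
      rw [abs_le]; constructor <;> nlinarith [hsq z, sq_nonneg (Φ z), abs_nonneg z]
    calc _ ≤ |(k - l) * (1 - Φ z ^ 2)| + |k * (Φ z ^ 2 - Φ w ^ 2)| := abs_add_le _ _
      _ ≤ |w - z| * (1 + |z|) + |w| * |w - z| := by
          rw [abs_mul, abs_mul, abs_sub_comm (Φ z ^ 2)]
          exact add_le_add (mul_le_mul (hklip w z) h1 (abs_nonneg _) (abs_nonneg _))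
            (mul_le_mul (hklew w) (hqlip w z) (abs_nonneg _) (abs_nonneg _))
      _ ≤ _ := by nlinarith [abs_nonneg w, abs_nonneg (w - z), mul_nonneg (abs_nonneg w) (abs_nonneg (w - z))]
  · rw [hprod, abs_mul]
    have h1 : |1 - Φ w ^ 2| ≤ 1 + |w| := by
      rw [abs_le]; constructor <;> nlinarith [hsq w, sq_nonneg (Φ w), abs_nonneg w]
    exact mul_le_mul (hk w) h1 (abs_nonneg _) (by positivity)
  · rw [hprod]
    have h1 := hk w
    have h2 : 0 ≤ Φ w * √(ε + Φ w ^ 2) := mul_nonneg (hΦpos w hw) (hsqrt w).le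
    rw [abs_of_nonneg h2] at h1
    nlinarith [mul_nonneg h2 (sq_nonneg (Φ w))]
  · have h2 : Φ w ^ 2 ≤ 1 := by
      have := hsq w
      rw [abs_of_nonpos h0] at this; linarith
    have h3 : Φ w ≤ 0 := by
      have := hΦpos (-w) (by linarith)
      rw [hneg] at this; linarith
    have := hsqrt w
    exact mul_nonpos_of_nonpos_of_nonneg
      (mul_nonpos_of_nonpos_of_nonneg h3 (by linarith)) this.le
  · have h1 : 1 < Φ w := by
      rw [← hsm.lt_iff_lt, hr]
      have := Ureg_le hε (zero_le_one)
      linarith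
    have := hsqrt w
    refine mul_neg_of_neg_of_pos (mul_neg_of_pos_of_neg (by linarith) ?_) this
    nlinarith
  · rw [abs_le]
    have : 0 ≤ 2 * √ε * √|w| := by positivity
    constructor <;> linarith [hup w, hsq w]
  · rw [hprod]
    set k := Φ w * √(ε + Φ w ^ 2) with hkdef
    have hwk : |k - w| ≤ 2 * √ε * √|w| := by
      have hka : |k| = |Φ w| * √(ε + Φ w ^ 2) := by
        rw [hkdef, abs_mul, abs_of_pos (hsqrt w)]
      have hlow : Φ w ^ 2 ≤ |k| := by
        rw [hka]
        refine le_of_eq_of_le (b := |Φ w| * |Φ w|) (by rw [← sq, sq_abs]) ?_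
        exact mul_le_mul_of_nonneg_left (hΦs w) (abs_nonneg _)
      have hup' := hup w
      have hle := hklew w
      rcases le_total 0 w with h | h
      · have : 0 ≤ k := mul_nonneg (hΦpos w h) (hsqrt w).le
        rw [abs_of_nonneg this] at hlow hle
        rw [abs_of_nonneg h] at hup' hle ⊢
        rw [abs_le]; constructor <;> linarith
      · have : k ≤ 0 := by
          have := hΦpos (-w) (by linarith)
          rw [hneg] at this
          exact mul_nonpos_of_nonpos_of_nonneg (by linarith) (hsqrt w).le
        rw [abs_of_nonpos this] at hlow hle
        rw [abs_of_nonpos h] at hup' hle ⊢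
        rw [abs_le]; constructor <;> linarith
    have e : k * (1 - Φ w ^ 2) - w * (1 - |w|)
        = (k - w) * (1 - |w|) + k * (|w| - Φ w ^ 2) := by ring
    rw [e]
    have h1 : |1 - (|w|)| ≤ 1 + |w| := by
      rw [abs_le]; constructor <;> linarith [abs_nonneg w]
    have h2 : |(|w| - Φ w ^ 2)| ≤ 2 * √ε * √|w| := by
      rw [abs_of_nonneg (by linarith [hsq w])]; linarith [hup w]
    calc _ ≤ |(k - w) * (1 - |w|)| + |k * (|w| - Φ w ^ 2)| := abs_add_le _ _
      _ ≤ (2 * √ε * √|w|) * (1 + |w|) + |w| * (2 * √ε * √|w|) := by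
          rw [abs_mul, abs_mul]
          exact add_le_add (mul_le_mul hwk h1 (abs_nonneg _) (by positivity))
            (mul_le_mul (hklew w) h2 (abs_nonneg _) (abs_nonneg _))
      _ = _ := by ring

section

/-- A solution of `v_t = A(v) v_xx + R(v)` in `(a,b) × (0,T]`, continuous up to the boundary,
whose lateral boundary values are constant in time. -/
structure RegSol (a b T : ℝ) (A R : ℝ → ℝ) (v : ℝ → ℝ → ℝ) : Prop where
  cont : ContinuousOn (fun p : ℝ × ℝ => v p.1 p.2) (Icc a b ×ˢ Icc 0 T)
  reg : ∀ x ∈ Ioo a b, ∀ t ∈ Ioc 0 T, ∃ vt vxx, C21At v x t vt vxx ∧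
    vt = A (v x t) * vxx + R (v x t)
  left : ∀ t ∈ Icc 0 T, v a t = v a 0
  right : ∀ t ∈ Icc 0 T, v b t = v b 0

/-- A solution of the equation with parameter `ε` which is bounded by `M`. -/
structure RegBdd (ε a b T M : ℝ) (A R : ℝ → ℝ) (v : ℝ → ℝ → ℝ) : Prop where
  coef : RegCoef ε A R
  sol : RegSol a b T A R v
  bdd : ∀ x ∈ Icc a b, ∀ t ∈ Icc 0 T, |v x t| ≤ M

variable {ε a b T M : ℝ} {A R : ℝ → ℝ} {v : ℝ → ℝ → ℝ}

theorem RegSol.neg (hc : RegCoef ε A R) (h : RegSol a b T A R v) :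
    RegSol a b T A R fun x t => -v x t where
  cont := h.cont.neg
  reg x hx t ht := by
    obtain ⟨vt, vxx, h1, h2⟩ := h.reg x hx t ht
    refine ⟨_, _, h1.neg, ?_⟩
    rw [hc.even, hc.odd, h2]; ring
  left t ht := by rw [h.left t ht]
  right t ht := by rw [h.right t ht]

theorem RegBdd.neg (h : RegBdd ε a b T M A R v) : RegBdd ε a b T M A R fun x t => -v x t where
  coef := h.coef
  sol := h.sol.neg h.coef
  bdd x hx t ht := by rw [abs_neg]; exact h.bdd x hx t ht

theorem RegSol.lt_const (hab : a ≤ b) (hc : RegCoef ε A R) (h : RegSol a b T A R v)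
    (hM : 1 + 2 * √ε < M) (h0 : ∀ x ∈ Icc a b, v x 0 < M) :
    ∀ x ∈ Icc a b, ∀ t ∈ Icc 0 T, v x t < M := by
  have key := lt_barrier (f := fun _ => M) (f' := 0) (f'' := 0) (g := 0) (g' := 0) h.cont
    (fun y => hasDerivAt_const _ _) (fun y => hasDerivAt_const _ _)
    (fun y => hasDerivAt_const _ _)
    (fun t ht => by rw [h.left t ht]; simpa using h0 a (left_mem_Icc.2 hab))
    (fun t ht => by rw [h.right t ht]; simpa using h0 b (right_mem_Icc.2 hab))
    (by simpa using h0) (fun x hx t ht heq => by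
      obtain ⟨vt, vxx, h1, h2⟩ := h.reg x hx t ht
      refine ⟨vt, vxx, h1, fun _ h3 => ?_⟩
      simp only [Pi.zero_apply, add_zero] at *
      rw [h2, heq]
      nlinarith [hc.R_neg M hM, hc.pos M])
  simpa using key

theorem RegBdd.lt_linear (h : RegBdd ε a b T M A R v) {l r e σ α K : ℝ} (hal : a ≤ l) (hrb : r ≤ b)
    (hσ : σ = 1 ∨ σ = -1) (he : e ∈ Icc a b) (hle : ∀ x ∈ Icc l r, 0 ≤ σ * (x - e)) (hlr : l ≤ r)
    (hl : ∀ t ∈ Icc 0 T, v l t < α + K * (σ * (l - e)))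
    (hr : ∀ t ∈ Icc 0 T, v r t < α + K * (σ * (r - e)))
    (h0 : ∀ x ∈ Icc l r, v x 0 < α + K * (σ * (x - e))) :
    ∀ x ∈ Icc l r, ∀ t ∈ Icc 0 T,
      v x t < α + (K + (1 + M) * (b - a)) * (σ * (x - e)) := by
  intro x₁ hx₁ t₁ ht₁
  have hM : 0 ≤ M := (abs_nonneg _).trans (h.bdd x₁ ⟨hal.trans hx₁.1, hx₁.2.trans hrb⟩ t₁ ht₁)
  set K' := K + (1 + M) * (b - a) with hK'
  have hσ2 : σ * σ = 1 := by rcases hσ with h | h <;> rw [h] <;> norm_num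
  have hsq : ∀ x ∈ Icc l r, (x - e) ^ 2 ≤ (b - a) * (σ * (x - e)) := fun x hx => by
    have h1 := hle x hx
    have h2 : σ * (x - e) ≤ b - a := by
      rcases hσ with h | h <;> rw [h] <;> linarith [hx.1, hx.2, he.1, he.2]
    calc (x - e) ^ 2 = (σ * (x - e)) * (σ * (x - e)) := by
          linear_combination (-(x - e) ^ 2) * hσ2
      _ ≤ _ := mul_le_mul_of_nonneg_right h2 h1
  have hcmp : ∀ x ∈ Icc l r, α + K * (σ * (x - e)) ≤
      (α + K' * (σ * (x - e)) - (1 + M) * (x - e) ^ 2) + 0 := fun x hx => by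
    have := mul_le_mul_of_nonneg_left (hsq x hx) (show 0 ≤ 1 + M by linarith)
    rw [hK']; linarith
  have key := lt_barrier (t₀ := 0) (t₁ := T) (v := v)
    (f := fun x => α + K' * (σ * (x - e)) - (1 + M) * (x - e) ^ 2)
    (f' := fun x => K' * σ - (1 + M) * (2 * (x - e))) (f'' := fun _ => - (1 + M) * 2)
    (g := fun _ => 0) (g' := fun _ => 0)
    (h.sol.cont.mono (prod_mono (Icc_subset_Icc hal hrb) subset_rfl))
    (fun y => by
      have h1 := (hasDerivAt_id y).sub_const e
      have h2 := (((h1.const_mul σ).const_mul K').const_add α).sub ((h1.pow 2).const_mul (1 + M))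
      refine h2.congr_deriv ?_
      simp)
    (fun y => by
      have h1 := (hasDerivAt_id y).sub_const e
      have h2 := ((h1.const_mul 2).const_mul (1 + M)).const_sub (K' * σ)
      refine h2.congr_deriv ?_
      ring)
    (fun y => hasDerivAt_const _ _)
    (fun t ht => (hl t ht).trans_le (hcmp l (left_mem_Icc.2 hlr)))
    (fun t ht => (hr t ht).trans_le (hcmp r (right_mem_Icc.2 hlr)))
    (fun x hx => (h0 x hx).trans_le (hcmp x hx))
    (fun x hx t ht _ => by
      have hx' : x ∈ Ioo a b := ⟨hal.trans_lt hx.1, hx.2.trans_le hrb⟩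
      obtain ⟨vt, vxx, h1, h2⟩ := h.sol.reg x hx' t ht
      refine ⟨vt, vxx, h1, fun _ h3 => ?_⟩
      rw [h2]
      have hA := h.coef.pos (v x t)
      have hR := (le_abs_self _).trans (h.coef.absR (v x t))
      have hb := h.bdd x ⟨hx'.1.le, hx'.2.le⟩ t ⟨ht.1.le, ht.2⟩
      nlinarith [mul_le_mul_of_nonneg_left h3 hA.le, mul_le_mul_of_nonneg_left hb hA.le,
        mul_nonneg hA.le hM])
    x₁ hx₁ t₁ ht₁
  nlinarith [sq_nonneg (x₁ - e)]

theorem RegBdd.lt_initial (h : RegBdd ε a b T M A R v) (hε1 : ε ≤ 1) {x₀ α C : ℝ} (hx₀ : x₀ ∈ Icc a b)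
    (hC : 0 ≤ C) (h0 : ∀ x ∈ Icc a b, v x 0 < α + C * (x - x₀) ^ 2) :
    ∀ t ∈ Icc 0 T, v x₀ t < α + (2 * C * (1 + M) + (1 + M) ^ 2 + 1) * t := by
  intro t₁ ht₁
  have hM : 0 ≤ M := (abs_nonneg _).trans (h.bdd x₀ hx₀ t₁ ht₁)
  have hab := hx₀.1.trans hx₀.2
  set C' := 2 * C * (1 + M) + (1 + M) ^ 2 + 1 with hC'
  have hC'0 : 0 ≤ C' := by positivity
  have key := lt_barrier (t₀ := 0) (t₁ := T) (v := v)
    (f := fun x => α + C * (x - x₀) ^ 2)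
    (f' := fun x => C * (2 * (x - x₀))) (f'' := fun _ => C * 2)
    (g := fun s => C' * s) (g' := fun _ => C') h.sol.cont
    (fun y => by
      have h1 := (hasDerivAt_id y).sub_const x₀
      refine (((h1.pow 2).const_mul C).const_add α).congr_deriv ?_
      simp)
    (fun y => by
      have h1 := (hasDerivAt_id y).sub_const x₀
      refine ((h1.const_mul 2).const_mul C).congr_deriv ?_
      ring)
    (fun y => by simpa using (hasDerivAt_id y).const_mul C')
    (fun t ht => by
      rw [h.sol.left t ht]
      linarith [h0 a (left_mem_Icc.2 hab), mul_nonneg hC'0 ht.1])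
    (fun t ht => by
      rw [h.sol.right t ht]
      linarith [h0 b (right_mem_Icc.2 hab), mul_nonneg hC'0 ht.1])
    (fun x hx => by simpa using h0 x hx)
    (fun x hx t ht _ => by
      obtain ⟨vt, vxx, h1, h2⟩ := h.sol.reg x hx t ht
      refine ⟨vt, vxx, h1, fun _ h3 => ?_⟩
      rw [h2]
      have hb := h.bdd x ⟨hx.1.le, hx.2.le⟩ t ⟨ht.1.le, ht.2⟩
      have hA := h.coef.pos (v x t)
      have hA1 : A (v x t) ≤ 1 + M := (h.coef.le _).trans (by linarith)
      have hR := (le_abs_self _).trans (h.coef.absR (v x t))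
      have e1 : A (v x t) * vxx ≤ (1 + M) * (C * 2) :=
        (mul_le_mul_of_nonneg_left h3 hA.le).trans
          (mul_le_mul_of_nonneg_right hA1 (by positivity))
      have e2 : A (v x t) * (1 + |v x t|) ≤ (1 + M) * (1 + M) :=
        mul_le_mul hA1 (by linarith) (by positivity) (by linarith)
      rw [hC']; nlinarith)
    x₀ hx₀ t₁ ht₁
  simpa using key

end

theorem hasDerivAt_quartic (xm ρ y : ℝ) : HasDerivAt
    (fun x => 2 * ((x - xm) / ρ) ^ 2 - ((x - xm) / ρ) ^ 4)
    ((4 * ((y - xm) / ρ) - 4 * ((y - xm) / ρ) ^ 3) / ρ) y := by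
  have h1 := ((hasDerivAt_id y).sub_const xm).div_const ρ
  refine (((h1.pow 2).const_mul 2).sub (h1.pow 4)).congr_deriv ?_
  simp; ring

theorem hasDerivAt_quartic_deriv (xm ρ y : ℝ) : HasDerivAt
    (fun x => (4 * ((x - xm) / ρ) - 4 * ((x - xm) / ρ) ^ 3) / ρ)
    ((4 - 12 * ((y - xm) / ρ) ^ 2) / ρ ^ 2) y := by
  have h1 := ((hasDerivAt_id y).sub_const xm).div_const ρ
  refine (((h1.const_mul 4).sub ((h1.pow 3).const_mul 4)).div_const ρ).congr_deriv ?_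
  simp; ring

set_option maxHeartbeats 1000000 in
/-- Negativity at a point persists if the initial value is negative nearby: the comparison is
made for `X(v)` where `X' = 1/p` with a weight `p` that is large on `[θ, ∞)`. -/
theorem RegBdd.neg_of_weight {ε a b T M : ℝ} {A R : ℝ → ℝ} {v : ℝ → ℝ → ℝ}
    (h : RegBdd ε a b T M A R v) {xm ρ c θ B s σ : ℝ} {p p' : ℝ → ℝ} (hρ : 0 < ρ)
    (hε : 0 < ε)
    (hl : a ≤ xm - ρ) (hr : xm + ρ ≤ b) (hc : 0 < c) (hc1 : c ≤ 1) (hs : 0 < s)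
    (hsT : s * T ≤ 1 / 8)
    (h0 : ∀ x ∈ Icc (xm - ρ) (xm + ρ), v x 0 < -c) (hp : ∀ w, HasDerivAt p (p' w) w)
    (hpc : Continuous p) (hp0 : ∀ w, 8 * c / 7 ≤ p w) (hpneg : ∀ w ≤ 0, p w = 8 * c / 7)
    (hp'neg : ∀ w ≤ 0, p' w = 0) (hp'nn : ∀ w, 0 ≤ p' w)
    (hp'le : ∀ w, 0 ≤ w → (ε + w) * p' w ≤ 2 * σ) (hpB : ∀ w, θ ≤ w → B ≤ p w)
    (hθ : 0 ≤ θ) (hθM : θ ≤ M)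
    (hσ : 32 * σ ≤ s * ρ ^ 2 / 4) (hcs : (ε + c) * 4 < s * ρ ^ 2)
    (hθ1 : θ / (8 * c / 7) ≤ 1 / 32) (hB0 : 0 < B)
    (hBM : M / B ≤ 1 / 32) (hBρ : ρ ^ 2 ≤ 2 * B) (hθε : (ε + θ) / (8 * c / 7) ≤ s / 2) :
    ∀ t ∈ Icc 0 T, v xm t < -(c / 2) := by
  have hp0' : (0 : ℝ) < 8 * c / 7 := by positivity
  have hpp : ∀ w, 0 < p w := fun w => hp0'.trans_le (hp0 w)
  have hM : 0 ≤ M := hθ.trans hθM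
  have hinv : Continuous fun w => (p w)⁻¹ := hpc.inv₀ fun w => (hpp w).ne'
  set X : ℝ → ℝ := fun w => ∫ z in (0 : ℝ)..w, (p z)⁻¹ with hX
  have hXd : ∀ w, HasDerivAt X (p w)⁻¹ w := fun w =>
    intervalIntegral.integral_hasDerivAt_right (hinv.intervalIntegrable _ _)
      (hinv.stronglyMeasurableAtFilter _ _) hinv.continuousAt
  have hXmono : StrictMono X := strictMono_of_hasDerivAt_pos hXd fun w => inv_pos.2 (hpp w)
  have hX0 : X 0 = 0 := by simp [hX]
  have hXneg : ∀ w ≤ 0, X w = w * (8 * c / 7)⁻¹ := fun w hw => by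
    have : X w = ∫ z in (0 : ℝ)..w, (8 * c / 7)⁻¹ := by
      refine intervalIntegral.integral_congr fun z hz => ?_
      rw [uIcc_of_ge hw] at hz
      rw [hpneg z hz.2]
    rw [this, intervalIntegral.integral_const]
    simp
  have hXc : X (-c) = -(7 / 8) := by
    rw [hXneg _ (by linarith)]; field_simp
  have hXdiff : Differentiable ℝ X := fun w => (hXd w).differentiableAt
  have hXθ : X θ ≤ 1 / 32 := by
    have := (convex_univ (𝕜 := ℝ) (E := ℝ)).image_sub_le_mul_sub_of_deriv_le
      hXdiff.continuous.continuousOn hXdiff.differentiableOn (C := (8 * c / 7)⁻¹)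
      (fun w _ => by rw [(hXd w).deriv]; exact inv_anti₀ hp0' (hp0 w)) 0 (mem_univ _) θ
      (mem_univ _) hθ
    rw [hX0] at this
    rw [div_eq_inv_mul] at hθ1
    linarith
  have hXM : X M ≤ 1 / 16 := by
    have := (convex_Ici (𝕜 := ℝ) θ).image_sub_le_mul_sub_of_deriv_le
      hXdiff.continuous.continuousOn hXdiff.differentiableOn (C := B⁻¹)
      (fun w hw => by
        rw [(hXd w).deriv]; exact inv_anti₀ hB0 (hpB w (interior_subset hw))) θ self_mem_Ici M
      hθM hθM
    rw [div_eq_inv_mul] at hBM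
    have h2 : B⁻¹ * (M - θ) ≤ B⁻¹ * M :=
      mul_le_mul_of_nonneg_left (by linarith) (inv_pos.2 hB0).le
    linarith
  have hle : xm - ρ ≤ xm + ρ := by linarith
  have hsub : Icc (xm - ρ) (xm + ρ) ⊆ Icc a b := Icc_subset_Icc hl hr
  have hbd : ∀ x ∈ Icc (xm - ρ) (xm + ρ), ∀ t ∈ Icc 0 T, X (v x t) ≤ 1 / 16 := fun x hx t ht =>
    (hXmono.monotone ((le_abs_self _).trans (h.bdd x (hsub hx) t ht))).trans hXM
  have hy : ∀ x ∈ Icc (xm - ρ) (xm + ρ), ((x - xm) / ρ) ^ 2 ≤ 1 := fun x hx => by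
    rw [div_pow, div_le_one (by positivity), sq_le_sq, abs_of_pos hρ]
    exact abs_le.2 ⟨by linarith [hx.1], by linarith [hx.2]⟩
  have key := lt_barrier (t₀ := 0) (t₁ := T) (v := fun x t => X (v x t))
    (g := fun t => s * t - 7 / 8) (g' := fun _ => s)
    (hXdiff.continuous.comp_continuousOn (h.sol.cont.mono (prod_mono hsub subset_rfl)))
    (hasDerivAt_quartic xm ρ) (hasDerivAt_quartic_deriv xm ρ)
    (fun y => by simpa using ((hasDerivAt_id y).const_mul s).sub_const (7 / 8))
    (fun t ht => by
      have h1 := hbd _ (left_mem_Icc.2 hle) t ht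
      have h2 : (xm - ρ - xm) / ρ = -1 := by field_simp; ring
      rw [h2]
      nlinarith [mul_nonneg hs.le ht.1])
    (fun t ht => by
      have h1 := hbd _ (right_mem_Icc.2 hle) t ht
      have h2 : (xm + ρ - xm) / ρ = 1 := by field_simp; ring
      rw [h2]
      nlinarith [mul_nonneg hs.le ht.1])
    (fun x hx => by
      have h1 := hXmono (h0 x hx)
      have h2 := hy x hx
      rw [hXc] at h1
      nlinarith [sq_nonneg ((x - xm) / ρ)])
    (fun x hx t ht heq => by
      have hx' : x ∈ Ioo a b := ⟨hl.trans_lt hx.1, hx.2.trans_le hr⟩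
      obtain ⟨vt, vxx, h1, h2⟩ := h.sol.reg x hx' t ht
      have hdinv := (hp (v x t)).inv (hpp _).ne'
      refine ⟨_, _, h1.comp hXd hdinv, ?_⟩
      rw [h1.deriv_comp (hXd _)]
      intro h3 h4
      have hyx := hy x (Ioo_subset_Icc_self hx)
      set w := v x t with hw
      set y := (x - xm) / ρ with hyd
      set P := p w with hP
      have hPp : 0 < P := hpp w
      set d := deriv (fun y => v y t) x with hd
      have hA := h.coef.pos w
      have hAl := h.coef.le w
      rw [h2]
      have hst : s * t ≤ 1 / 8 := (mul_le_mul_of_nonneg_left ht.2 hs.le).trans hsT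
      have hst0 : 0 ≤ s * t := mul_nonneg hs.le ht.1.le
      have h4' : P⁻¹ * vxx ≤ (4 - 12 * y ^ 2) / ρ ^ 2 +
          p' w * ((4 * y - 4 * y ^ 3) / ρ) ^ 2 := by
        rw [← h3]
        have : -p' w / P ^ 2 * d ^ 2 = -(p' w * (P⁻¹ * d) ^ 2) := by field_simp
        linarith
      have hmain := mul_le_mul_of_nonneg_left h4' hA.le
      have hgoal : P⁻¹ * (A w * vxx + R w) = A w * (P⁻¹ * vxx) + P⁻¹ * R w := by ring
      rw [hgoal]
      have hρ2 : 0 < ρ ^ 2 := by positivity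
      rcases lt_or_ge w 0 with hw0 | hw0
      · have hwc : -c ≤ w := by
          rw [← hXmono.le_iff_le, hXc]
          change X w = _ at heq
          rw [heq]; linarith [mul_nonneg (sq_nonneg y) (show 0 ≤ 2 - y ^ 2 by linarith)]
        have hR := h.coef.R_nonpos w (by linarith) hw0.le
        rw [hp'neg w hw0.le] at hmain
        have e1 : P⁻¹ * R w ≤ 0 := mul_nonpos_of_nonneg_of_nonpos (inv_pos.2 hPp).le hR
        have e2 : A w * ((4 - 12 * y ^ 2) / ρ ^ 2) ≤ (ε + c) * (4 / ρ ^ 2) := by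
          rw [abs_of_neg hw0] at hAl
          calc _ ≤ A w * (4 / ρ ^ 2) := by gcongr; nlinarith [sq_nonneg y]
            _ ≤ _ := by gcongr; linarith
        have e3 : (ε + c) * (4 / ρ ^ 2) < s := by
          rw [← mul_div_assoc, div_lt_iff₀ hρ2]; exact hcs
        linarith
      · have hw1 : 3 / 4 ≤ 2 * y ^ 2 - y ^ 4 := by
          have := hXmono.monotone hw0
          rw [hX0] at this
          change X w = _ at heq
          linarith
        have hy2 : 1 / 2 ≤ y ^ 2 := by nlinarith
        rw [abs_of_nonneg hw0] at hAl
        have e1 : P⁻¹ * R w ≤ A w * P⁻¹ := by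
          rw [mul_comm]
          exact mul_le_mul_of_nonneg_right (h.coef.R_le w hw0) (inv_pos.2 hPp).le
        have e2 : (4 - 12 * y ^ 2) / ρ ^ 2 ≤ -(2 / ρ ^ 2) := by
          rw [← neg_div]; gcongr; linarith
        have e3 : ((4 * y - 4 * y ^ 3) / ρ) ^ 2 ≤ 16 / ρ ^ 2 := by
          rw [div_pow]; gcongr
          have : (4 * y - 4 * y ^ 3) ^ 2 = 16 * (y ^ 2 * (1 - y ^ 2) ^ 2) := by ring
          nlinarith [mul_nonneg (sq_nonneg y) (sq_nonneg (1 - y ^ 2))]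
        have e4 : A w * (p' w * ((4 * y - 4 * y ^ 3) / ρ) ^ 2) ≤ s / 4 := by
          calc A w * (p' w * ((4 * y - 4 * y ^ 3) / ρ) ^ 2)
              ≤ (ε + w) * (p' w * (16 / ρ ^ 2)) := by
                have := hp'nn w
                gcongr
            _ = ((ε + w) * p' w) * (16 / ρ ^ 2) := by ring
            _ ≤ 2 * σ * (16 / ρ ^ 2) :=
                mul_le_mul_of_nonneg_right (hp'le w hw0) (by positivity)
            _ = 32 * σ / ρ ^ 2 := by ring
            _ ≤ s / 4 := by rw [div_le_iff₀ hρ2]; linarith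
        have e5 : A w * (P⁻¹ - 2 / ρ ^ 2) ≤ s / 2 := by
          rcases le_total w θ with hwθ | hwθ
          · calc A w * (P⁻¹ - 2 / ρ ^ 2) ≤ A w * P⁻¹ := by
                  gcongr; linarith [show 0 ≤ 2 / ρ ^ 2 by positivity]
              _ ≤ (ε + θ) * (8 * c / 7)⁻¹ := by
                  have := hp0 w
                  gcongr; linarith
              _ ≤ _ := by rw [← div_eq_mul_inv]; exact hθε
          · have : P⁻¹ ≤ 2 / ρ ^ 2 := by
              rw [← inv_div]
              exact inv_anti₀ (by positivity) (by linarith [hpB w hwθ])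
            exact (mul_nonpos_of_nonneg_of_nonpos hA.le (by linarith)).trans (by positivity)
        have e6 : A w * ((4 - 12 * y ^ 2) / ρ ^ 2) ≤ A w * (-(2 / ρ ^ 2)) :=
          mul_le_mul_of_nonneg_left e2 hA.le
        rw [mul_add] at hmain
        rw [mul_sub] at e5
        rw [mul_neg] at e6
        linarith)
  intro t ht
  have h1 := key xm ⟨by linarith, by linarith⟩ t ht
  have hX2 : X (-(c / 2)) = -(7 / 16) := by
    rw [hXneg _ (by linarith)]; field_simp; norm_num
  rw [← hXmono.lt_iff_lt, hX2]
  have hst : s * t ≤ 1 / 8 := (mul_le_mul_of_nonneg_left ht.2 hs.le).trans hsT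
  simp at h1
  linarith

/-- The weight used for `RegBdd.neg_of_weight`. -/
noncomputable def logWeight (p₀ σ ε w : ℝ) : ℝ :=
  p₀ + σ / 2 * Real.log (1 + (max w 0) ^ 2 / ε ^ 2)

theorem hasDerivAt_max_sq (w : ℝ) : HasDerivAt (fun w : ℝ => (max w 0) ^ 2) (2 * max w 0) w := by
  have h : (fun w : ℝ => (max w 0) ^ 2) = fun w => (w ^ 2 + w * |w|) / 2 := by
    funext w
    rcases le_total w 0 with h | h
    · rw [max_eq_right h, abs_of_nonpos h]; ring
    · rw [max_eq_left h, abs_of_nonneg h]; ring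
  have h2 : HasDerivAt (fun w : ℝ => w * |w|) (2 * |w|) w := by
    rcases lt_trichotomy w 0 with hw | hw | hw
    · have : (fun w : ℝ => w * |w|) =ᶠ[𝓝 w] fun w => -(w ^ 2) := by
        filter_upwards [gt_mem_nhds hw] with z hz
        rw [abs_of_neg hz]; ring
      refine HasDerivAt.congr_of_eventuallyEq ?_ this
      rw [abs_of_neg hw]
      exact (hasDerivAt_pow 2 w).neg.congr_deriv (by simp)
    · subst hw
      rw [hasDerivAt_iff_tendsto_slope]
      simp only [abs_zero, mul_zero]
      have : Tendsto (fun z : ℝ => |z|) (𝓝[≠] 0) (𝓝 0) := by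
        have := (continuous_abs (G := ℝ)).tendsto 0
        rw [abs_zero] at this
        exact this.mono_left nhdsWithin_le_nhds
      refine this.congr' ?_
      filter_upwards [self_mem_nhdsWithin] with z hz
      have hz' : z ≠ 0 := hz
      rw [slope_def_field]; field_simp; simp
    · have : (fun w : ℝ => w * |w|) =ᶠ[𝓝 w] fun w => w ^ 2 := by
        filter_upwards [lt_mem_nhds hw] with z hz
        rw [abs_of_pos hz]; ring
      refine HasDerivAt.congr_of_eventuallyEq ?_ this
      rw [abs_of_pos hw]
      simpa using hasDerivAt_pow 2 w
  rw [h]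
  refine (((hasDerivAt_pow 2 w).add h2).div_const 2).congr_deriv ?_
  rcases le_total w 0 with h | h
  · rw [max_eq_right h, abs_of_nonpos h]; simp
  · rw [max_eq_left h, abs_of_nonneg h]; simp

theorem hasDerivAt_logWeight {ε : ℝ} (hε : 0 < ε) (p₀ σ w : ℝ) :
    HasDerivAt (logWeight p₀ σ ε) (σ * max w 0 / (ε ^ 2 + (max w 0) ^ 2)) w := by
  have hpos : (0 : ℝ) < 1 + (max w 0) ^ 2 / ε ^ 2 := by positivity
  have h := (((((hasDerivAt_max_sq w).div_const (ε ^ 2)).const_add 1).log hpos.ne').const_mul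
    (σ / 2)).const_add p₀
  refine h.congr_deriv ?_
  field_simp

/-- If `v(·,0) < -c₀` near `xm` uniformly in `ε`, then `v` is bounded away from `0` on the line
segments through the points near `xm`, for small `ε`. -/
theorem eventually_neg_at {a b T M : ℝ} {A R : ℝ → ℝ → ℝ} {v : ℝ → ℝ → ℝ → ℝ}
    (h : ∀ᶠ ε in 𝓝[>] (0:ℝ), RegBdd ε a b T M (A ε) (R ε) (v ε)) (hT : 0 < T) (hM : 1 ≤ M)
    {xm ρ c₀ : ℝ} (hρ : 0 < ρ) (hc₀ : 0 < c₀) (hl : a ≤ xm - 2 * ρ) (hr : xm + 2 * ρ ≤ b)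
    (h0 : ∀ᶠ ε in 𝓝[>] (0:ℝ), ∀ x ∈ Icc (xm - 2 * ρ) (xm + 2 * ρ), v ε x 0 < -c₀) :
    ∃ c > 0, ∀ᶠ ε in 𝓝[>] (0:ℝ), ∀ x ∈ Icc (xm - ρ) (xm + ρ), ∀ t ∈ Icc 0 T, v ε x t < -c := by
  set s := 1 / (8 * T) with hs
  have hs0 : 0 < s := by positivity
  set c := min (min 1 c₀) (s * ρ ^ 2 / 16) with hc
  have hc0 : 0 < c := by positivity
  have hc1 : c ≤ 1 := (min_le_left _ _).trans (min_le_left _ _)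
  have hcc : c ≤ c₀ := (min_le_left _ _).trans (min_le_right _ _)
  have hcs : c ≤ s * ρ ^ 2 / 16 := min_le_right _ _
  set θ := min (c / 32) (c * s / 4) with hθ
  have hθ0 : 0 < θ := by positivity
  have hθ1 : θ ≤ c / 32 := min_le_left _ _
  have hθ2 : θ ≤ c * s / 4 := min_le_right _ _
  set σ := s * ρ ^ 2 / 128 with hσ
  have hσ0 : 0 < σ := by positivity
  set B := 32 * M + ρ ^ 2 with hB
  have hB0 : 0 < B := by positivity
  have hlim : Tendsto (fun ε : ℝ => logWeight (8 * c / 7) σ ε θ) (𝓝[>] 0) atTop := by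
    unfold logWeight
    refine tendsto_atTop_add_const_left _ _ ?_
    refine Tendsto.const_mul_atTop (by positivity) ?_
    refine Real.tendsto_log_atTop.comp ?_
    refine tendsto_atTop_add_const_left _ _ ?_
    have : Tendsto (fun ε : ℝ => (ε⁻¹) ^ 2) (𝓝[>] 0) atTop :=
      (tendsto_pow_atTop two_ne_zero).comp tendsto_inv_nhdsGT_zero
    rw [max_eq_left hθ0.le]
    refine (this.const_mul_atTop (show 0 < θ ^ 2 by positivity)).congr fun ε => ?_
    rw [inv_pow, div_eq_mul_inv]
  have hsmall : ∀ᶠ ε in 𝓝[>] (0:ℝ), ε < min θ c :=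
    nhdsWithin_le_nhds (gt_mem_nhds (by positivity))
  refine ⟨c / 2, by positivity, ?_⟩
  filter_upwards [h, h0, hlim.eventually_ge_atTop B, hsmall, self_mem_nhdsWithin]
    with ε h1 h2 h3 h4 hε x₁ hx₁
  have hε0 : (0:ℝ) < ε := hε
  have hεθ : ε < θ := h4.trans_le (min_le_left _ _)
  have hεc : ε < c := h4.trans_le (min_le_right _ _)
  have hmono : ∀ w w' : ℝ, w ≤ w' →
      logWeight (8 * c / 7) σ ε w ≤ logWeight (8 * c / 7) σ ε w' := fun w w' hww => by
    unfold logWeight; gcongr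
  have hneg : ∀ w ≤ 0, logWeight (8 * c / 7) σ ε w = 8 * c / 7 := fun w hw => by
    simp [logWeight, max_eq_right hw]
  refine h1.neg_of_weight (ρ := ρ) (c := c) (θ := θ) (B := B) (s := s) (σ := σ)
    (p := logWeight (8 * c / 7) σ ε) hρ hε0
    (by linarith [hx₁.1]) (by linarith [hx₁.2]) hc0 hc1 hs0 ?_ ?_
    (hasDerivAt_logWeight hε0 _ _) ?_ ?_ hneg ?_ ?_ ?_
    (fun w hw => h3.trans (hmono _ _ hw)) hθ0.le ?_ ?_ ?_ ?_ hB0 ?_ ?_ ?_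
  · rw [hs]; field_simp; rfl
  · exact fun x hx => (h2 x ⟨by linarith [hx.1, hx₁.1], by linarith [hx.2, hx₁.2]⟩).trans_le
      (by linarith)
  · exact continuous_iff_continuousAt.2 fun w => (hasDerivAt_logWeight hε0 _ _ w).continuousAt
  · intro w
    rcases le_total w 0 with hw | hw
    · exact (hneg w hw).ge
    · exact (hneg 0 le_rfl).ge.trans (hmono _ _ hw)
  · intro w hw; simp [max_eq_right hw]
  · intro w; positivity
  · intro w hw
    rw [max_eq_left hw, ← mul_div_assoc, div_le_iff₀ (by positivity)]
    nlinarith [sq_nonneg (ε - w), mul_nonneg hσ0.le (sq_nonneg (ε - w)),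
      mul_nonneg hσ0.le (sq_nonneg (ε + w)), mul_nonneg hσ0.le (sq_nonneg ε),
      mul_nonneg hσ0.le (sq_nonneg w)]
  · linarith
  · rw [hσ]; linarith
  · have : 0 < s * ρ ^ 2 := by positivity
    linarith
  · rw [div_le_iff₀ (by positivity)]; linarith
  · rw [div_le_iff₀ hB0, hB]; nlinarith [sq_nonneg ρ]
  · rw [hB]; nlinarith [sq_nonneg ρ]
  · rw [div_le_iff₀ (by positivity)]; nlinarith [mul_pos hc0 hs0]

/-- A family of solutions, bounded by `M`, of the regularised equations whose initial values
converge uniformly to a function with finitely many zeros, all of them sign changes. -/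
structure RegFamily (a b T M : ℝ) (N₀ : Set ℝ) (u₀ : ℝ → ℝ) (A R : ℝ → ℝ → ℝ)
    (v : ℝ → ℝ → ℝ → ℝ) : Prop where
  lt : a < b
  pos : 0 < T
  one_le : 1 ≤ M
  ev : ∀ᶠ ε in 𝓝[>] (0:ℝ), RegBdd ε a b T M (A ε) (R ε) (v ε)
  cont : ContinuousOn u₀ (Icc a b)
  fin : N₀.Finite
  sub : N₀ ⊆ Ioo a b
  zero : ∀ x ∈ N₀, u₀ x = 0
  sign_change : ∀ x ∈ N₀, ∀ δ > 0,
    ∃ y ∈ Ioo (x - δ) x, ∃ z ∈ Ioo x (x + δ), u₀ y * u₀ z < 0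
  conv : TendstoUniformlyOn (fun ε x => v ε x 0) u₀ (𝓝[>] (0:ℝ)) (Icc a b)

namespace RegFamily

variable {a b T M : ℝ} {N₀ : Set ℝ} {u₀ : ℝ → ℝ} {A R : ℝ → ℝ → ℝ} {v : ℝ → ℝ → ℝ → ℝ}

theorem neg (h : RegFamily a b T M N₀ u₀ A R v) :
    RegFamily a b T M N₀ (fun x => -u₀ x) A R fun ε x t => -v ε x t where
  lt := h.lt
  pos := h.pos
  one_le := h.one_le
  ev := h.ev.mono fun _ hε => hε.neg
  cont := h.cont.neg
  fin := h.fin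
  sub := h.sub
  zero x hx := by rw [h.zero x hx, neg_zero]
  sign_change x hx δ hδ := by simpa using h.sign_change x hx δ hδ
  conv := by
    rw [Metric.tendstoUniformlyOn_iff] at *
    intro e he
    filter_upwards [Metric.tendstoUniformlyOn_iff.1 h.conv e he] with ε hε x hx
    simpa [dist_neg_neg] using hε x hx

theorem initial_close (h : RegFamily a b T M N₀ u₀ A R v) {δ : ℝ} (hδ : 0 < δ) :
    ∀ᶠ ε in 𝓝[>] (0:ℝ), ∀ x ∈ Icc a b, v ε x 0 < u₀ x + δ := by
  filter_upwards [Metric.tendstoUniformlyOn_iff.1 h.conv δ hδ] with ε hε x hx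
  have := hε x hx
  rw [Real.dist_eq, abs_lt] at this
  linarith [this.1]

theorem abs_initial_le (h : RegFamily a b T M N₀ u₀ A R v) : ∀ x ∈ Icc a b, |u₀ x| ≤ M := by
  intro x hx
  have hc : Tendsto (fun ε => |v ε x 0|) (𝓝[>] (0:ℝ)) (𝓝 |u₀ x|) :=
    (h.conv.tendsto_at hx).abs
  exact le_of_tendsto hc (h.ev.mono fun ε hε => hε.bdd x hx 0 ⟨le_rfl, h.pos.le⟩)

theorem eventually_lt_linear (h : RegFamily a b T M N₀ u₀ A R v) {e σ r₀ c δ : ℝ}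
    (hσ : σ = 1 ∨ σ = -1) (he : e ∈ Icc a b) (he' : e + σ * r₀ ∈ Icc a b) (hr₀ : 0 < r₀)
    (hc : |c| ≤ M) (hδ : 0 < δ)
    (hev : ∀ᶠ ε in 𝓝[>] (0:ℝ), ∀ t ∈ Icc 0 T, v ε e t < c + δ / 2)
    (hu₀ : ∀ x ∈ Icc a b, 0 ≤ σ * (x - e) → σ * (x - e) ≤ r₀ → u₀ x < c + δ / 4) :
    ∀ᶠ ε in 𝓝[>] (0:ℝ), ∀ x, 0 ≤ σ * (x - e) → σ * (x - e) ≤ r₀ → ∀ t ∈ Icc 0 T,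
      v ε x t < c + δ / 2 + ((2 * M + 1) / r₀ + (1 + M) * (b - a)) * (σ * (x - e)) := by
  have hM := h.one_le
  filter_upwards [h.ev, hev, h.initial_close (show 0 < δ / 4 by positivity)] with ε h1 h2 h3
  set K := (2 * M + 1) / r₀ with hK
  have hK0 : 0 ≤ K := by positivity
  have hKr : K * r₀ = 2 * M + 1 := by rw [hK]; field_simp
  have hfar : ∀ x ∈ Icc a b, σ * (x - e) = r₀ → ∀ t ∈ Icc 0 T,
      v ε x t < c + δ / 2 + K * (σ * (x - e)) := by
    intro x hx hxe t ht
    rw [hxe, hKr]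
    linarith [(abs_le.1 (h1.bdd x hx t ht)).2, (abs_le.1 hc).1]
  have hnear : ∀ x, x = e → ∀ t ∈ Icc 0 T, v ε x t < c + δ / 2 + K * (σ * (x - e)) := by
    rintro x rfl t ht
    simpa using h2 t ht
  have hinit : ∀ x ∈ Icc a b, 0 ≤ σ * (x - e) → σ * (x - e) ≤ r₀ →
      v ε x 0 < c + δ / 2 + K * (σ * (x - e)) := by
    intro x hx hx1 hx2
    linarith [h3 x hx, hu₀ x hx hx1 hx2, mul_nonneg hK0 hx1]
  rcases hσ with rfl | rfl
  · have hsub : ∀ x ∈ Icc e (e + r₀), x ∈ Icc a b := fun x hx =>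
      ⟨he.1.trans hx.1, hx.2.trans (by linarith [he'.2])⟩
    have hle : e ≤ e + r₀ := by linarith
    intro x hx1 hx2
    refine h1.lt_linear (l := e) (r := e + r₀) he.1 (by linarith [he'.2]) (Or.inl rfl) he
      (fun x hx => by linarith [hx.1]) hle (hnear e rfl)
      (hfar _ (hsub _ ⟨hle, le_rfl⟩) (by ring))
      (fun x hx => hinit x (hsub x hx) (by linarith [hx.1]) (by linarith [hx.2]))
      x ⟨by linarith, by linarith⟩
  · have hsub : ∀ x ∈ Icc (e - r₀) e, x ∈ Icc a b := fun x hx =>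
      ⟨by linarith [he'.1, hx.1], hx.2.trans he.2⟩
    have hle : e - r₀ ≤ e := by linarith
    intro x hx1 hx2
    refine h1.lt_linear (l := e - r₀) (r := e) (by linarith [he'.1]) he.2 (Or.inr rfl) he
      (fun x hx => by linarith [hx.2]) hle
      (hfar _ (hsub _ ⟨le_rfl, hle⟩) (by ring)) (hnear e rfl)
      (fun x hx => hinit x (hsub x hx) (by linarith [hx.2]) (by linarith [hx.1]))
      x ⟨by linarith, by linarith⟩

theorem exists_ball (h : RegFamily a b T M N₀ u₀ A R v) {x : ℝ} (hx : x ∈ Icc a b) {δ : ℝ}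
    (hδ : 0 < δ) : ∃ r > 0, ∀ y ∈ Icc a b, |y - x| < r → |u₀ y - u₀ x| < δ := by
  obtain ⟨r, hr, h1⟩ := Metric.continuousWithinAt_iff.1 (h.cont x hx) δ hδ
  exact ⟨r, hr, fun y hy hyx => h1 hy hyx⟩

theorem eventually_neg_near (h : RegFamily a b T M N₀ u₀ A R v) {xm : ℝ} (hxm : xm ∈ Ioo a b)
    (hneg : u₀ xm < 0) : ∃ ρ > 0, ∃ c > 0, ∀ᶠ ε in 𝓝[>] (0:ℝ),
      ∀ x ∈ Icc (xm - ρ) (xm + ρ), ∀ t ∈ Icc 0 T, v ε x t < -c := by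
  obtain ⟨r, hr, hb⟩ := h.exists_ball (Ioo_subset_Icc_self hxm)
    (show 0 < -u₀ xm / 4 by linarith)
  have g1 : 0 < xm - a := by linarith [hxm.1]
  have g2 : 0 < b - xm := by linarith [hxm.2]
  set ρ := min (r / 4) (min ((xm - a) / 2) ((b - xm) / 2)) with hρ
  have hρ1 : ρ ≤ r / 4 := min_le_left _ _
  have hρ2 : ρ ≤ (xm - a) / 2 := (min_le_right _ _).trans (min_le_left _ _)
  have hρ3 : ρ ≤ (b - xm) / 2 := (min_le_right _ _).trans (min_le_right _ _)
  refine ⟨ρ, by positivity, eventually_neg_at h.ev h.pos h.one_le (c₀ := -u₀ xm / 4)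
    (by positivity) (by linarith) (by linarith) (by linarith) ?_⟩
  filter_upwards [h.initial_close (show 0 < -u₀ xm / 4 by linarith)] with ε hε y hy
  have hyI : y ∈ Icc a b := ⟨by linarith [hy.1], by linarith [hy.2]⟩
  have := (abs_lt.1 (hb y hyI (abs_lt.2 ⟨by linarith [hy.1], by linarith [hy.2]⟩))).2
  linarith [hε y hyI]

/-- The local upper bound at an endpoint or at a zero of `u₀`. -/
theorem eventually_le_near (h : RegFamily a b T M N₀ u₀ A R v) {x₁ : ℝ}
    (hx₁ : x₁ ∈ insert a (insert b N₀)) {δ : ℝ} (hδ : 0 < δ) :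
    ∃ r > 0, ∀ᶠ ε in 𝓝[>] (0:ℝ), ∀ x ∈ Icc a b, |x - x₁| < r → ∀ t ∈ Icc 0 T,
      v ε x t < u₀ x₁ + δ := by
  have hM := h.one_le
  have hab := h.lt
  have hx₁' : x₁ ∈ Icc a b := by
    rcases hx₁ with rfl | rfl | hx
    · exact left_mem_Icc.2 hab.le
    · exact right_mem_Icc.2 hab.le
    · exact Ioo_subset_Icc_self (h.sub hx)
  obtain ⟨r₁, hr₁, hball⟩ := h.exists_ball hx₁' (show 0 < δ / 4 by positivity)
  have hend : ∀ e ∈ Icc a b, ∀ σ : ℝ, (σ = 1 ∨ σ = -1) → x₁ = e →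
      (∀ x ∈ Icc a b, 0 ≤ σ * (x - e)) → e + σ * (min (r₁ / 2) (b - a)) ∈ Icc a b →
      (∀ᶠ ε in 𝓝[>] (0:ℝ), ∀ t ∈ Icc 0 T, v ε e t = v ε e 0) →
      ∃ r > 0, ∀ᶠ ε in 𝓝[>] (0:ℝ), ∀ x ∈ Icc a b, |x - x₁| < r → ∀ t ∈ Icc 0 T,
      v ε x t < u₀ x₁ + δ := by
    rintro e he σ hσ rfl hpos hmem hlat
    set r₀ := min (r₁ / 2) (b - a)
    have hr₀ : 0 < r₀ := lt_min (by positivity) (by linarith)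
    set K' := (2 * M + 1) / r₀ + (1 + M) * (b - a) with hK'
    have hK'0 : 0 < K' := by
      have : 0 < b - a := by linarith
      positivity
    have habs : ∀ x ∈ Icc a b, |x - x₁| = σ * (x - x₁) := fun x hx => by
      rw [← abs_of_nonneg (hpos x hx), abs_mul]
      rcases hσ with rfl | rfl <;> simp
    refine ⟨min r₀ (δ / (2 * K')), by positivity, ?_⟩
    filter_upwards [h.eventually_lt_linear hσ he hmem hr₀ (h.abs_initial_le _ he) hδ
      (by
        filter_upwards [hlat, h.initial_close (show 0 < δ / 2 by positivity)] with ε h1 h2 t ht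
        rw [h1 t ht]; exact h2 _ he)
      (fun x hx h1 h2 => by
        rw [← habs x hx] at h2
        have := (abs_lt.1 (hball x hx (h2.trans_lt ((min_le_left _ _).trans_lt (by linarith))))).2
        linarith)] with ε hε x hx hxr t ht
    have h1 : |x - x₁| * (2 * K') < δ := by
      rw [← lt_div_iff₀ (by positivity)]; exact hxr.trans_le (min_le_right _ _)
    have := hε x (hpos x hx) ((habs x hx) ▸ (hxr.le.trans (min_le_left _ _))) t ht
    rw [← habs x hx] at this
    linarith
  rcases hx₁ with hx | hx | hx
  · exact hend a (left_mem_Icc.2 hab.le) 1 (Or.inl rfl) hx (fun x hx => by linarith [hx.1])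
      ⟨by rw [one_mul]; linarith [show 0 < min (r₁ / 2) (b - a) from
        lt_min (by positivity) (by linarith)], by
        linarith [min_le_right (r₁ / 2) (b - a)]⟩
      (h.ev.mono fun ε hε t ht => hε.sol.left t ht)
  · exact hend b (right_mem_Icc.2 hab.le) (-1) (Or.inr rfl) hx (fun x hx => by linarith [hx.2])
      ⟨by linarith [min_le_right (r₁ / 2) (b - a)], by
        linarith [show 0 < min (r₁ / 2) (b - a) from
        lt_min (by positivity) (by linarith)]⟩
      (h.ev.mono fun ε hε t ht => hε.sol.right t ht)
  · have hxI := h.sub hx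
    have hx0 := h.zero x₁ hx
    rw [hx0] at hball ⊢
    set r₀ := min (r₁ / 4) (min ((x₁ - a) / 2) ((b - x₁) / 2)) with hr₀d
    have h1 : 0 < x₁ - a := by linarith [hxI.1]
    have h2 : 0 < b - x₁ := by linarith [hxI.2]
    have hr₀ : 0 < r₀ := by positivity
    have hr1 : r₀ ≤ r₁ / 4 := min_le_left _ _
    have hr2 : r₀ ≤ (x₁ - a) / 2 := (min_le_right _ _).trans (min_le_left _ _)
    have hr3 : r₀ ≤ (b - x₁) / 2 := (min_le_right _ _).trans (min_le_right _ _)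
    set K' := (2 * M + 1) / r₀ + (1 + M) * (b - a) with hK'
    have hK'0 : 0 < K' := by
      have : 0 < b - a := by linarith
      positivity
    set κ := min (r₀ / 2) (δ / (4 * K')) with hκ
    have hκ0 : 0 < κ := by positivity
    have hκ1 : κ ≤ r₀ / 2 := min_le_left _ _
    have hκ2 : κ * (4 * K') ≤ δ := by
      rw [← le_div_iff₀ (by positivity)]; exact min_le_right _ _
    have hmain : ∃ σ : ℝ, (σ = 1 ∨ σ = -1) ∧ ∃ xm, 0 < σ * (x₁ - xm) ∧ σ * (x₁ - xm) < κ ∧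
        u₀ xm < 0 := by
      obtain ⟨y, hy, z, hz, hyz⟩ := h.sign_change x₁ hx κ hκ0
      rcases mul_neg_iff.1 hyz with h3 | h3
      · exact ⟨-1, Or.inr rfl, z, by linarith [hz.1], by linarith [hz.2], h3.2⟩
      · exact ⟨1, Or.inl rfl, y, by linarith [hy.2], by linarith [hy.1], h3.1⟩
    obtain ⟨σ, hσ, xm, hm1, hm2, hm3⟩ := hmain
    have hxm : xm ∈ Ioo a b := by
      rcases hσ with rfl | rfl <;> constructor <;> linarith
    obtain ⟨_, hr, c, hc, hneg⟩ := h.eventually_neg_near hxm hm3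
    refine ⟨min (σ * (x₁ - xm)) κ, by positivity, ?_⟩
    filter_upwards [h.eventually_lt_linear (c := 0) hσ (Ioo_subset_Icc_self hxm)
      (r₀ := r₀) (by rcases hσ with rfl | rfl <;> constructor <;> linarith) hr₀ (by simp; linarith)
      hδ (hneg.mono fun ε hε t ht => by
        linarith [hε xm ⟨by linarith, by linarith⟩ t ht])
      (fun x hx h1 h2 => by
        have := (abs_lt.1 (hball x hx (abs_lt.2 (by
          rcases hσ with rfl | rfl <;> constructor <;> linarith)))).2
        linarith)] with ε hε x hxI hxr t ht
    have g1 := abs_lt.1 (hxr.trans_le (min_le_left _ _))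
    have g2 := abs_lt.1 (hxr.trans_le (min_le_right _ _))
    have g3 : 0 ≤ σ * (x - xm) := by
      rcases hσ with rfl | rfl <;> linarith [g1.1, g1.2]
    have g4 : σ * (x - xm) ≤ 2 * κ := by
      rcases hσ with rfl | rfl <;> linarith [g2.1, g2.2]
    have := hε x g3 (by linarith) t ht
    have g5 := mul_le_mul_of_nonneg_left g4 hK'0.le
    linarith

/-- The upper bound for small times. -/
theorem eventually_le_initial (h : RegFamily a b T M N₀ u₀ A R v) {δ : ℝ} (hδ : 0 < δ) :
    ∃ η > 0, ∀ᶠ ε in 𝓝[>] (0:ℝ), ∀ x ∈ Icc a b, ∀ t ∈ Icc 0 T, t ≤ η → v ε x t < u₀ x + δ := by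
  have hM := h.one_le
  obtain ⟨r, hr, hunif⟩ := Metric.uniformContinuousOn_iff.1
    (isCompact_Icc.uniformContinuousOn_of_continuous h.cont) (δ / 4) (by positivity)
  set C := 2 * M / r ^ 2 with hC
  have hC0 : 0 ≤ C := by positivity
  set C' := 2 * C * (1 + M) + (1 + M) ^ 2 + 1 with hC'
  have hC'0 : 0 < C' := by positivity
  refine ⟨δ / (2 * C'), by positivity, ?_⟩
  have h1 : ∀ᶠ ε in 𝓝[>] (0:ℝ), ε < 1 := nhdsWithin_le_nhds (gt_mem_nhds one_pos)
  filter_upwards [h.ev, h1, h.initial_close (show 0 < δ / 4 by positivity)]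
    with ε h2 h3 h4 x hx t ht htη
  have key := h2.lt_initial h3.le (α := u₀ x + δ / 2) hx hC0 (fun y hy => by
    have e1 := h4 y hy
    by_cases hyx : |y - x| < r
    · have := (abs_lt.1 (hunif y hy x hx hyx)).2
      nlinarith [mul_nonneg hC0 (sq_nonneg (y - x))]
    · have e2 : r ^ 2 ≤ (y - x) ^ 2 := by
        rw [← sq_abs (y - x)]; gcongr; exact not_lt.1 hyx
      have e3 : 2 * M ≤ C * (y - x) ^ 2 := by
        calc 2 * M = C * r ^ 2 := by rw [hC]; field_simp
          _ ≤ _ := by gcongr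
      linarith [(abs_le.1 (h.abs_initial_le y hy)).2, (abs_le.1 (h.abs_initial_le x hx)).1]) t ht
  rw [le_div_iff₀ (by positivity)] at htη
  rw [← hC'] at key
  linarith

end RegFamily

theorem C21At.uxx_nonpos {u : ℝ → ℝ → ℝ} {x t ut uxx : ℝ} (h : C21At u x t ut uxx)
    (hx : ∀ᶠ y in 𝓝 x, u y t ≤ u x t) : uxx ≤ 0 :=
  h.dxx.deriv ▸ IsLocalMax.deriv_deriv_nonpos (f := fun y => u y t) hx h.continuousAt

/-- `z` solves a linear equation `z_t = α z_xx + f` with `lam ≤ α ≤ Lam`, `|f| ≤ F` in a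
rectangle, and `|z| ≤ m` there. -/
structure ParabolicOn (l r s t lam Lam F m : ℝ) (z : ℝ → ℝ → ℝ) : Prop where
  cont : ContinuousOn (fun p : ℝ × ℝ => z p.1 p.2) (Icc l r ×ˢ Icc s t)
  eq : ∀ x ∈ Ioo l r, ∀ τ ∈ Ioc s t, ∃ zt zxx α f, C21At z x τ zt zxx ∧ zt = α * zxx + f ∧
    lam ≤ α ∧ α ≤ Lam ∧ |f| ≤ F
  bdd : ∀ x ∈ Icc l r, ∀ τ ∈ Icc s t, |z x τ| ≤ m

namespace ParabolicOn

variable {l r s t lam Lam F m : ℝ} {z : ℝ → ℝ → ℝ}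

theorem neg (h : ParabolicOn l r s t lam Lam F m z) :
    ParabolicOn l r s t lam Lam F m fun x t => -z x t where
  cont := h.cont.neg
  eq x hx τ hτ := by
    obtain ⟨zt, zxx, α, f, h1, h2, h3, h4, h5⟩ := h.eq x hx τ hτ
    exact ⟨_, _, α, -f, h1.neg, by rw [h2]; ring, h3, h4, by rwa [abs_neg]⟩
  bdd x hx τ hτ := by rw [abs_neg]; exact h.bdd x hx τ hτ

theorem mono (h : ParabolicOn l r s t lam Lam F m z) {l' r' s' t' : ℝ} (hl : l ≤ l') (hr : r' ≤ r)
    (hs : s ≤ s') (ht : t' ≤ t) : ParabolicOn l' r' s' t' lam Lam F m z where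
  cont := h.cont.mono (prod_mono (Icc_subset_Icc hl hr) (Icc_subset_Icc hs ht))
  eq x hx τ hτ := h.eq x (Ioo_subset_Ioo hl hr hx) τ (Ioc_subset_Ioc hs ht hτ)
  bdd x hx τ hτ := h.bdd x (Icc_subset_Icc hl hr hx) τ (Icc_subset_Icc hs ht hτ)

set_option maxHeartbeats 800000 in
/-- Doubling of the space variable. -/
theorem sub_le_doubling {xc ϱ : ℝ} (h : ParabolicOn (xc - ϱ) (xc + ϱ) (t - ϱ ^ 2) t lam Lam F m z)
    (hϱ : 0 < ϱ) (hlam : 0 < lam) (hF : 0 ≤ F) (hm : 0 < m) {x y : ℝ}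
    (hy : xc - ϱ ≤ y) (hyx : y ≤ x) (hx : x ≤ xc + ϱ) :
    z x t - z y t ≤ (4 * m / ϱ ^ 2 + (2 * m / ϱ ^ 2 + 2 * F) / lam) * ϱ * (x - y) +
      2 * m / ϱ ^ 2 * ((x - xc) ^ 2 + (y - xc) ^ 2) := by
  set κ := 2 * m / ϱ ^ 2 with hκ
  have hκ0 : 0 < κ := by positivity
  have hκϱ : κ * ϱ ^ 2 = 2 * m := by rw [hκ]; field_simp
  set N := 2 * κ + (κ + 2 * F) / lam with hN
  have hN' : 4 * m / ϱ ^ 2 + (κ + 2 * F) / lam = N := by rw [hN, hκ]; ring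
  have hNlam : lam * (N - 2 * κ) = κ + 2 * F := by rw [hN]; field_simp; ring
  have hN2 : 2 * κ ≤ N := by
    have : 0 ≤ (κ + 2 * F) / lam := by positivity
    linarith
  rw [hN']
  set ψ : ℝ → ℝ := fun s => N * ϱ * s - N / 2 * s ^ 2 with hψ
  have hψle : ∀ s, ψ s ≤ N * ϱ * s := fun s => by
    simp only [hψ]; nlinarith [mul_nonneg (show 0 ≤ N by linarith) (sq_nonneg s)]
  have hψ0 : ∀ s, 0 ≤ s → s ≤ 2 * ϱ → 0 ≤ ψ s := fun s h1 h2 => by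
    have : ψ s = N / 2 * (s * (2 * ϱ - s)) := by simp only [hψ]; ring
    rw [this]
    exact mul_nonneg (by linarith) (mul_nonneg h1 (by linarith))
  set H : ℝ × ℝ × ℝ → ℝ := fun p => z p.1 p.2.2 - z p.2.1 p.2.2 -
    (ψ (p.1 - p.2.1) + κ * ((p.1 - xc) ^ 2 + (p.2.1 - xc) ^ 2) + κ * (t - p.2.2)) with hH
  set D : Set (ℝ × ℝ × ℝ) := (Icc (xc - ϱ) (xc + ϱ) ×ˢ Icc (xc - ϱ) (xc + ϱ) ×ˢ
    Icc (t - ϱ ^ 2) t) ∩ {p | p.2.1 ≤ p.1} with hD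
  have hDc : IsCompact D := (isCompact_Icc.prod (isCompact_Icc.prod isCompact_Icc)).inter_right
    (isClosed_le (by fun_prop) (by fun_prop))
  have hHc : ContinuousOn H D := by
    have e1 : ContinuousOn (fun p : ℝ × ℝ × ℝ => z p.1 p.2.2) D :=
      h.cont.comp (f := fun p : ℝ × ℝ × ℝ => (p.1, p.2.2)) (by fun_prop)
        fun p hp => ⟨hp.1.1, hp.1.2.2⟩
    have e2 : ContinuousOn (fun p : ℝ × ℝ × ℝ => z p.2.1 p.2.2) D :=
      h.cont.comp (f := fun p : ℝ × ℝ × ℝ => (p.2.1, p.2.2)) (by fun_prop)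
        fun p hp => ⟨hp.1.2.1, hp.1.2.2⟩
    exact (e1.sub e2).sub (by simp only [hψ]; fun_prop)
  suffices hle : ∀ p ∈ D, H p ≤ 0 by
    have := hle (x, y, t) ⟨⟨⟨hy.trans hyx, hx⟩, ⟨hy, hyx.trans hx⟩, by nlinarith, le_rfl⟩, hyx⟩
    simp only [hH] at this
    linarith [hψle (x - y)]
  by_contra! hcon
  obtain ⟨q, hq, hHq⟩ := hcon
  obtain ⟨⟨x₀, y₀, t₀⟩, hp, hmax⟩ := hDc.exists_isMaxOn ⟨q, hq⟩ hHc
  have hHp : 0 < H (x₀, y₀, t₀) := hHq.trans_le (hmax hq)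
  have hmax' : ∀ x y τ, x ∈ Icc (xc - ϱ) (xc + ϱ) → y ∈ Icc (xc - ϱ) (xc + ϱ) →
      τ ∈ Icc (t - ϱ ^ 2) t → y ≤ x → H (x, y, τ) ≤ H (x₀, y₀, t₀) :=
    fun x y τ h1 h2 h3 h4 => hmax ⟨⟨h1, h2, h3⟩, h4⟩
  clear hmax
  obtain ⟨⟨hx₀, hy₀, ht₀⟩, hyx₀⟩ := hp
  simp only [mem_ofPred_eq] at hx₀ hy₀ ht₀ hyx₀
  have hbx := abs_le.1 (h.bdd x₀ hx₀ t₀ ht₀)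
  have hby := abs_le.1 (h.bdd y₀ hy₀ t₀ ht₀)
  have hψ₀ := hψ0 (x₀ - y₀) (by linarith) (by linarith [hx₀.2, hy₀.1])
  have hsx := mul_nonneg hκ0.le (sq_nonneg (x₀ - xc))
  have hsy := mul_nonneg hκ0.le (sq_nonneg (y₀ - xc))
  have hst : 0 ≤ κ * (t - t₀) := mul_nonneg hκ0.le (by linarith [ht₀.2])
  have hlt : y₀ < x₀ := by
    rcases hyx₀.lt_or_eq with h1 | h1
    · exact h1
    · simp only [hH, h1, sub_self] at hHp
      simp only [hψ] at hHp
      rw [h1] at hsy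
      linarith
  simp only [hH] at hHp
  have hxI : x₀ < xc + ϱ := by
    rcases hx₀.2.lt_or_eq with h1 | h1
    · exact h1
    · rw [h1] at hHp hsx hψ₀ hbx
      rw [add_sub_cancel_left] at hHp
      linarith
  have hyI : xc - ϱ < y₀ := by
    rcases hy₀.1.lt_or_eq with h1 | h1
    · exact h1
    · rw [← h1] at hHp hsy hψ₀ hby
      rw [show xc - ϱ - xc = -ϱ by ring, neg_sq] at hHp
      linarith
  have htI : t - ϱ ^ 2 < t₀ := by
    rcases ht₀.1.lt_or_eq with h1 | h1
    · exact h1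
    · rw [← h1, show t - (t - ϱ ^ 2) = ϱ ^ 2 by ring] at hHp
      rw [← h1] at hbx hby
      linarith
  obtain ⟨zt, zxx, α, f, g1, g2, g3, g4, g5⟩ :=
    h.eq x₀ ⟨hyI.trans hlt, hxI⟩ t₀ ⟨htI, ht₀.2⟩
  obtain ⟨wt, wxx, β, k, k1, k2, k3, k4, k5⟩ :=
    h.eq y₀ ⟨hyI, hlt.trans hxI⟩ t₀ ⟨htI, ht₀.2⟩
  have hxx : zxx ≤ 2 * κ - N := by
    have ht1 := C21At.add_test (x := x₀) (t := t₀) (g := fun _ => 0) (g' := 0)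
      (f := fun x => ψ (x - y₀) + κ * ((x - xc) ^ 2 + (y₀ - xc) ^ 2))
      (f' := fun x => N * ϱ - N * (x - y₀) + 2 * κ * (x - xc)) (f'' := -N + 2 * κ)
      (fun x => by
        have e1 := (hasDerivAt_id x).sub_const y₀
        have e2 := (hasDerivAt_id x).sub_const xc
        refine (((e1.const_mul (N * ϱ)).sub ((e1.pow 2).const_mul (N / 2))).add
          (((e2.pow 2).add_const ((y₀ - xc) ^ 2)).const_mul κ)).congr_deriv ?_
        simp; ring)
      (by
        have e1 := (hasDerivAt_id x₀).sub_const y₀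
        have e2 := (hasDerivAt_id x₀).sub_const xc
        refine (((e1.const_mul N).const_sub (N * ϱ)).add
          (e2.const_mul (2 * κ))).congr_deriv ?_
        ring)
      (hasDerivAt_const _ _)
    have := (g1.sub ht1).uxx_nonpos (by
      filter_upwards [Ioo_mem_nhds hlt hxI] with x hx
      have := hmax' x y₀ t₀ ⟨by linarith [hx.1], hx.2.le⟩ hy₀ ht₀ hx.1.le
      simp only [hH] at this ⊢
      linarith)
    linarith
  have hyy : -wxx ≤ 2 * κ - N := by
    have ht1 := C21At.add_test (x := y₀) (t := t₀) (g := fun _ => 0) (g' := 0)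
      (f := fun y => ψ (x₀ - y) + κ * ((x₀ - xc) ^ 2 + (y - xc) ^ 2))
      (f' := fun y => -(N * ϱ) + N * (x₀ - y) + 2 * κ * (y - xc)) (f'' := -N + 2 * κ)
      (fun x => by
        have e1 := (hasDerivAt_id x).const_sub x₀
        have e2 := (hasDerivAt_id x).sub_const xc
        refine (((e1.const_mul (N * ϱ)).sub ((e1.pow 2).const_mul (N / 2))).add
          (((e2.pow 2).const_add ((x₀ - xc) ^ 2)).const_mul κ)).congr_deriv ?_
        simp; ring)
      (by
        have e1 := (hasDerivAt_id y₀).const_sub x₀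
        have e2 := (hasDerivAt_id y₀).sub_const xc
        refine (((e1.const_mul N).const_add (-(N * ϱ))).add
          (e2.const_mul (2 * κ))).congr_deriv ?_
        ring)
      (hasDerivAt_const _ _)
    have := (k1.neg.sub ht1).uxx_nonpos (by
      filter_upwards [Ioo_mem_nhds hyI hlt] with y hy
      have := hmax' x₀ y t₀ hx₀ ⟨hy.1.le, by linarith [hy.2]⟩ ht₀ hy.2.le
      simp only [hH] at this ⊢
      linarith)
    linarith
  have htt : 0 ≤ zt - wt + κ := by
    have e1 : HasDerivWithinAt (fun s : ℝ => κ * s) κ (Iic t₀) t₀ := by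
      simpa using ((hasDerivAt_id t₀).const_mul κ).hasDerivWithinAt
    refine ((g1.dt.sub k1.dt).add e1).nonneg_of_left_max ?_
    filter_upwards [Ioo_mem_nhdsLT htI] with τ hτ
    have := hmax' x₀ y₀ τ hx₀ hy₀ ⟨hτ.1.le, hτ.2.le.trans ht₀.2⟩ hyx₀
    simp only [hH] at this
    simp only [Pi.add_apply, Pi.sub_apply]
    linarith
  have e1 : α * zxx ≤ lam * (2 * κ - N) := by
    exact (mul_le_mul_of_nonneg_left hxx (hlam.le.trans g3)).trans
      (mul_le_mul_of_nonpos_right g3 (by linarith))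
  have e2 : β * (-wxx) ≤ lam * (2 * κ - N) := by
    exact (mul_le_mul_of_nonneg_left hyy (hlam.le.trans k3)).trans
      (mul_le_mul_of_nonpos_right k3 (by linarith))
  have := (abs_le.1 g5).2
  have := (abs_le.1 k5).1
  rw [g2, k2] at htt
  linarith

/-- Interior Lipschitz bound in space. -/
theorem abs_sub_le_space {xc ϱ : ℝ}
    (h : ParabolicOn (xc - ϱ) (xc + ϱ) (t - ϱ ^ 2) t lam Lam F m z)
    (hϱ : 0 < ϱ) (hlam : 0 < lam) (hF : 0 ≤ F) (hm : 0 < m) {x : ℝ}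
    (hx : x ∈ Icc (xc - ϱ) (xc + ϱ)) :
    |z x t - z xc t| ≤ ((6 + 2 / lam) * (m / ϱ) + 2 / lam * (F * ϱ)) * |x - xc| := by
  have hκ : 0 ≤ 2 * m / ϱ ^ 2 := by positivity
  have hL : (6 + 2 / lam) * (m / ϱ) + 2 / lam * (F * ϱ) =
      (4 * m / ϱ ^ 2 + (2 * m / ϱ ^ 2 + 2 * F) / lam) * ϱ + 2 * m / ϱ ^ 2 * ϱ := by
    field_simp; ring
  rw [hL]
  set P := (4 * m / ϱ ^ 2 + (2 * m / ϱ ^ 2 + 2 * F) / lam) * ϱ with hP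
  set κ := 2 * m / ϱ ^ 2
  rcases le_total xc x with hxc | hxc
  · have e1 := h.sub_le_doubling hϱ hlam hF hm (by linarith) hxc hx.2
    have e2 := h.neg.sub_le_doubling hϱ hlam hF hm (by linarith) hxc hx.2
    have e3 : κ * (x - xc) ^ 2 ≤ κ * ϱ * (x - xc) := by
      rw [mul_assoc]
      exact mul_le_mul_of_nonneg_left (by nlinarith [hx.2]) hκ
    rw [sub_self] at e1 e2
    rw [abs_of_nonneg (sub_nonneg.2 hxc), abs_le]
    constructor <;> linarith
  · have e1 := h.sub_le_doubling hϱ hlam hF hm hx.1 hxc (by linarith)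
    have e2 := h.neg.sub_le_doubling hϱ hlam hF hm hx.1 hxc (by linarith)
    have e3 : κ * (x - xc) ^ 2 ≤ κ * ϱ * (xc - x) := by
      rw [mul_assoc]
      exact mul_le_mul_of_nonneg_left (by nlinarith [hx.1]) hκ
    rw [sub_self] at e1 e2
    rw [abs_of_nonpos (sub_nonpos.2 hxc), abs_le]
    constructor <;> linarith

theorem sub_le_time {xc ϱ L : ℝ} (h : ParabolicOn (xc - ϱ) (xc + ϱ) s t lam Lam F m z)
    (hϱ : 0 < ϱ) (hlam : 0 < lam) (hlL : lam ≤ Lam) (hm : 0 < m) (hst : s < t) (hL0 : 0 ≤ L)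
    (hL : ∀ x ∈ Icc (xc - ϱ) (xc + ϱ), z x s - z xc s ≤ L * |x - xc|) :
    z xc t - z xc s ≤ √(t - s) * (L * (1 + Lam)) + (t - s) * (6 * Lam * m / ϱ ^ 2 + F) := by
  have hLam : 0 < Lam := hlam.trans_le hlL
  set k := √(t - s) with hk
  have hk0 : 0 < k := Real.sqrt_pos.2 (by linarith)
  have hk2 : k ^ 2 = t - s := Real.sq_sqrt (by linarith)
  set β := L / (4 * k) + 2 * m / ϱ ^ 2 with hβ
  have hβ0 : 0 < β := by positivity
  have hβϱ : 2 * m ≤ β * ϱ ^ 2 := by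
    have : β * ϱ ^ 2 = L / (4 * k) * ϱ ^ 2 + 2 * m := by rw [hβ]; field_simp
    rw [this]; have : 0 ≤ L / (4 * k) * ϱ ^ 2 := by positivity
    linarith
  have hF : 0 ≤ F := by
    obtain ⟨_, _, _, f, -, -, -, -, h5⟩ := h.eq xc ⟨by linarith, by linarith⟩ t ⟨hst, le_rfl⟩
    exact (abs_nonneg f).trans h5
  set γ := 3 * Lam * β + F with hγ
  have hle : xc - ϱ ≤ xc + ϱ := by linarith
  have hxcI : xc ∈ Icc (xc - ϱ) (xc + ϱ) := ⟨by linarith, by linarith⟩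
  have hb0 := abs_le.1 (h.bdd xc hxcI s ⟨le_rfl, hst.le⟩)
  have hγ0 : 0 ≤ γ := by positivity
  refine le_of_forall_pos_le_add fun e he => ?_
  have hlat : ∀ x ∈ Icc (xc - ϱ) (xc + ϱ), (x - xc) ^ 2 = ϱ ^ 2 → ∀ τ ∈ Icc s t,
      z x τ < (z xc s + L * k + e + β * (x - xc) ^ 2) + γ * (τ - s) := fun x hx hx2 τ hτ => by
    rw [hx2]
    have e1 := (abs_le.1 (h.bdd x hx τ hτ)).2
    have e2 := mul_nonneg hγ0 (sub_nonneg.2 hτ.1)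
    have e3 := mul_nonneg hL0 hk0.le
    linarith
  have key := lt_barrier (v := z) (f := fun x => z xc s + L * k + e + β * (x - xc) ^ 2)
    (f' := fun x => β * (2 * (x - xc))) (f'' := fun _ => β * 2)
    (g := fun τ => γ * (τ - s)) (g' := fun _ => γ) h.cont
    (fun y => by
      have h1 := (hasDerivAt_id y).sub_const xc
      refine (((h1.pow 2).const_mul β).const_add (z xc s + L * k + e)).congr_deriv ?_
      simp)
    (fun y => by
      have h1 := (hasDerivAt_id y).sub_const xc
      refine ((h1.const_mul 2).const_mul β).congr_deriv ?_
      ring)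
    (fun y => by simpa using ((hasDerivAt_id y).sub_const s).const_mul γ)
    (hlat _ (left_mem_Icc.2 hle) (by ring)) (hlat _ (right_mem_Icc.2 hle) (by ring))
    (fun x hx => by
      have e1 : L * |x - xc| ≤ L * k + β * (x - xc) ^ 2 := by
        have e2 : |x - xc| ≤ k + 1 / (4 * k) * (x - xc) ^ 2 := by
          rw [← sq_abs (x - xc)]
          have : k + 1 / (4 * k) * |x - xc| ^ 2 - |x - xc| =
              1 / (4 * k) * (|x - xc| - 2 * k) ^ 2 := by field_simp; ring
          have : 0 ≤ 1 / (4 * k) * (|x - xc| - 2 * k) ^ 2 := by positivity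
          linarith
        have e3 : L * (1 / (4 * k)) ≤ β := by
          rw [hβ, mul_one_div]; have : 0 ≤ 2 * m / ϱ ^ 2 := by positivity
          linarith
        nlinarith [mul_le_mul_of_nonneg_left e2 hL0,
          mul_le_mul_of_nonneg_right e3 (sq_nonneg (x - xc))]
      have := hL x hx
      simp only [sub_self, mul_zero, add_zero]
      linarith)
    (fun x hx τ hτ _ => by
      obtain ⟨zt, zxx, α, f, h1, h2, h3, h4, h5⟩ := h.eq x hx τ hτ
      refine ⟨zt, zxx, h1, fun _ h6 => ?_⟩
      have e1 := mul_le_mul_of_nonneg_left h6 (hlam.le.trans h3)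
      have e2 := mul_le_mul_of_nonneg_right h4 (show 0 ≤ β * 2 by positivity)
      have e3 := (abs_le.1 h5).2
      have e4 : 0 < Lam * β := by positivity
      rw [h2, hγ]
      linarith)
    xc hxcI t ⟨hst.le, le_rfl⟩
  have e1 : γ * (t - s) ≤ k * (L * Lam) + (t - s) * (6 * Lam * m / ϱ ^ 2 + F) := by
    rw [hγ, hβ, ← hk2]
    have : (3 * Lam * (L / (4 * k) + 2 * m / ϱ ^ 2) + F) * k ^ 2 =
      3 / 4 * (k * (L * Lam)) + k ^ 2 * (6 * Lam * m / ϱ ^ 2 + F) := by field_simp; ring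
    rw [this]
    have : 0 ≤ k * (L * Lam) := by positivity
    linarith
  simp only [sub_self] at key
  linarith

/-- Interior `1/2`-Hölder bound in time. -/
theorem abs_sub_le_time {xc ϱ : ℝ}
    (h : ParabolicOn (xc - ϱ) (xc + ϱ) (t - 2 * ϱ ^ 2) t lam Lam F m z)
    (hϱ : 0 < ϱ) (hlam : 0 < lam) (hlL : lam ≤ Lam) (hF : 0 ≤ F) (hm : 0 < m)
    (hs : s ∈ Icc (t - ϱ ^ 2) t) :
    |z xc t - z xc s| ≤
      ((1 + Lam) * (6 + 2 / lam) + 6 * Lam + 1) * (m / ϱ + F * ϱ) * √(t - s) := by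
  have hLam : 0 < Lam := hlam.trans_le hlL
  rcases hs.2.lt_or_eq with hst | rfl
  swap
  · simp
  set L := (6 + 2 / lam) * (m / ϱ) + 2 / lam * (F * ϱ) with hLd
  have hL0 : 0 ≤ L := by positivity
  have h1 : ∀ x ∈ Icc (xc - ϱ) (xc + ϱ), |z x s - z xc s| ≤ L * |x - xc| := fun x hx =>
    (h.mono le_rfl le_rfl (by linarith [hs.1]) hst.le).abs_sub_le_space hϱ hlam hF hm hx
  have h2 := h.mono le_rfl le_rfl (show t - 2 * ϱ ^ 2 ≤ s by nlinarith [hs.1]) le_rfl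
  have e1 := h2.sub_le_time hϱ hlam hlL hm hst hL0 fun x hx => (le_abs_self _).trans (h1 x hx)
  have e2 := h2.neg.sub_le_time hϱ hlam hlL hm hst hL0 fun x hx => by
    have := (abs_le.1 (h1 x hx)).1
    linarith
  set k := √(t - s) with hk
  have hk0 : 0 < k := Real.sqrt_pos.2 (by linarith)
  have hk2 : k ^ 2 = t - s := Real.sq_sqrt (by linarith)
  have hkϱ : k ≤ ϱ := by
    rw [hk, Real.sqrt_le_left hϱ.le]; linarith [hs.1]
  have e3 : (t - s) * (6 * Lam * m / ϱ ^ 2 + F) ≤ k * (6 * Lam * (m / ϱ) + F * ϱ) := by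
    rw [← hk2]
    calc k ^ 2 * (6 * Lam * m / ϱ ^ 2 + F) ≤ k * ϱ * (6 * Lam * m / ϱ ^ 2 + F) := by
          rw [sq]; gcongr
      _ = _ := by field_simp
  have e4 : k * (L * (1 + Lam)) + k * (6 * Lam * (m / ϱ) + F * ϱ) ≤
      ((1 + Lam) * (6 + 2 / lam) + 6 * Lam + 1) * (m / ϱ + F * ϱ) * k := by
    have g1 : 0 ≤ k * (m / ϱ) := by positivity
    have g2 : 0 ≤ k * (F * ϱ) := by positivity
    have g3 : 0 ≤ k * (F * ϱ) * Lam := by positivity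
    rw [hLd]
    ring_nf
    ring_nf at g1 g2 g3
    linarith
  rw [abs_le]
  constructor <;> linarith

end ParabolicOn

/-- `v` is of class `C^{2,1}` in `D × (0,T]`. -/
structure C21On (T : ℝ) (D : Set ℝ) (v : ℝ → ℝ → ℝ) : Prop where
  diff_x : ∀ x ∈ D, ∀ t ∈ Ioc 0 T, DifferentiableAt ℝ (fun y => v y t) x
  diff_xx : ∀ x ∈ D, ∀ t ∈ Ioc 0 T, DifferentiableAt ℝ (fun y => pdx v y t) x
  diff_t : ∀ x ∈ D, ∀ t ∈ Ioc 0 T, DifferentiableWithinAt ℝ (fun s => v x s) (Iic T) t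
  cont_x : ContinuousOn (fun p : ℝ × ℝ => pdx v p.1 p.2) (D ×ˢ Ioc 0 T)
  cont_xx : ContinuousOn (fun p : ℝ × ℝ => pdxx v p.1 p.2) (D ×ˢ Ioc 0 T)
  cont_t : ContinuousOn (fun p : ℝ × ℝ => pdtW T v p.1 p.2) (D ×ˢ Ioc 0 T)

theorem pdx_neg (v : ℝ → ℝ → ℝ) : pdx (fun x t => -v x t) = fun x t => -pdx v x t := by
  funext x t; exact deriv.fun_neg

theorem pdxx_neg (v : ℝ → ℝ → ℝ) : pdxx (fun x t => -v x t) = fun x t => -pdxx v x t := by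
  funext x t; unfold pdxx; rw [pdx_neg]; exact deriv.fun_neg

theorem pdtW_neg (T : ℝ) (v : ℝ → ℝ → ℝ) :
    pdtW T (fun x t => -v x t) = fun x t => -pdtW T v x t := by
  funext x t; exact derivWithin.fun_neg

namespace C21On

variable {T : ℝ} {D : Set ℝ} {v w : ℝ → ℝ → ℝ}

theorem neg (h : C21On T D v) : C21On T D fun x t => -v x t where
  diff_x x hx t ht := (h.diff_x x hx t ht).neg
  diff_xx x hx t ht := by rw [pdx_neg]; exact (h.diff_xx x hx t ht).neg
  diff_t x hx t ht := (h.diff_t x hx t ht).neg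
  cont_x := by rw [pdx_neg]; exact h.cont_x.neg
  cont_xx := by rw [pdxx_neg]; exact h.cont_xx.neg
  cont_t := by rw [pdtW_neg]; exact h.cont_t.neg

theorem mono (h : C21On T D v) {D' : Set ℝ} (hD : D' ⊆ D) : C21On T D' v where
  diff_x x hx := h.diff_x x (hD hx)
  diff_xx x hx := h.diff_xx x (hD hx)
  diff_t x hx := h.diff_t x (hD hx)
  cont_x := h.cont_x.mono (prod_mono hD subset_rfl)
  cont_xx := h.cont_xx.mono (prod_mono hD subset_rfl)
  cont_t := h.cont_t.mono (prod_mono hD subset_rfl)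

theorem c21At (h : C21On T D v) (hD : IsOpen D) {x t : ℝ} (hx : x ∈ D) (ht : t ∈ Ioc 0 T) :
    C21At v x t (pdtW T v x t) (pdxx v x t) where
  dx := by filter_upwards [hD.mem_nhds hx] with y hy using h.diff_x y hy t ht
  dxx := (h.diff_xx x hx t ht).hasDerivAt
  dt := (h.diff_t x hx t ht).hasDerivWithinAt.mono (Iic_subset_Iic.2 ht.2)

theorem hasDerivAt_t (h : C21On T D v) {x t : ℝ} (hx : x ∈ D) (ht : t ∈ Ioo 0 T) :
    HasDerivAt (fun s => v x s) (pdtW T v x t) t :=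
  (h.diff_t x hx t ⟨ht.1, ht.2.le⟩).hasDerivWithinAt.hasDerivAt (Iic_mem_nhds ht.2)

theorem continuousOn_t (h : C21On T D v) {x : ℝ} (hx : x ∈ D) :
    ContinuousOn (fun s => v x s) (Ioc 0 T) := fun t ht =>
  (h.diff_t x hx t ht).continuousWithinAt.mono fun _ hs => hs.2

theorem hasDerivAt_x (h : C21On T D v) {x t : ℝ} (hx : x ∈ D) (ht : t ∈ Ioc 0 T) :
    HasDerivAt (fun y => v y t) (pdx v x t) x := (h.diff_x x hx t ht).hasDerivAt

theorem hasDerivAt_xx (h : C21On T D v) {x t : ℝ} (hx : x ∈ D) (ht : t ∈ Ioc 0 T) :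
    HasDerivAt (fun y => pdx v y t) (pdxx v x t) x := (h.diff_xx x hx t ht).hasDerivAt

end C21On

/-- The data of the convergence problem: a family of solutions of the regularised equations and a
solution `u` of the limit equation. -/
structure ConvData (a b T M : ℝ) (N₀ : Set ℝ) (u₀ : ℝ → ℝ) (A R : ℝ → ℝ → ℝ)
    (v : ℝ → ℝ → ℝ → ℝ) (u : ℝ → ℝ → ℝ) : Prop extends RegFamily a b T M N₀ u₀ A R v where
  c21v : ∀ᶠ ε in 𝓝[>] (0:ℝ), C21On T (Ioo a b) (v ε)
  eqv : ∀ᶠ ε in 𝓝[>] (0:ℝ), ∀ x ∈ Ioo a b, ∀ t ∈ Ioc 0 T,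
    pdtW T (v ε) x t = A ε (v ε x t) * pdxx (v ε) x t + R ε (v ε x t)
  ucont : ContinuousOn (fun p : ℝ × ℝ => u p.1 p.2) (Icc a b ×ˢ Icc 0 T)
  c21u : C21On T (Ioo a b \ N₀) u
  equ : ∀ x ∈ Ioo a b \ N₀, ∀ t ∈ Ioc 0 T,
    pdtW T u x t = |u x t| * pdxx u x t + u x t * (1 - |u x t|)
  ulat : ∀ x ∈ insert a (insert b N₀), ∀ t ∈ Icc 0 T, u x t = u₀ x
  uinit : ∀ x ∈ Icc a b, u x 0 = u₀ x
  une : ∀ x ∈ Ioo a b \ N₀, ∀ t ∈ Icc 0 T, u x t ≠ 0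
  ubdd : ∀ x ∈ Icc a b, ∀ t ∈ Icc 0 T, |u x t| ≤ M

namespace ConvData

variable {a b T M : ℝ} {N₀ : Set ℝ} {u₀ : ℝ → ℝ} {A R : ℝ → ℝ → ℝ} {v : ℝ → ℝ → ℝ → ℝ}
  {u : ℝ → ℝ → ℝ}

theorem neg (h : ConvData a b T M N₀ u₀ A R v u) :
    ConvData a b T M N₀ (fun x => -u₀ x) A R (fun ε x t => -v ε x t) fun x t => -u x t where
  toRegFamily := h.toRegFamily.neg
  c21v := h.c21v.mono fun _ hε => hε.neg
  eqv := by
    filter_upwards [h.eqv, h.ev] with ε h1 h2 x hx t ht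
    rw [pdtW_neg, pdxx_neg]
    beta_reduce
    rw [h2.coef.even, h2.coef.odd, h1 x hx t ht]; ring
  ucont := h.ucont.neg
  c21u := h.c21u.neg
  equ x hx t ht := by
    rw [pdtW_neg, pdxx_neg]
    beta_reduce
    rw [abs_neg, h.equ x hx t ht]; ring
  ulat x hx t ht := by rw [h.ulat x hx t ht]
  uinit x hx := by rw [h.uinit x hx]
  une x hx t ht := neg_ne_zero.2 (h.une x hx t ht)
  ubdd x hx t ht := by rw [abs_neg]; exact h.ubdd x hx t ht

theorem isOpen_diff (h : ConvData a b T M N₀ u₀ A R v u) : IsOpen (Ioo a b \ N₀) :=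
  isOpen_Ioo.sdiff h.fin.isClosed

theorem sign_u (h : ConvData a b T M N₀ u₀ A R v u) {x : ℝ} (hx : x ∈ Ioo a b \ N₀)
    {S : ℝ} (hS : S = 1 ∨ S = -1) (hu : 0 < S * u₀ x) : ∀ t ∈ Icc 0 T, 0 < S * u x t := by
  intro t ht
  by_contra! hle
  have hxI := Ioo_subset_Icc_self hx.1
  have hc : ContinuousOn (fun s => S * u x s) (Icc 0 t) :=
    continuousOn_const.mul (h.ucont.comp (f := fun s : ℝ => (x, s)) (by fun_prop)
      fun s hs => ⟨hxI, hs.1, hs.2.trans ht.2⟩)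
  have h0 : (0:ℝ) ∈ Icc (S * u x t) (S * u x 0) := ⟨hle, by rw [h.uinit x hxI]; exact hu.le⟩
  obtain ⟨s, hs, hs0⟩ := intermediate_value_Icc' ht.1 hc h0
  have hS0 : S ≠ 0 := by rcases hS with rfl | rfl <;> norm_num
  exact (mul_ne_zero hS0 (h.une x hx s ⟨hs.1, hs.2.trans ht.2⟩)) hs0

theorem exists_sign (h : ConvData a b T M N₀ u₀ A R v u) {x : ℝ} (hx : x ∈ Ioo a b \ N₀) :
    ∃ S : ℝ, (S = 1 ∨ S = -1) ∧ 0 < S * u₀ x := by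
  have h0 : u₀ x ≠ 0 := by
    rw [← h.uinit x (Ioo_subset_Icc_self hx.1)]
    exact h.une x hx 0 ⟨le_rfl, h.pos.le⟩
  rcases lt_or_gt_of_ne h0 with h1 | h1
  · exact ⟨-1, Or.inr rfl, by linarith⟩
  · exact ⟨1, Or.inl rfl, by linarith⟩

theorem exists_sign_lower (h : ConvData a b T M N₀ u₀ A R v u) {K : Set ℝ} (hK : IsCompact K)
    (hKs : K ⊆ Ioo a b \ N₀) : ∃ c > 0, ∀ᶠ ε in 𝓝[>] (0:ℝ), ∀ x ∈ K,
      ∃ S : ℝ, (S = 1 ∨ S = -1) ∧ ∀ t ∈ Icc 0 T, c ≤ S * v ε x t ∧ c ≤ S * u x t := by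
  have hloc : ∃ c > 0, ∀ᶠ ε in 𝓝[>] (0:ℝ), ∀ x ∈ K,
      ∀ S : ℝ, (S = 1 ∨ S = -1) → 0 < S * u₀ x → ∀ t ∈ Icc 0 T, c ≤ S * v ε x t := by
    refine hK.induction_on (p := fun s => ∃ c > 0, ∀ᶠ ε in 𝓝[>] (0:ℝ), ∀ x ∈ s,
      ∀ S : ℝ, (S = 1 ∨ S = -1) → 0 < S * u₀ x → ∀ t ∈ Icc 0 T, c ≤ S * v ε x t)
      ⟨1, one_pos, by simp⟩ ?_ ?_ ?_
    · rintro s s' hss ⟨c, hc, hev⟩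
      exact ⟨c, hc, hev.mono fun ε hε x hx => hε x (hss hx)⟩
    · rintro s s' ⟨c, hc, hev⟩ ⟨c', hc', hev'⟩
      refine ⟨min c c', lt_min hc hc', ?_⟩
      filter_upwards [hev, hev'] with ε h1 h2 x hx S hS hSx t ht
      rcases hx with hx | hx
      · exact (min_le_left _ _).trans (h1 x hx S hS hSx t ht)
      · exact (min_le_right _ _).trans (h2 x hx S hS hSx t ht)
    · intro x hx
      have hxD := hKs hx
      obtain ⟨S, hS, hSx⟩ := h.exists_sign hxD
      have key : ∃ ρ > 0, ∃ c > 0, ∀ᶠ ε in 𝓝[>] (0:ℝ),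
          ∀ y ∈ Icc (x - ρ) (x + ρ), ∀ t ∈ Icc 0 T, c < S * v ε y t := by
        rcases hS with rfl | rfl
        · obtain ⟨ρ, hρ, c, hc, hev⟩ := h.neg.eventually_neg_near hxD.1 (by linarith)
          exact ⟨ρ, hρ, c, hc, hev.mono fun ε hε y hy t ht => by linarith [hε y hy t ht]⟩
        · obtain ⟨ρ, hρ, c, hc, hev⟩ := h.eventually_neg_near hxD.1 (by linarith)
          exact ⟨ρ, hρ, c, hc, hev.mono fun ε hε y hy t ht => by linarith [hε y hy t ht]⟩
      obtain ⟨ρ, hρ, c, hc, hev⟩ := key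
      have hS2 : ∀ S' : ℝ, (S' = 1 ∨ S' = -1) → S' = S ∨ S' = -S := by
        intro S' hS'
        rcases hS' with rfl | rfl <;> rcases hS with rfl | rfl <;> norm_num
      have hxn : {y | 0 < S * u₀ y} ∩ Icc (x - ρ) (x + ρ) ∈ 𝓝[K] x := by
        refine inter_mem ?_ (nhdsWithin_le_nhds (Icc_mem_nhds (by linarith) (by linarith)))
        have hct : ContinuousWithinAt (fun y => S * u₀ y) K x :=
          continuousWithinAt_const.mul ((h.cont x (Ioo_subset_Icc_self hxD.1)).mono
            fun y hy => Ioo_subset_Icc_self (hKs hy).1)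
        exact hct (lt_mem_nhds hSx)
      refine ⟨_, hxn, c, hc, hev.mono fun ε hε y hy S' hS' hSy t ht => ?_⟩
      rcases hS2 S' hS' with rfl | rfl
      · exact (hε y hy.2 t ht).le
      · have : 0 < S * u₀ y := hy.1
        linarith
  obtain ⟨c, hc, hev⟩ := hloc
  have hu : ∃ c' > 0, ∀ x ∈ K, ∀ t ∈ Icc 0 T, c' ≤ |u x t| := by
    rcases K.eq_empty_or_nonempty with rfl | hne
    · exact ⟨1, one_pos, by simp⟩
    have hcont : ContinuousOn (fun p : ℝ × ℝ => |u p.1 p.2|) (K ×ˢ Icc 0 T) :=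
      (h.ucont.mono (prod_mono (fun y hy => Ioo_subset_Icc_self (hKs hy).1) subset_rfl)).abs
    obtain ⟨p, hp, hmin⟩ := (hK.prod isCompact_Icc).exists_isMinOn
      (hne.prod (nonempty_Icc.2 h.pos.le)) hcont
    exact ⟨|u p.1 p.2|, abs_pos.2 (h.une _ (hKs hp.1) _ hp.2),
      fun x hx t ht => hmin (show (x, t) ∈ K ×ˢ Icc 0 T from ⟨hx, ht⟩)⟩
  obtain ⟨c', hc', hu⟩ := hu
  refine ⟨min c c', lt_min hc hc', hev.mono fun ε hε x hx => ?_⟩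
  obtain ⟨S, hS, hSx⟩ := h.exists_sign (hKs hx)
  refine ⟨S, hS, fun t ht => ⟨(min_le_left _ _).trans (hε x hx S hS hSx t ht), ?_⟩⟩
  refine (min_le_right _ _).trans ((hu x hx t ht).trans_eq ?_)
  have := h.sign_u (hKs hx) hS hSx t ht
  rw [← abs_of_pos this, abs_mul]
  rcases hS with rfl | rfl <;> simp

end ConvData

theorem RegCoef.continuous_A {ε : ℝ} {A R : ℝ → ℝ} (h : RegCoef ε A R) : Continuous A := by
  refine (LipschitzWith.of_dist_le_mul (K := 1) fun w z => ?_).continuous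
  simpa [Real.dist_eq] using h.lipA w z

/-- A modulus for the distance of the regularised coefficients from the limit coefficients. -/
noncomputable def coefErr (M ε : ℝ) : ℝ := (ε + 2 * √ε * √M) * (1 + 2 * M)

theorem tendsto_coefErr (M : ℝ) : Tendsto (coefErr M) (𝓝[>] (0:ℝ)) (𝓝 0) := by
  have : Continuous (coefErr M) := by unfold coefErr; fun_prop
  simpa [coefErr] using (this.tendsto 0).mono_left nhdsWithin_le_nhds

theorem RegCoef.abs_A_sub_le {ε M : ℝ} {A R : ℝ → ℝ} (h : RegCoef ε A R) (hε : 0 < ε)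
    (hM : 1 ≤ M) {z : ℝ} (hz : |z| ≤ M) : |A z - (|z|)| ≤ coefErr M ε := by
  refine (h.closeA z).trans ?_
  have h1 : √|z| ≤ √M := Real.sqrt_le_sqrt hz
  have h2 : √ε * √|z| ≤ √ε * √M := mul_le_mul_of_nonneg_left h1 (Real.sqrt_nonneg _)
  have h3 : 0 ≤ √ε * √M := by positivity
  unfold coefErr
  nlinarith [mul_nonneg (by linarith : (0:ℝ) ≤ ε + 2 * √ε * √M) (by linarith : 0 ≤ 2 * M)]

theorem RegCoef.abs_R_sub_le {ε M : ℝ} {A R : ℝ → ℝ} (h : RegCoef ε A R) (hε : 0 < ε)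
    (hM : 1 ≤ M) {z : ℝ} (hz : |z| ≤ M) : |R z - z * (1 - |z|)| ≤ coefErr M ε := by
  refine (h.closeR z).trans ?_
  have h1 : √|z| ≤ √M := Real.sqrt_le_sqrt hz
  have h2 : 2 * √ε * √|z| ≤ 2 * √ε * √M :=
    mul_le_mul_of_nonneg_left h1 (by positivity)
  unfold coefErr
  gcongr
  linarith

theorem RegCoef.quotient_close {ε c M : ℝ} {A R : ℝ → ℝ} (h : RegCoef ε A R) (hε : 0 < ε)
    (hM : 1 ≤ M) (hc : 0 < c) (he : coefErr M ε ≤ c / 2) {z : ℝ} (hcz : c ≤ |z|) (hz : |z| ≤ M) :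
    |(A z)⁻¹ - (|z|)⁻¹| ≤ coefErr M ε * (2 * (2 + M) / c + 2 / c ^ 2) ∧
    |R z / A z - z / |z| * (1 - |z|)| ≤ coefErr M ε * (2 * (2 + M) / c + 2 / c ^ 2) := by
  have hA := h.abs_A_sub_le hε hM hz
  have hR := h.abs_R_sub_le hε hM hz
  have hk : 0 ≤ coefErr M ε := (abs_nonneg _).trans hA
  have hAc : c / 2 ≤ A z := by linarith [(abs_le.1 hA).1]
  have hz0 : 0 < |z| := hc.trans_le hcz
  have hA0 : 0 < A z := h.pos z
  constructor
  · have : (A z)⁻¹ - (|z|)⁻¹ = (|z| - A z) / (A z * |z|) := by field_simp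
    rw [this, abs_div, abs_of_pos (mul_pos hA0 hz0), abs_sub_comm]
    calc |A z - (|z|)| / (A z * |z|) ≤ coefErr M ε / (c / 2 * c) := by gcongr
      _ = coefErr M ε * (2 / c ^ 2) := by field_simp
      _ ≤ _ := by
        refine mul_le_mul_of_nonneg_left ?_ hk
        have : 0 ≤ 2 * (2 + M) / c := by positivity
        linarith
  · have : R z / A z - z / |z| * (1 - |z|)
        = ((R z - z * (1 - |z|)) - z / |z| * (1 - |z|) * (A z - |z|)) / A z := by
      field_simp; ring
    rw [this, abs_div, abs_of_pos hA0]
    have h1 : |z / |z| * (1 - |z|) * (A z - |z|)| ≤ (1 + M) * coefErr M ε := by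
      rw [abs_mul, abs_mul, abs_div, abs_abs, div_self hz0.ne', one_mul]
      have : |1 - (|z|)| ≤ 1 + M := by rw [abs_le]; constructor <;> linarith
      gcongr
    calc _ ≤ (coefErr M ε + (1 + M) * coefErr M ε) / (c / 2) := by
          gcongr
          exact (abs_sub _ _).trans (add_le_add hR h1)
      _ = coefErr M ε * (2 * (2 + M) / c) := by field_simp; ring
      _ ≤ _ := by
        refine mul_le_mul_of_nonneg_left ?_ hk
        have : 0 ≤ 2 / c ^ 2 := by positivity
        linarith

/-- Differentiation under the integral sign with a jointly continuous derivative. -/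
theorem hasDerivAt_integral_of_continuousOn {D : Set ℝ} (hD : IsOpen D) {T η t x : ℝ}
    (hη : 0 < η) (hηt : η ≤ t) (htT : t ≤ T) (hx : x ∈ D) {f f' : ℝ → ℝ → ℝ}
    (hd : ∀ y ∈ D, ∀ s ∈ Ioc 0 T, HasDerivAt (fun y => f y s) (f' y s) y)
    (hc : ∀ y ∈ D, ContinuousOn (fun s => f y s) (Ioc 0 T))
    (hc' : ContinuousOn (fun p : ℝ × ℝ => f' p.1 p.2) (D ×ˢ Ioc 0 T)) :
    HasDerivAt (fun y => ∫ s in η..t, f y s) (∫ s in η..t, f' x s) x := by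
  obtain ⟨r, hr, hrD⟩ := Metric.nhds_basis_closedBall.mem_iff.1 (hD.mem_nhds hx)
  have hsub : Icc η t ⊆ Ioc 0 T := fun s hs => ⟨hη.trans_le hs.1, hs.2.trans htT⟩
  have huI : uIcc η t ⊆ Ioc 0 T := by rwa [uIcc_of_le hηt]
  have hK : IsCompact (Metric.closedBall x r ×ˢ Icc η t) :=
    (isCompact_closedBall x r).prod isCompact_Icc
  obtain ⟨C, hC⟩ := hK.exists_bound_of_continuousOn (hc'.mono (prod_mono hrD hsub))
  have hcx : ContinuousOn (fun s => f' x s) (Ioc 0 T) :=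
    hc'.comp (f := fun s : ℝ => (x, s)) (by fun_prop) fun s hs => ⟨hx, hs⟩
  have hio : Set.uIoc η t ⊆ Icc η t := by rw [uIoc_of_le hηt]; exact Ioc_subset_Icc_self
  refine (intervalIntegral.hasDerivAt_integral_of_dominated_loc_of_deriv_le
    (μ := volume) (F := f) (F' := f') (bound := fun _ => C) (s := Metric.closedBall x r)
    (Metric.closedBall_mem_nhds x hr) ?_ ?_ ?_ ?_ ?_ ?_).2
  · filter_upwards [Metric.closedBall_mem_nhds x hr] with y hy
    exact ((hc y (hrD hy)).mono huI).intervalIntegrable.aestronglyMeasurable_restrict_uIoc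
  · exact ((hc x hx).mono huI).intervalIntegrable
  · exact (hcx.mono huI).intervalIntegrable.aestronglyMeasurable_restrict_uIoc
  · exact Eventually.of_forall fun s hs y hy => hC (y, s) ⟨hy, hio hs⟩
  · exact _root_.intervalIntegrable_const
  · exact Eventually.of_forall fun s hs y hy => hd y (hrD hy) s (hsub (hio hs))

theorem C21On.integral_xx_nonpos {T η t x : ℝ} {D : Set ℝ} {z : ℝ → ℝ → ℝ} (h : C21On T D z)
    (hD : IsOpen D) (hx : x ∈ D) (hη : 0 < η) (hηt : η ≤ t) (htT : t ≤ T)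
    (hmax : IsLocalMax (fun y => ∫ s in η..t, z y s) x) : ∫ s in η..t, pdxx z x s ≤ 0 := by
  have hcx : ∀ y ∈ D, ContinuousOn (fun s => pdx z y s) (Ioc 0 T) := fun y hy =>
    h.cont_x.comp (f := fun s : ℝ => (y, s)) (by fun_prop) fun s hs => ⟨hy, hs⟩
  have h1 : ∀ y ∈ D, HasDerivAt (fun y => ∫ s in η..t, z y s) (∫ s in η..t, pdx z y s) y :=
    fun y hy => hasDerivAt_integral_of_continuousOn hD hη hηt htT hy
      (fun y hy s hs => h.hasDerivAt_x hy hs) (fun y hy => h.continuousOn_t hy) h.cont_x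
  have h2 : HasDerivAt (fun y => ∫ s in η..t, pdx z y s) (∫ s in η..t, pdxx z x s) x :=
    hasDerivAt_integral_of_continuousOn hD hη hηt htT hx
      (fun y hy s hs => h.hasDerivAt_xx hy hs) hcx h.cont_xx
  have h3 : deriv (fun y => ∫ s in η..t, z y s) =ᶠ[𝓝 x] fun y => ∫ s in η..t, pdx z y s := by
    filter_upwards [hD.mem_nhds hx] with y hy using (h1 y hy).deriv
  have := hmax.deriv_deriv_nonpos (h1 x hx).continuousAt
  rwa [h3.deriv_eq, h2.deriv] at this

theorem abs_eq_sign_mul {S z : ℝ} (hS : S = 1 ∨ S = -1) (hz : 0 < S * z) : |z| = S * z := by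
  rw [← abs_of_pos hz, abs_mul]
  rcases hS with rfl | rfl <;> simp

theorem hasDerivAt_sign_log {S z : ℝ} (hS : S = 1 ∨ S = -1) (hz : 0 < S * z) :
    HasDerivAt (fun z => S * Real.log (S * z)) (|z|)⁻¹ z := by
  have h1 : HasDerivAt (fun z => S * z) S z := by simpa using (hasDerivAt_id z).const_mul S
  have h2 : (|z|)⁻¹ = S * (S / (S * z)) := by
    rw [abs_eq_sign_mul hS hz, mul_div_assoc',
      show S * S = 1 by rcases hS with rfl | rfl <;> norm_num, one_div]
  rw [h2]
  exact (h1.log hz.ne').const_mul S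

theorem sign_log_mono {S x y : ℝ} (hS : S = 1 ∨ S = -1) (hx : 0 < S * x) (hy : 0 < S * y)
    (h : x ≤ y) : S * Real.log (S * x) ≤ S * Real.log (S * y) := by
  rcases hS with rfl | rfl
  · simpa using Real.log_le_log (by linarith) (by linarith)
  · have := Real.log_le_log hy (show -1 * y ≤ -1 * x by linarith)
    linarith

theorem sign_log_sub_le {S x y c δ : ℝ} (hS : S = 1 ∨ S = -1) (hc : 0 < c) (hx : c ≤ S * x)
    (hy : c ≤ S * y) (hδ : 0 ≤ δ) (h : x ≤ y + δ) :
    S * Real.log (S * x) - S * Real.log (S * y) ≤ δ / c := by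
  have key : ∀ p q : ℝ, c ≤ p → c ≤ q → p ≤ q + δ → Real.log p - Real.log q ≤ δ / c := by
    intro p q hp hq hpq
    have hp0 := hc.trans_le hp
    have hq0 := hc.trans_le hq
    rw [← Real.log_div hp0.ne' hq0.ne']
    refine (Real.log_le_sub_one_of_pos (by positivity)).trans ?_
    calc p / q - 1 = (p - q) / q := by field_simp
      _ ≤ δ / q := by gcongr; linarith
      _ ≤ δ / c := by gcongr
  rcases hS with rfl | rfl
  · simpa using key (1 * x) (1 * y) hx hy (by linarith)
  · have := key (-1 * y) (-1 * x) hy hx (by linarith)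
    linarith

/-- One-dimensional comparison along a vertical segment: dividing both equations by their diffusion
coefficients and integrating in time controls `∫ (V - U)`. -/
theorem integral_sub_le_of_equations {A R : ℝ → ℝ} (hAc : Continuous A) (hA : ∀ z, 0 < A z)
    {η t c M e δ S : ℝ} (hηt : η ≤ t) (hS : S = 1 ∨ S = -1) (hc : 0 < c) (he0 : 0 ≤ e)
    (hδ : 0 ≤ δ)
    (he : ∀ z, c ≤ |z| → |z| ≤ M → |(A z)⁻¹ - (|z|)⁻¹| ≤ e ∧
      |R z / A z - z / |z| * (1 - |z|)| ≤ e)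
    {V U Vt Ut Vxx Uxx : ℝ → ℝ} (hV : ContinuousOn V (Icc η t)) (hU : ContinuousOn U (Icc η t))
    (hVt : ∀ s ∈ Ioo η t, HasDerivAt V (Vt s) s) (hUt : ∀ s ∈ Ioo η t, HasDerivAt U (Ut s) s)
    (hVxx : ContinuousOn Vxx (Icc η t)) (hUxx : ContinuousOn Uxx (Icc η t))
    (eqV : ∀ s ∈ Ioo η t, Vt s = A (V s) * Vxx s + R (V s))
    (eqU : ∀ s ∈ Ioo η t, Ut s = |U s| * Uxx s + U s * (1 - |U s|))
    (hVb : ∀ s ∈ Icc η t, c ≤ S * V s ∧ |V s| ≤ M) (hUb : ∀ s ∈ Icc η t, c ≤ S * U s)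
    (hxx : ∫ s in η..t, (Vxx s - Uxx s) ≤ 0) (h0 : V η ≤ U η + δ) (h1 : U t ≤ V t) :
    ∫ s in η..t, (V s - U s) ≤ e * (t - η + 2 * M) + δ / c := by
  have hS2 : S * S = 1 := by rcases hS with rfl | rfl <;> norm_num
  have hηm : η ∈ Icc η t := ⟨le_rfl, hηt⟩
  have htm : t ∈ Icc η t := ⟨hηt, le_rfl⟩
  set B : ℝ → ℝ := fun z => ∫ y in (V η)..z, (A y)⁻¹ with hB
  have hAi : Continuous fun z => (A z)⁻¹ := hAc.inv₀ fun z => (hA z).ne'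
  have hBd : ∀ z, HasDerivAt B (A z)⁻¹ z := fun z =>
    intervalIntegral.integral_hasDerivAt_right (hAi.intervalIntegrable _ _)
      hAi.aestronglyMeasurable.stronglyMeasurableAtFilter hAi.continuousAt
  have hBη : B (V η) = 0 := intervalIntegral.integral_same
  have hBlog : |(B (V t) - S * Real.log (S * V t)) - (B (V η) - S * Real.log (S * V η))|
      ≤ e * (2 * M) := by
    set s : Set ℝ := {z | c ≤ S * z ∧ |z| ≤ M} with hs
    have hconv : Convex ℝ s := by
      intro x hx y hy p q hp hq hpq
      have hx2 := abs_le.1 hx.2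
      have hy2 := abs_le.1 hy.2
      refine ⟨?_, abs_le.2 ⟨?_, ?_⟩⟩ <;> simp only [smul_eq_mul]
      · nlinarith [mul_le_mul_of_nonneg_left hx.1 hp, mul_le_mul_of_nonneg_left hy.1 hq]
      · nlinarith [mul_le_mul_of_nonneg_left hx2.1 hp, mul_le_mul_of_nonneg_left hy2.1 hq]
      · nlinarith [mul_le_mul_of_nonneg_left hx2.2 hp, mul_le_mul_of_nonneg_left hy2.2 hq]
    have := hconv.norm_image_sub_le_of_norm_hasDerivWithin_le
      (f := fun z => B z - S * Real.log (S * z)) (f' := fun z => (A z)⁻¹ - (|z|)⁻¹) (C := e)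
      (fun z hz => ((hBd z).sub (hasDerivAt_sign_log hS (hc.trans_le hz.1))).hasDerivWithinAt)
      (fun z hz => (he z (by rw [abs_eq_sign_mul hS (hc.trans_le hz.1)]; exact hz.1) hz.2).1)
      (hVb η hηm) (hVb t htm)
    simp only [Real.norm_eq_abs] at this
    refine this.trans (mul_le_mul_of_nonneg_left ?_ he0)
    have := abs_sub (V t) (V η)
    linarith [(hVb η hηm).2, (hVb t htm).2]
  have hmain := intervalIntegral.sub_le_integral_of_hasDeriv_right_of_le hηt
    (g := fun s => B (V s) - S * Real.log (S * U s))
    (g' := fun s => (A (V s))⁻¹ * Vt s - (|U s|)⁻¹ * Ut s)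
    (φ := fun s => (Vxx s - Uxx s) + (e - (V s - U s))) ?_ ?_ ?_ ?_
  · have hi1 : IntervalIntegrable (fun s => Vxx s - Uxx s) volume η t :=
      (hVxx.sub hUxx).intervalIntegrable_of_Icc hηt
    have hi2 : IntervalIntegrable (fun s => V s - U s) volume η t :=
      (hV.sub hU).intervalIntegrable_of_Icc hηt
    rw [intervalIntegral.integral_add hi1 (intervalIntegrable_const.sub hi2),
      intervalIntegral.integral_sub intervalIntegrable_const hi2,
      intervalIntegral.integral_const, smul_eq_mul] at hmain
    have a1 := sign_log_mono hS (hc.trans_le (hUb t htm)) (hc.trans_le (hVb t htm).1) h1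
    have a2 := sign_log_sub_le hS hc (hVb η hηm).1 (hUb η hηm) hδ h0
    have a3 := (abs_le.1 hBlog).1
    nlinarith
  · refine ContinuousOn.sub ?_ ?_
    · exact (continuous_iff_continuousAt.2 fun z => (hBd z).continuousAt).comp_continuousOn hV
    · refine continuousOn_const.mul (ContinuousOn.log (continuousOn_const.mul hU) fun s hs => ?_)
      exact (hc.trans_le (hUb s hs)).ne'
  · intro s hs
    have hs' := Ioo_subset_Icc_self hs
    have e1 := (hBd (V s)).comp s (hVt s hs)
    have e2 := (hasDerivAt_sign_log hS (hc.trans_le (hUb s hs'))).comp s (hUt s hs)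
    exact (e1.sub e2).hasDerivWithinAt
  · exact (((hVxx.sub hUxx).add (continuousOn_const.sub (hV.sub hU))).integrableOn_Icc)
  · intro s hs
    have hs' := Ioo_subset_Icc_self hs
    have hVp := hc.trans_le (hVb s hs').1
    have hUp := hc.trans_le (hUb s hs')
    have hVa := abs_eq_sign_mul hS hVp
    have hUa := abs_eq_sign_mul hS hUp
    have e1 := (abs_le.1 (he (V s) (by rw [hVa]; exact (hVb s hs').1) (hVb s hs').2).2).2
    have hsg : ∀ z, 0 < S * z → z / (S * z) = S := fun z hz => by
      rw [div_eq_iff hz.ne', ← mul_assoc, hS2, one_mul]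
    rw [hVa, hsg _ hVp] at e1
    have e2 : (A (V s))⁻¹ * Vt s = Vxx s + R (V s) / A (V s) := by
      rw [eqV s hs]; field_simp [(hA (V s)).ne']
    have e3 : (|U s|)⁻¹ * Ut s = Uxx s + (S - U s) := by
      rw [eqU s hs, mul_add, hUa, inv_mul_cancel_left₀ hUp.ne']
      rw [← mul_assoc, inv_mul_eq_div, hsg _ hUp]
      linear_combination -hS2 * U s
    rw [e2, e3]
    linear_combination e1 - hS2 * V s

namespace C21On

variable {T : ℝ} {D : Set ℝ} {v w : ℝ → ℝ → ℝ}

theorem pdx_sub (hv : C21On T D v) (hw : C21On T D w) {x t : ℝ} (hx : x ∈ D) (ht : t ∈ Ioc 0 T) :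
    pdx (fun x t => v x t - w x t) x t = pdx v x t - pdx w x t :=
  ((hv.hasDerivAt_x hx ht).sub (hw.hasDerivAt_x hx ht)).deriv

theorem hasDerivAt_xx_sub (hv : C21On T D v) (hw : C21On T D w) (hD : IsOpen D) {x t : ℝ}
    (hx : x ∈ D) (ht : t ∈ Ioc 0 T) :
    HasDerivAt (fun y => pdx (fun x t => v x t - w x t) y t) (pdxx v x t - pdxx w x t) x :=
  ((hv.hasDerivAt_xx hx ht).sub (hw.hasDerivAt_xx hx ht)).congr_of_eventuallyEq <| by
    filter_upwards [hD.mem_nhds hx] with y hy using hv.pdx_sub hw hy ht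

theorem hasDerivWithinAt_t_sub (hv : C21On T D v) (hw : C21On T D w) {x t : ℝ}
    (hx : x ∈ D) (ht : t ∈ Ioc 0 T) :
    HasDerivWithinAt (fun s => v x s - w x s) (pdtW T v x t - pdtW T w x t) (Iic T) t :=
  (hv.diff_t x hx t ht).hasDerivWithinAt.sub (hw.diff_t x hx t ht).hasDerivWithinAt

theorem sub (hv : C21On T D v) (hw : C21On T D w) (hD : IsOpen D) :
    C21On T D fun x t => v x t - w x t where
  diff_x x hx t ht := (hv.diff_x x hx t ht).sub (hw.diff_x x hx t ht)
  diff_xx _ hx _ ht := (hv.hasDerivAt_xx_sub hw hD hx ht).differentiableAt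
  diff_t x hx t ht := (hv.diff_t x hx t ht).sub (hw.diff_t x hx t ht)
  cont_x := (hv.cont_x.sub hw.cont_x).congr fun _ hp => hv.pdx_sub hw hp.1 hp.2
  cont_xx := (hv.cont_xx.sub hw.cont_xx).congr fun _ hp =>
    (hv.hasDerivAt_xx_sub hw hD hp.1 hp.2).deriv
  cont_t := (hv.cont_t.sub hw.cont_t).congr fun _ hp =>
    (hv.hasDerivWithinAt_t_sub hw hp.1 hp.2).derivWithin (uniqueDiffOn_Iic T _ hp.2.2)

end C21On

namespace ConvData

variable {a b T M : ℝ} {N₀ : Set ℝ} {u₀ : ℝ → ℝ} {A R : ℝ → ℝ → ℝ} {v : ℝ → ℝ → ℝ → ℝ}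
  {u : ℝ → ℝ → ℝ}

theorem unif (h : ConvData a b T M N₀ u₀ A R v u) {δ : ℝ} (hδ : 0 < δ) :
    ∃ r > 0, ∀ x ∈ Icc a b, ∀ y ∈ Icc a b, ∀ t ∈ Icc 0 T, ∀ s ∈ Icc 0 T,
      |x - y| < r → |t - s| < r → |u x t - u y s| < δ := by
  obtain ⟨r, hr, H⟩ := Metric.uniformContinuousOn_iff.1
    ((isCompact_Icc.prod isCompact_Icc).uniformContinuousOn_of_continuous h.ucont) δ hδ
  refine ⟨r, hr, fun x hx y hy t ht s hs hxy hts => ?_⟩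
  have := H (x, t) ⟨hx, ht⟩ (y, s) ⟨hy, hs⟩ (by
    rw [Prod.dist_eq, Real.dist_eq, Real.dist_eq]; exact max_lt hxy hts)
  simpa [Real.dist_eq] using this

theorem eventually_lt_near (h : ConvData a b T M N₀ u₀ A R v u) {z : ℝ}
    (hz : z ∈ insert a (insert b N₀)) {δ : ℝ} (hδ : 0 < δ) :
    ∃ r > 0, ∀ᶠ ε in 𝓝[>] (0:ℝ), ∀ x ∈ Icc a b, |x - z| < r → ∀ t ∈ Icc 0 T,
      v ε x t < u x t + δ := by
  obtain ⟨r, hr, h1⟩ := h.eventually_le_near hz (half_pos hδ)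
  obtain ⟨r', hr', h2⟩ := h.unif (half_pos hδ)
  have hzI : z ∈ Icc a b := by
    rcases hz with rfl | rfl | hz
    · exact ⟨le_rfl, h.lt.le⟩
    · exact ⟨h.lt.le, le_rfl⟩
    · exact Ioo_subset_Icc_self (h.sub hz)
  refine ⟨min r r', lt_min hr hr', h1.mono fun ε hε x hx hxz t ht => ?_⟩
  have a1 := hε x hx (hxz.trans_le (min_le_left _ _)) t ht
  have a2 := h2 x hx z hzI t ht t ht (hxz.trans_le (min_le_right _ _)) (by simpa using hr')
  rw [h.ulat z hz t ht, abs_lt] at a2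
  linarith [a2.1]

theorem eventually_lt_initial (h : ConvData a b T M N₀ u₀ A R v u) {δ : ℝ} (hδ : 0 < δ) :
    ∃ η > 0, ∀ᶠ ε in 𝓝[>] (0:ℝ), ∀ x ∈ Icc a b, ∀ t ∈ Icc 0 T, t ≤ η →
      v ε x t < u x t + δ := by
  obtain ⟨r, hr, h1⟩ := h.eventually_le_initial (half_pos hδ)
  obtain ⟨r', hr', h2⟩ := h.unif (half_pos hδ)
  refine ⟨min r (r' / 2), by positivity, h1.mono fun ε hε x hx t ht hte => ?_⟩
  have a1 := hε x hx t ht (hte.trans (min_le_left _ _))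
  have a2 := h2 x hx x hx t ht 0 ⟨le_rfl, h.pos.le⟩ (by simpa using hr') (by
    rw [sub_zero, abs_of_nonneg ht.1]
    linarith [hte.trans (min_le_right _ _)])
  rw [h.uinit x hx, abs_lt] at a2
  linarith [a2.1]

theorem exists_compact_lt (h : ConvData a b T M N₀ u₀ A R v u) {δ : ℝ} (hδ : 0 < δ) :
    ∃ K : Set ℝ, IsCompact K ∧ K ⊆ Ioo a b \ N₀ ∧ ∀ᶠ ε in 𝓝[>] (0:ℝ), ∀ x ∈ Icc a b, x ∉ K →
      ∀ t ∈ Icc 0 T, v ε x t < u x t + δ := by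
  choose! r hr hev using fun z (hz : z ∈ insert a (insert b N₀)) => h.eventually_lt_near hz hδ
  have hfin : (insert a (insert b N₀)).Finite := (h.fin.insert b).insert a
  set U := ⋃ z ∈ insert a (insert b N₀), Metric.ball z (r z)
  have hU : IsOpen U := isOpen_biUnion fun z _ => Metric.isOpen_ball
  have hmem : ∀ z ∈ insert a (insert b N₀), z ∈ U := fun z hz =>
    mem_biUnion hz (Metric.mem_ball_self (hr z hz))
  refine ⟨Icc a b \ U, isCompact_Icc.diff hU, fun x hx => ⟨⟨?_, ?_⟩, fun hxN => ?_⟩, ?_⟩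
  · exact lt_of_le_of_ne hx.1.1 fun hxa => hx.2 (hxa ▸ hmem a (by simp))
  · exact lt_of_le_of_ne hx.1.2 fun hxb => hx.2 (hxb ▸ hmem b (by simp))
  · exact hx.2 (hmem x (by simp [hxN]))
  · filter_upwards [(eventually_all_finite hfin).2 hev] with ε hε x hx hxK t ht
    have hxU : x ∈ U := by by_contra hxU; exact hxK ⟨hx, hxU⟩
    obtain ⟨z, hz, hxz⟩ := mem_iUnion₂.1 hxU
    exact hε z hz x hx (by simpa [Real.dist_eq] using hxz) t ht

end ConvData

/-- Maximum principle for the time integral: at a maximum point of `∫_η^t (v - u)` one has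
`v ≥ u` and `∫ (v - u)_xx ≤ 0`. -/
theorem integral_le_of_critical {a b T η C : ℝ} {K D : Set ℝ} {v u : ℝ → ℝ → ℝ}
    (hη : 0 < η) (hD : IsOpen D) (hDs : D ⊆ Ioo a b) (hK : K ⊆ D) (hC : 0 ≤ C)
    (hv : ContinuousOn (fun p : ℝ × ℝ => v p.1 p.2) (Icc a b ×ˢ Icc 0 T))
    (hu : ContinuousOn (fun p : ℝ × ℝ => u p.1 p.2) (Icc a b ×ˢ Icc 0 T))
    (cv : C21On T D v) (cu : C21On T D u)
    (hnear : ∀ x ∈ Icc a b, x ∉ K → ∀ t ∈ Icc η T, ∫ s in η..t, (v x s - u x s) ≤ C)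
    (hcrit : ∀ x ∈ K, ∀ t ∈ Icc η T, u x t ≤ v x t →
      ∫ s in η..t, (pdxx v x s - pdxx u x s) ≤ 0 → ∫ s in η..t, (v x s - u x s) ≤ C) :
    ∀ x ∈ Icc a b, ∀ t ∈ Icc η T, ∫ s in η..t, (v x s - u x s) ≤ C := by
  intro x₀ hx₀ t₀ ht₀
  have hab : a ≤ b := hx₀.1.trans hx₀.2
  have hT : 0 ≤ T := hη.le.trans (ht₀.1.trans ht₀.2)
  set F : ℝ → ℝ → ℝ := fun x s => v (projIcc a b hab x) (projIcc 0 T hT s)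
    - u (projIcc a b hab x) (projIcc 0 T hT s) with hF
  have hFc : Continuous (Function.uncurry F) := by
    have hp : Continuous fun p : ℝ × ℝ =>
        (((projIcc a b hab p.1 : ℝ), (projIcc 0 T hT p.2 : ℝ)) : ℝ × ℝ) :=
      (continuous_subtype_val.comp (continuous_projIcc.comp continuous_fst)).prodMk
        (continuous_subtype_val.comp (continuous_projIcc.comp continuous_snd))
    exact (hv.sub hu).comp_continuous hp fun p => ⟨Subtype.prop _, Subtype.prop _⟩
  have hFe : ∀ x ∈ Icc a b, ∀ s ∈ Icc 0 T, F x s = v x s - u x s := fun x hx s hs => by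
    simp only [hF, projIcc_of_mem hab hx, projIcc_of_mem hT hs]
  have hFi : ∀ x ∈ Icc a b, ∀ t ∈ Icc η T,
      ∫ s in η..t, F x s = ∫ s in η..t, (v x s - u x s) := fun x hx t ht =>
    intervalIntegral.integral_congr fun s hs => by
      rw [uIcc_of_le ht.1] at hs
      exact hFe x hx s ⟨hη.le.trans hs.1, hs.2.trans ht.2⟩
  have hW : Continuous fun p : ℝ × ℝ => ∫ s in η..p.2, F p.1 s :=
    intervalIntegral.continuous_parametric_intervalIntegral_of_continuous
      (f := fun (p : ℝ × ℝ) s => F p.1 s)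
      (hFc.comp ((continuous_fst.comp continuous_fst).prodMk continuous_snd)) continuous_snd
  obtain ⟨⟨x, t⟩, ⟨hx, ht⟩, hmax⟩ := (isCompact_Icc.prod isCompact_Icc).exists_isMaxOn
    (⟨(x₀, t₀), hx₀, ht₀⟩ : (Icc a b ×ˢ Icc η T).Nonempty) hW.continuousOn
  have hmax' : ∀ y ∈ Icc a b, ∀ s ∈ Icc η T,
      ∫ r in η..s, F y r ≤ ∫ r in η..t, F x r := fun y hy s hs => hmax (a := (y, s)) ⟨hy, hs⟩
  simp only at hx ht
  rw [← hFi x₀ hx₀ t₀ ht₀]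
  refine (hmax' x₀ hx₀ t₀ ht₀).trans ?_
  rcases ht.1.eq_or_lt with rfl | htη
  · simpa using hC
  rw [hFi x hx t ht]
  by_cases hxK : x ∈ K
  swap
  · exact hnear x hx hxK t ht
  have hxD := hK hxK
  have ht0 : 0 < t := hη.trans htη
  refine hcrit x hxK t ht ?_ ?_
  · have hFx : Continuous (F x) := hFc.comp (by fun_prop : Continuous fun s : ℝ => (x, s))
    have hd : HasDerivAt (fun s => ∫ r in η..s, F x r) (F x t) t :=
      intervalIntegral.integral_hasDerivAt_right (hFx.intervalIntegrable _ _)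
        hFx.aestronglyMeasurable.stronglyMeasurableAtFilter hFx.continuousAt
    have := (hd.hasDerivWithinAt (s := Iic t)).nonneg_of_left_max (by
      filter_upwards [Ioo_mem_nhdsLT htη] with s hs
      exact hmax' x hx s ⟨hs.1.le, hs.2.le.trans ht.2⟩)
    rw [hFe x hx t ⟨ht0.le, ht.2⟩] at this
    linarith
  · have hI : ∀ s ∈ uIcc η t, pdxx (fun x t => v x t - u x t) x s = pdxx v x s - pdxx u x s := by
      intro s hs
      rw [uIcc_of_le ht.1] at hs
      exact (cv.hasDerivAt_xx_sub cu hD hxD ⟨hη.trans_le hs.1, hs.2.trans ht.2⟩).deriv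
    rw [← intervalIntegral.integral_congr hI]
    refine (cv.sub cu hD).integral_xx_nonpos hD hxD hη ht.1 ht.2 ?_
    filter_upwards [hD.mem_nhds hxD] with y hy
    have hyI := Ioo_subset_Icc_self (hDs hy)
    rw [← hFi y hyI t ht, ← hFi x hx t ht]
    exact hmax' y hyI t ht

namespace ConvData

variable {a b T M : ℝ} {N₀ : Set ℝ} {u₀ : ℝ → ℝ} {A R : ℝ → ℝ → ℝ} {v : ℝ → ℝ → ℝ → ℝ}
  {u : ℝ → ℝ → ℝ}

theorem continuousOn_sub_t (h : ConvData a b T M N₀ u₀ A R v u) {ε : ℝ}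
    (hε : RegBdd ε a b T M (A ε) (R ε) (v ε)) {x : ℝ} (hx : x ∈ Icc a b) :
    ContinuousOn (fun s => v ε x s - u x s) (Icc 0 T) :=
  (hε.sol.cont.sub h.ucont).comp (f := fun s : ℝ => (x, s)) (by fun_prop) fun _ hs => ⟨hx, hs⟩

theorem integral_initial_le (h : ConvData a b T M N₀ u₀ A R v u) {ε : ℝ}
    (hε : RegBdd ε a b T M (A ε) (R ε) (v ε)) {x t : ℝ} (hx : x ∈ Icc a b) (ht : t ∈ Icc 0 T) :
    ∫ s in (0:ℝ)..t, (v ε x s - u x s) ≤ 2 * M * t := by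
  have hi : IntervalIntegrable (fun s => v ε x s - u x s) volume 0 t :=
    ((h.continuousOn_sub_t hε hx).mono (Icc_subset_Icc le_rfl ht.2)).intervalIntegrable_of_Icc ht.1
  have := intervalIntegral.integral_mono_on ht.1 hi (intervalIntegrable_const (c := 2 * M))
    fun s hs => by
      have hs' : s ∈ Icc 0 T := ⟨hs.1, hs.2.trans ht.2⟩
      linarith [(abs_le.1 (hε.bdd x hx s hs')).2, (abs_le.1 (h.ubdd x hx s hs')).1]
  refine this.trans_eq ?_
  rw [intervalIntegral.integral_const, smul_eq_mul]; ring

theorem eventually_integral_le (h : ConvData a b T M N₀ u₀ A R v u) {δ : ℝ} (hδ : 0 < δ) :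
    ∀ᶠ ε in 𝓝[>] (0:ℝ), ∀ x ∈ Icc a b, ∀ t ∈ Icc 0 T,
      ∫ s in (0:ℝ)..t, (v ε x s - u x s) ≤ δ := by
  have hT := h.pos
  have hM := h.one_le
  have hM0 : 0 < M := by linarith
  obtain ⟨K, hKc, hKs, hKev⟩ := h.exists_compact_lt (show 0 < δ / (2 * T) by positivity)
  obtain ⟨c, hc, hcev⟩ := h.exists_sign_lower hKc hKs
  obtain ⟨η₁, hη₁, hηev⟩ := h.eventually_lt_initial (show 0 < c * (δ / 4) by positivity)
  set η := min (min η₁ T) (δ / (4 * M)) with hηdef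
  have hη : 0 < η := by positivity
  have hη1 : η ≤ η₁ := (min_le_left _ _).trans (min_le_left _ _)
  have hηT : η ≤ T := (min_le_left _ _).trans (min_le_right _ _)
  have hηM : 2 * M * η ≤ δ / 2 := by
    have : η ≤ δ / (4 * M) := min_le_right _ _
    rw [le_div_iff₀ (by positivity)] at this
    linarith
  set C₁ := 2 * (2 + M) / c + 2 / c ^ 2 with hC₁
  have hC₁0 : 0 < C₁ := by positivity
  have herr : ∀ᶠ ε in 𝓝[>] (0:ℝ), coefErr M ε * (C₁ * (T + 2 * M)) < δ / 4 := by
    have := (tendsto_coefErr M).mul_const (C₁ * (T + 2 * M))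
    rw [zero_mul] at this
    exact this.eventually_lt_const (by positivity)
  filter_upwards [h.ev, h.c21v, h.eqv, hKev, hcev, hηev, herr, self_mem_nhdsWithin,
    (tendsto_coefErr M).eventually_lt_const (half_pos hc)]
    with ε hb hcv heq hK hsign hinit herr hε hce x hx t ht
  have hε : 0 < ε := hε
  have hcoef0 : 0 ≤ coefErr M ε :=
    (abs_nonneg _).trans (hb.coef.abs_A_sub_le hε hM (z := 0) (by simpa using hM0.le))
  have hmain : ∀ x ∈ Icc a b, ∀ t ∈ Icc η T, ∫ s in η..t, (v ε x s - u x s) ≤ δ / 2 := by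
    refine integral_le_of_critical (K := K) (D := Ioo a b \ N₀) hη h.isOpen_diff sdiff_subset hKs
      (by positivity) hb.sol.cont h.ucont (hcv.mono sdiff_subset) h.c21u ?_ ?_
    · intro x hx hxK t ht
      have hi : IntervalIntegrable (fun s => v ε x s - u x s) volume η t :=
        ((h.continuousOn_sub_t hb hx).mono
          (Icc_subset_Icc hη.le ht.2)).intervalIntegrable_of_Icc ht.1
      have := intervalIntegral.integral_mono_on ht.1 hi
        (intervalIntegrable_const (c := δ / (2 * T))) fun s hs => by
          linarith [hK x hx hxK s ⟨hη.le.trans hs.1, hs.2.trans ht.2⟩]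
      rw [intervalIntegral.integral_const, smul_eq_mul] at this
      refine this.trans ?_
      calc (t - η) * (δ / (2 * T)) ≤ T * (δ / (2 * T)) := by
            gcongr
            linarith [ht.2]
        _ = δ / 2 := by field_simp
    · intro x hxK t ht hle hxx
      obtain ⟨S, hS, hsc⟩ := hsign x hxK
      have hxD := hKs hxK
      have hxI := Ioo_subset_Icc_self hxD.1
      have hIcc : Icc η t ⊆ Ioc 0 T := fun s hs => ⟨hη.trans_le hs.1, hs.2.trans ht.2⟩
      have hIoo : Ioo η t ⊆ Ioo 0 T := fun s hs => ⟨hη.trans hs.1, hs.2.trans_le ht.2⟩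
      have hm : ∀ s ∈ Icc η t, s ∈ Icc 0 T := fun s hs => Ioc_subset_Icc_self (hIcc hs)
      have hcvD := hcv.mono (D' := Ioo a b \ N₀) sdiff_subset
      have hmk : ∀ {g : ℝ × ℝ → ℝ}, ContinuousOn g ((Ioo a b \ N₀) ×ˢ Ioc 0 T) →
          ContinuousOn (fun s => g (x, s)) (Icc η t) := fun hg =>
        hg.comp (f := fun s : ℝ => (x, s)) (by fun_prop) fun s hs => ⟨hxD, hIcc hs⟩
      have := integral_sub_le_of_equations (R := R ε) hb.coef.continuous_A hb.coef.pos ht.1 hS hc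
        (e := coefErr M ε * C₁) (M := M) (δ := c * (δ / 4)) (by positivity) (by positivity)
        (fun z h1 h2 => hb.coef.quotient_close hε hM hc hce.le h1 h2)
        ((hcvD.continuousOn_t hxD).mono hIcc) ((h.c21u.continuousOn_t hxD).mono hIcc)
        (fun s hs => hcvD.hasDerivAt_t hxD (hIoo hs))
        (fun s hs => h.c21u.hasDerivAt_t hxD (hIoo hs))
        (hmk hcvD.cont_xx) (hmk h.c21u.cont_xx)
        (fun s hs => heq x hxD.1 s (hIcc (Ioo_subset_Icc_self hs)))
        (fun s hs => h.equ x hxD s (hIcc (Ioo_subset_Icc_self hs)))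
        (fun s hs => ⟨(hsc s (hm s hs)).1, hb.bdd x hxI s (hm s hs)⟩)
        (fun s hs => (hsc s (hm s hs)).2) hxx (hinit x hxI η ⟨hη.le, hηT⟩ hη1).le hle
      refine this.trans ?_
      have e1 : c * (δ / 4) / c = δ / 4 := by field_simp
      have e2 : coefErr M ε * C₁ * (t - η + 2 * M) ≤ coefErr M ε * (C₁ * (T + 2 * M)) := by
        rw [mul_assoc]
        gcongr
        linarith [ht.2]
      linarith
  rcases le_total t η with hle | hle
  · refine (h.integral_initial_le hb hx ht).trans ?_
    nlinarith
  · have hi : ∀ p q, 0 ≤ p → p ≤ q → q ≤ T →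
        IntervalIntegrable (fun s => v ε x s - u x s) volume p q := fun p q h0 hpq hq =>
      ((h.continuousOn_sub_t hb hx).mono (Icc_subset_Icc h0 hq)).intervalIntegrable_of_Icc hpq
    rw [← intervalIntegral.integral_add_adjacent_intervals (hi 0 η le_rfl hη.le hηT)
      (hi η t hη.le hle ht.2)]
    linarith [h.integral_initial_le hb hx ⟨hη.le, hηT⟩, hmain x hx t ⟨hle, ht.2⟩]

theorem eventually_abs_integral_le (h : ConvData a b T M N₀ u₀ A R v u) {δ : ℝ} (hδ : 0 < δ) :
    ∀ᶠ ε in 𝓝[>] (0:ℝ), ∀ x ∈ Icc a b, ∀ t ∈ Icc 0 T,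
      |∫ s in (0:ℝ)..t, (v ε x s - u x s)| ≤ δ := by
  filter_upwards [h.eventually_integral_le hδ, h.neg.eventually_integral_le hδ]
    with ε h1 h2 x hx t ht
  refine abs_le.2 ⟨?_, h1 x hx t ht⟩
  have := h2 x hx t ht
  rw [show (fun s => -v ε x s - -u x s) = fun s => -(v ε x s - u x s) by funext; ring,
    intervalIntegral.integral_neg] at this
  linarith

end ConvData

theorem HasDerivWithinAt.tendsto_left_quotient {f : ℝ → ℝ} {f' t : ℝ}
    (hf : HasDerivWithinAt f f' (Iic t) t) :
    Tendsto (fun h => (f t - f (t - h)) / h) (𝓝[>] 0) (𝓝 f') := by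
  rw [← hasDerivWithinAt_Iio_iff_Iic, hasDerivWithinAt_iff_tendsto_slope' (by simp)] at hf
  have ht : Tendsto (fun h : ℝ => t - h) (𝓝[>] 0) (𝓝[<] t) := by
    refine tendsto_nhdsWithin_iff.2 ⟨?_, ?_⟩
    · have : Continuous fun h : ℝ => t - h := by fun_prop
      simpa using (this.tendsto 0).mono_left nhdsWithin_le_nhds
    · filter_upwards [self_mem_nhdsWithin] with h hh
      have : 0 < h := hh
      simp [this]
  refine (hf.comp ht).congr fun h => ?_
  rw [Function.comp_apply, slope_def_field, sub_sub_cancel_left, ← neg_div_neg_eq]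
  simp

/-- A solution of `v_t = A(v) v_xx + R(v)` in `(l,r) × (0,T]` along which the equation is uniformly
parabolic, together with all the constants entering interior estimates. -/
structure LocSol (T l r lam Lam F Lc M : ℝ) (A R : ℝ → ℝ) (v : ℝ → ℝ → ℝ) : Prop where
  c21 : C21On T (Ioo l r) v
  cont : ContinuousOn (fun p : ℝ × ℝ => v p.1 p.2) (Ioo l r ×ˢ Ioc 0 T)
  eq : ∀ x ∈ Ioo l r, ∀ t ∈ Ioc 0 T, pdtW T v x t = A (v x t) * pdxx v x t + R (v x t)
  le_A : ∀ x ∈ Ioo l r, ∀ t ∈ Ioc 0 T, lam ≤ A (v x t)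
  A_le : ∀ x ∈ Ioo l r, ∀ t ∈ Ioc 0 T, A (v x t) ≤ Lam
  abs_R_le : ∀ x ∈ Ioo l r, ∀ t ∈ Ioc 0 T, |R (v x t)| ≤ F
  lipA : ∀ w z, |A w - A z| ≤ |w - z|
  lipR : ∀ x ∈ Ioo l r, ∀ t ∈ Ioc 0 T, ∀ s ∈ Ioc 0 T,
    |R (v x t) - R (v x s)| ≤ Lc * |v x t - v x s|
  bdd : ∀ x ∈ Ioo l r, ∀ t ∈ Ioc 0 T, |v x t| ≤ M

/-- The constant in the interior Hölder estimate for the time derivative. -/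
noncomputable def holderConst (lam Lam F Lc : ℝ) : ℝ :=
  ((1 + Lam) * (6 + 2 / lam) + 6 * Lam + 1) * (1 + (1 + F) / lam + Lc)

theorem C21On.abs_sub_le {T m s t x : ℝ} {D : Set ℝ} {v : ℝ → ℝ → ℝ} (h : C21On T D v)
    (hx : x ∈ D) (hs : 0 < s) (hst : s ≤ t) (ht : t ≤ T)
    (hm : ∀ τ ∈ Icc s t, |pdtW T v x τ| ≤ m) : |v x t - v x s| ≤ m * (t - s) := by
  rcases hst.eq_or_lt with rfl | hlt
  · simp
  obtain ⟨τ, hτ, he⟩ := exists_hasDerivAt_eq_slope (fun s => v x s) (fun s => pdtW T v x s) hlt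
    ((h.continuousOn_t hx).mono fun τ hτ => ⟨hs.trans_le hτ.1, hτ.2.trans ht⟩)
    fun τ hτ => h.hasDerivAt_t hx ⟨hs.trans hτ.1, hτ.2.trans_le ht⟩
  have hpos : 0 < t - s := by linarith
  have := hm τ (Ioo_subset_Icc_self hτ)
  rwa [he, abs_div, abs_of_pos hpos, div_le_iff₀ hpos] at this

namespace LocSol

variable {T l r lam Lam F Lc M : ℝ} {A R : ℝ → ℝ} {v : ℝ → ℝ → ℝ}

theorem abs_pdxx_le (h : LocSol T l r lam Lam F Lc M A R v) (hlam : 0 < lam) {x t m : ℝ}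
    (hx : x ∈ Ioo l r) (ht : t ∈ Ioc 0 T) (hm : |pdtW T v x t| ≤ m) :
    |pdxx v x t| ≤ (m + F) / lam := by
  have hA := h.le_A x hx t ht
  have hA0 := hlam.trans_le hA
  have h1 : A (v x t) * pdxx v x t = pdtW T v x t - R (v x t) := by rw [h.eq x hx t ht]; ring
  have h2 : A (v x t) * |pdxx v x t| ≤ m + F := by
    rw [← abs_of_pos hA0, ← abs_mul, h1]
    exact (abs_sub _ _).trans (add_le_add hm (h.abs_R_le x hx t ht))
  rw [le_div_iff₀ hlam]
  nlinarith [abs_nonneg (pdxx v x t)]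

theorem parabolicOn (h : LocSol T l r lam Lam F Lc M A R v) {l' r' s t : ℝ} (hl : l < l')
    (hr : r' < r) (hs : 0 < s) (ht : t ≤ T) : ParabolicOn l' r' s t lam Lam F M v where
  cont := h.cont.mono (prod_mono (Icc_subset_Ioo hl hr)
    fun τ hτ => ⟨hs.trans_le hτ.1, hτ.2.trans ht⟩)
  eq x hx τ hτ := by
    have hx' : x ∈ Ioo l r := ⟨hl.trans hx.1, hx.2.trans hr⟩
    have hτ' : τ ∈ Ioc 0 T := ⟨hs.trans hτ.1, hτ.2.trans ht⟩
    exact ⟨_, _, _, _, h.c21.c21At isOpen_Ioo hx' hτ', h.eq x hx' τ hτ', h.le_A x hx' τ hτ',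
      h.A_le x hx' τ hτ', h.abs_R_le x hx' τ hτ'⟩
  bdd x hx τ hτ := h.bdd x (Icc_subset_Ioo hl hr hx) τ ⟨hs.trans_le hτ.1, hτ.2.trans ht⟩

theorem parabolicOn_quotient (h : LocSol T l r lam Lam F Lc M A R v) (hlam : 0 < lam) (hLc : 0 ≤ Lc)
    {l' r' s t k m : ℝ} (hl : l < l') (hr : r' < r) (hk : 0 < k) (hs : 0 < s - k)
    (ht : t ≤ T) (hVt : ∀ x ∈ Icc l' r', ∀ τ ∈ Icc (s - k) t, |pdtW T v x τ| ≤ m) :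
    ParabolicOn l' r' s t lam Lam (m * ((m + F) / lam + Lc)) m
      fun x τ => (v x τ - v x (τ - k)) / k := by
  have hX := Icc_subset_Ioo hl hr
  have hbd : ∀ x ∈ Icc l' r', ∀ τ ∈ Icc s t, |v x τ - v x (τ - k)| ≤ m * k := by
    intro x hx τ hτ
    have := h.c21.abs_sub_le (m := m) (hX hx) (s := τ - k) (t := τ) (by linarith [hτ.1])
      (by linarith) (hτ.2.trans ht) fun τ' hτ' =>
        hVt x hx τ' ⟨by linarith [hτ.1, hτ'.1], hτ'.2.trans hτ.2⟩
    simpa using this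
  refine ⟨?_, ?_, ?_⟩
  · have hsub : ∀ p ∈ Icc l' r' ×ˢ Icc s t, ((p.1, p.2 - k) : ℝ × ℝ) ∈ Ioo l r ×ˢ Ioc 0 T :=
      fun p hp => ⟨hX hp.1, by linarith [hp.2.1], by linarith [hp.2.2]⟩
    refine ContinuousOn.div_const (ContinuousOn.sub (h.cont.mono fun p hp => ?_)
      (h.cont.comp (f := fun p : ℝ × ℝ => (p.1, p.2 - k)) (by fun_prop) hsub)) k
    exact ⟨hX hp.1, by linarith [hp.2.1], hp.2.2.trans ht⟩
  · intro x hx τ hτ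
    have hx' := hX (Ioo_subset_Icc_self hx)
    have hτ' : τ ∈ Ioc 0 T := ⟨by linarith [hτ.1], hτ.2.trans ht⟩
    have hτk : τ - k ∈ Ioc 0 T := ⟨by linarith [hτ.1], by linarith [hτ.2]⟩
    have c1 := h.c21.c21At isOpen_Ioo hx' hτ'
    have c2 := (h.c21.c21At isOpen_Ioo hx' hτk).shift
    refine ⟨_, _, A (v x τ), (A (v x τ) - A (v x (τ - k))) / k * pdxx v x (τ - k) +
      (R (v x τ) - R (v x (τ - k))) / k, (c1.sub c2).div_const k, ?_, h.le_A x hx' τ hτ',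
      h.A_le x hx' τ hτ', ?_⟩
    · rw [h.eq x hx' τ hτ', h.eq x hx' _ hτk]; field_simp; ring
    · have hb := hbd x (Ioo_subset_Icc_self hx) τ (Ioc_subset_Icc_self hτ)
      have hm0 : 0 ≤ m :=
        (abs_nonneg _).trans (hVt x (Ioo_subset_Icc_self hx) τ ⟨by linarith [hτ.1], hτ.2⟩)
      have hxx := h.abs_pdxx_le hlam hx' hτk (hVt x (Ioo_subset_Icc_self hx) (τ - k)
        ⟨by linarith [hτ.1], by linarith [hτ.2]⟩)
      have e1 : |(A (v x τ) - A (v x (τ - k))) / k| ≤ m := by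
        rw [abs_div, abs_of_pos hk, div_le_iff₀ hk]
        exact (h.lipA _ _).trans hb
      have e2 : |(R (v x τ) - R (v x (τ - k))) / k| ≤ m * Lc := by
        rw [abs_div, abs_of_pos hk, div_le_iff₀ hk]
        refine (h.lipR x hx' τ hτ' _ hτk).trans ?_
        nlinarith [mul_le_mul_of_nonneg_left hb hLc]
      refine (abs_add_le _ _).trans ?_
      rw [abs_mul, mul_add]
      exact add_le_add (mul_le_mul e1 hxx (abs_nonneg _) hm0) e2
  · intro x hx τ hτ
    rw [abs_div, abs_of_pos hk, div_le_iff₀ hk]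
    exact hbd x hx τ hτ

/-- Interior `1/2`-Hölder estimate in time for the time derivative. -/
theorem abs_pdtW_sub_le (h : LocSol T l r lam Lam F Lc M A R v) (hlam : 0 < lam)
    (hlL : lam ≤ Lam) (hF : 0 ≤ F) (hLc : 0 ≤ Lc) {xc tc ϱ m s : ℝ} (hϱ : 0 < ϱ) (hm : 0 < m)
    (hl : l < xc - ϱ) (hr : xc + ϱ < r) (h0 : 0 < tc - 3 * ϱ ^ 2) (htc : tc ≤ T)
    (hVt : ∀ x ∈ Icc (xc - ϱ) (xc + ϱ), ∀ τ ∈ Icc (tc - 3 * ϱ ^ 2) tc, |pdtW T v x τ| ≤ m)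
    (hmϱ : (m + 1) * ϱ ^ 2 ≤ 1) (hs : s ∈ Icc (tc - ϱ ^ 2) tc) :
    |pdtW T v xc tc - pdtW T v xc s| ≤ holderConst lam Lam F Lc * (m / ϱ) * √(tc - s) := by
  have hxc : xc ∈ Ioo l r := ⟨by linarith, by linarith⟩
  have hϱ2 : 0 < ϱ ^ 2 := by positivity
  have q1 := ((h.c21.c21At isOpen_Ioo hxc ⟨by linarith, htc⟩).dt).tendsto_left_quotient
  have q2 := ((h.c21.c21At isOpen_Ioo hxc ⟨by linarith [hs.1], hs.2.trans htc⟩).dt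
    ).tendsto_left_quotient
  refine le_of_tendsto (q1.sub q2).abs ?_
  filter_upwards [Ioc_mem_nhdsGT hϱ2] with k hk
  have hp := h.parabolicOn_quotient (l' := xc - ϱ) (r' := xc + ϱ) (s := tc - 2 * ϱ ^ 2) (t := tc)
    hlam hLc hl hr hk.1 (by linarith [hk.2]) htc fun x hx τ hτ =>
      hVt x hx τ ⟨by linarith [hτ.1, hk.2], hτ.2⟩
  have hLam : 0 < Lam := hlam.trans_le hlL
  refine (hp.abs_sub_le_time hϱ hlam hlL (by positivity) hm hs).trans ?_
  refine mul_le_mul_of_nonneg_right ?_ (Real.sqrt_nonneg _)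
  rw [holderConst, mul_assoc _ _ (m / ϱ)]
  refine mul_le_mul_of_nonneg_left ?_ (by positivity)
  have e1 : ((m + F) / lam + Lc) * ϱ ^ 2 ≤ (1 + F) / lam + Lc := by
    have : (m + F) * ϱ ^ 2 ≤ 1 + F := by nlinarith
    have h2 : (m + F) / lam * ϱ ^ 2 ≤ (1 + F) / lam := by
      rw [div_mul_eq_mul_div]; gcongr
    have h3 : Lc * ϱ ^ 2 ≤ Lc * 1 := by
      refine mul_le_mul_of_nonneg_left ?_ hLc
      nlinarith
    linarith
  calc m / ϱ + m * ((m + F) / lam + Lc) * ϱ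
      = m / ϱ * (1 + ((m + F) / lam + Lc) * ϱ ^ 2) := by field_simp
    _ ≤ m / ϱ * (1 + ((1 + F) / lam + Lc)) := by gcongr
    _ = _ := by ring

end LocSol

theorem one_le_holderConst {lam Lam F Lc : ℝ} (hlam : 0 < lam) (hlL : lam ≤ Lam) (hF : 0 ≤ F)
    (hLc : 0 ≤ Lc) : 1 ≤ holderConst lam Lam F Lc := by
  have hLam : 0 < Lam := hlam.trans_le hlL
  have h1 : 1 ≤ (1 + Lam) * (6 + 2 / lam) + 6 * Lam + 1 := by
    have : 0 ≤ (1 + Lam) * (6 + 2 / lam) + 6 * Lam := by positivity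
    linarith
  have h2 : 1 ≤ 1 + (1 + F) / lam + Lc := by
    have : 0 ≤ (1 + F) / lam + Lc := by positivity
    linarith
  exact one_le_mul_of_one_le_of_one_le h1 h2

namespace LocSol

variable {T l r lam Lam F Lc M : ℝ} {A R : ℝ → ℝ} {v : ℝ → ℝ → ℝ}

/-- Interior bound for the time derivative of a solution with small oscillation in time. -/
theorem sq_mul_abs_pdtW_le (h : LocSol T l r lam Lam F Lc M A R v) (hlam : 0 < lam)
    (hlL : lam ≤ Lam) (hF : 0 ≤ F) (hLc : 0 ≤ Lc) {x₀ ρ s₀ t₂ θ : ℝ} (hρ1 : ρ ≤ 1)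
    (hl : l < x₀ - ρ) (hr : x₀ + ρ < r) (hs₀ : 0 < s₀) (ht₂ : t₂ ≤ T)
    (hθ : 0 < θ) (hθC : 8 * holderConst lam Lam F Lc * θ ≤ 1)
    (hosc : ∀ x ∈ Icc (x₀ - ρ) (x₀ + ρ), ∀ t ∈ Icc s₀ t₂, ∀ s ∈ Icc s₀ t, t - s ≤ ρ ^ 2 →
      |v x t - v x s| < θ ^ 2 / 10) :
    ∀ x ∈ Icc (x₀ - ρ) (x₀ + ρ), ∀ t ∈ Icc s₀ t₂,
      min (ρ - |x - x₀|) √(t - s₀) ^ 2 * |pdtW T v x t| ≤ 1 := by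
  intro x hx t ht
  have hC := one_le_holderConst hlam hlL hF hLc
  set C := holderConst lam Lam F Lc with hCdef
  have hθ1 : θ ≤ 1 := by nlinarith
  have hXs := Icc_subset_Ioo hl hr
  have hTs : Icc s₀ t₂ ⊆ Ioc 0 T := fun τ hτ => ⟨hs₀.trans_le hτ.1, hτ.2.trans ht₂⟩
  set d : ℝ × ℝ → ℝ := fun p => min (ρ - |p.1 - x₀|) √(p.2 - s₀) with hd
  have hdc : Continuous d := by rw [hd]; fun_prop
  have hcont : ContinuousOn (fun p : ℝ × ℝ => d p ^ 2 * |pdtW T v p.1 p.2|)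
      (Icc (x₀ - ρ) (x₀ + ρ) ×ˢ Icc s₀ t₂) :=
    (hdc.pow 2).continuousOn.mul (h.c21.cont_t.mono (prod_mono hXs hTs)).abs
  obtain ⟨⟨x₁, t₁⟩, ⟨hx₁, ht₁⟩, hmax⟩ := (isCompact_Icc.prod isCompact_Icc).exists_isMaxOn
    (⟨(x, t), hx, ht⟩ : (Icc (x₀ - ρ) (x₀ + ρ) ×ˢ Icc s₀ t₂).Nonempty) hcont
  have hmax' : ∀ y ∈ Icc (x₀ - ρ) (x₀ + ρ), ∀ τ ∈ Icc s₀ t₂,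
      d (y, τ) ^ 2 * |pdtW T v y τ| ≤ d (x₁, t₁) ^ 2 * |pdtW T v x₁ t₁| := fun y hy τ hτ =>
    hmax (a := (y, τ)) ⟨hy, hτ⟩
  refine (hmax' x hx t ht).trans ?_
  by_contra! hP
  simp only at hx₁ ht₁
  set d₁ := d (x₁, t₁) with hd₁
  set z := |pdtW T v x₁ t₁| with hz
  have hz0 : 0 ≤ z := abs_nonneg _
  have hd0 : 0 ≤ d₁ := by
    rw [hd₁, hd]
    refine le_min ?_ (Real.sqrt_nonneg _)
    have : |x₁ - x₀| ≤ ρ := abs_le.2 ⟨by linarith [hx₁.1], by linarith [hx₁.2]⟩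
    simpa using this
  have hdpos : 0 < d₁ := by
    rcases hd0.eq_or_lt with h0 | h0
    · rw [← h0] at hP; norm_num at hP
    · exact h0
  have hda : d₁ ≤ ρ - |x₁ - x₀| := min_le_left _ _
  have hdt : d₁ ^ 2 ≤ t₁ - s₀ := by
    have : d₁ ≤ √(t₁ - s₀) := min_le_right _ _
    rwa [Real.le_sqrt hd0 (by linarith [ht₁.1])] at this
  have hdρ : d₁ ≤ ρ := hda.trans (by linarith [abs_nonneg (x₁ - x₀)])
  have hd1 : d₁ ^ 2 ≤ 1 := by nlinarith
  have hz1 : 1 < z := by nlinarith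
  set ϱ := √(1 / (5 * z)) with hϱ
  have hϱ2 : ϱ ^ 2 = 1 / (5 * z) := Real.sq_sqrt (by positivity)
  have hϱ0 : 0 < ϱ := Real.sqrt_pos.2 (by positivity)
  have hϱz : ϱ ^ 2 * (5 * z) = 1 := by rw [hϱ2]; field_simp
  have hϱd2 : 5 * ϱ ^ 2 ≤ d₁ ^ 2 := by
    rw [hϱ2, mul_one_div, div_le_iff₀ (by positivity)]
    linarith
  have hϱ2pos : 0 < ϱ ^ 2 := by positivity
  have hϱd : ϱ ≤ d₁ / 2 := by
    refine (sq_le_sq₀ hϱ0.le (by positivity)).1 ?_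
    rw [div_pow]
    linarith
  have hxx := abs_le.1 (show |x₁ - x₀| ≤ ρ - d₁ by linarith)
  have hbox : ∀ y ∈ Icc (x₁ - ϱ) (x₁ + ϱ), ∀ τ ∈ Icc (t₁ - 3 * ϱ ^ 2) t₁,
      |pdtW T v y τ| ≤ 4 * z := by
    intro y hy τ hτ
    have hy' : |y - x₀| ≤ ρ - d₁ / 2 :=
      abs_le.2 ⟨by linarith [hy.1, hxx.1], by linarith [hy.2, hxx.2]⟩
    have hyI : y ∈ Icc (x₀ - ρ) (x₀ + ρ) := by
      have := abs_le.1 hy'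
      exact ⟨by linarith [this.1], by linarith [this.2]⟩
    have hd2 : d₁ / 2 ≤ d (y, τ) := by
      refine le_min (by simpa using by linarith) ?_
      refine Real.le_sqrt_of_sq_le ?_
      simp only [div_pow]
      linarith [hτ.1]
    have h1 := hmax' y hyI τ ⟨by linarith [hτ.1], hτ.2.trans ht₁.2⟩
    have h2 : (d₁ / 2) ^ 2 ≤ d (y, τ) ^ 2 := by gcongr
    have h3 : (d₁ / 2) ^ 2 * |pdtW T v y τ| ≤ d₁ ^ 2 * z :=
      (mul_le_mul_of_nonneg_right h2 (abs_nonneg _)).trans h1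
    have hd2pos : 0 < d₁ ^ 2 := by positivity
    by_contra! hlt
    have := mul_lt_mul_of_pos_left hlt hd2pos
    rw [div_pow] at h3
    linarith
  have hθϱ : θ ^ 2 * ϱ ^ 2 ≤ ϱ ^ 2 :=
    mul_le_of_le_one_left hϱ2pos.le (pow_le_one₀ hθ.le hθ1)
  set s₁ := t₁ - θ ^ 2 * ϱ ^ 2 with hs₁
  have hs₁s : s₀ < s₁ := by linarith
  have hs₁t : s₁ < t₁ := by
    have : 0 < θ ^ 2 * ϱ ^ 2 := by positivity
    linarith
  have hx₁D := hXs hx₁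
  have hder : ∀ s ∈ Ioo s₁ t₁, z / 2 ≤ |pdtW T v x₁ s| := by
    intro s hs
    have hm1 : (4 * z + 1) * ϱ ^ 2 ≤ 1 := by nlinarith
    have h1 := h.abs_pdtW_sub_le (xc := x₁) (tc := t₁) (s := s) hlam hlL hF hLc hϱ0
      (show 0 < 4 * z by linarith) (by linarith) (by linarith)
      (by linarith) (ht₁.2.trans ht₂) hbox hm1 ⟨by linarith [hs.1], hs.2.le⟩
    have h2 : √(t₁ - s) ≤ θ * ϱ := by
      rw [Real.sqrt_le_left (by positivity), mul_pow]
      linarith [hs.1]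
    have h3 : C * (4 * z / ϱ) * √(t₁ - s) ≤ z / 2 := by
      calc C * (4 * z / ϱ) * √(t₁ - s) ≤ C * (4 * z / ϱ) * (θ * ϱ) := by gcongr
        _ = (8 * C * θ) * (z / 2) := by field_simp; ring
        _ ≤ 1 * (z / 2) := by gcongr
        _ = z / 2 := one_mul _
    have h4 := abs_sub_abs_le_abs_sub (pdtW T v x₁ t₁) (pdtW T v x₁ s)
    linarith
  obtain ⟨ξ, hξ, he⟩ := exists_hasDerivAt_eq_slope (fun s => v x₁ s) (fun s => pdtW T v x₁ s) hs₁t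
    ((h.c21.continuousOn_t hx₁D).mono fun τ hτ =>
      hTs ⟨hs₁s.le.trans hτ.1, hτ.2.trans ht₁.2⟩)
    fun τ hτ => h.c21.hasDerivAt_t hx₁D
      ⟨hs₀.trans (hs₁s.trans hτ.1), hτ.2.trans_le (ht₁.2.trans ht₂)⟩
  have h5 := hder ξ hξ
  have h6 := hosc x₁ hx₁ t₁ ht₁ s₁ ⟨hs₁s.le, hs₁t.le⟩ (by linarith [pow_le_pow_left₀ hd0 hdρ 2])
  have h7 : t₁ - s₁ = θ ^ 2 * ϱ ^ 2 := by rw [hs₁]; ring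
  rw [he, h7, abs_div, abs_of_pos (by positivity : 0 < θ ^ 2 * ϱ ^ 2),
    le_div_iff₀ (by positivity)] at h5
  have h8 : z / 2 * (θ ^ 2 * ϱ ^ 2) = θ ^ 2 / 10 * (ϱ ^ 2 * (5 * z)) := by ring
  rw [hϱz] at h8
  linarith

end LocSol

/-- All continuous strict inequalities that hold at `0` hold at some small positive number. -/
theorem exists_pos_of_eventually {p : ℝ → Prop} (h : ∀ᶠ ϱ in 𝓝 (0:ℝ), p ϱ) : ∃ ϱ > 0, p ϱ := by
  obtain ⟨ϱ, h1, h2⟩ := ((h.filter_mono nhdsWithin_le_nhds).and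
    (self_mem_nhdsWithin (a := (0:ℝ)) (s := Ioi 0))).exists
  exact ⟨ϱ, h2, h1⟩

theorem eventually_lt_zero_of_continuous {f : ℝ → ℝ} (hf : Continuous f) (c : ℝ) (h0 : f 0 < c) :
    ∀ᶠ ϱ in 𝓝 (0:ℝ), f ϱ < c := hf.continuousAt.eventually_lt continuousAt_const h0

/-- Interior estimates which do not depend on the solution. -/
theorem LocSol.exists_uniform_bounds {T l r lam Lam F Lc M x₀ σ : ℝ} (hlam : 0 < lam)
    (hlL : lam ≤ Lam) (hF : 0 ≤ F) (hLc : 0 ≤ Lc) (hM : 0 < M) (hx₀ : x₀ ∈ Ioo l r)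
    (hσ : 0 < σ) :
    ∃ ϱ > 0, ∃ m > 0, ∃ C ≥ 0, Icc (x₀ - ϱ) (x₀ + ϱ) ⊆ Ioo l r ∧ ϱ ^ 2 < σ ∧
      ∀ A R v, LocSol T l r lam Lam F Lc M A R v → ∀ x ∈ Icc (x₀ - ϱ) (x₀ + ϱ),
        (∀ t ∈ Icc (σ - ϱ ^ 2) T, |pdtW T v x t| ≤ m) ∧
        ∀ t ∈ Icc σ T, ∀ s ∈ Icc (t - ϱ ^ 2) t, |pdtW T v x t - pdtW T v x s| ≤ C * √(t - s) := by
  obtain ⟨ϱ₀, hϱ₀, h1, h2, h3⟩ : ∃ ϱ > 0, -x₀ + 2 * ϱ < -l ∧ x₀ + 2 * ϱ < r ∧ 8 * ϱ ^ 2 < σ := by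
    refine exists_pos_of_eventually ((eventually_lt_zero_of_continuous (by fun_prop) _ ?_).and
      ((eventually_lt_zero_of_continuous (by fun_prop) _ ?_).and
      (eventually_lt_zero_of_continuous (by fun_prop) _ ?_))) <;> simp [hx₀.1, hx₀.2, hσ]
  have hH := one_le_holderConst hlam hlL hF hLc
  set H := holderConst lam Lam F Lc with hHdef
  have hLam : 0 < Lam := hlam.trans_le hlL
  set C₁ := ((1 + Lam) * (6 + 2 / lam) + 6 * Lam + 1) * (M / ϱ₀ + F * ϱ₀) with hC₁
  have hC₁0 : 0 ≤ C₁ := by positivity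
  set θ := 1 / (8 * H) with hθdef
  have hθ : 0 < θ := by positivity
  have hθC : 8 * H * θ ≤ 1 := by rw [hθdef]; field_simp; rfl
  obtain ⟨ρ, hρ, h4, h5, h6, h7⟩ : ∃ ρ > 0, ρ < ϱ₀ ∧ ρ < 1 ∧ ρ ^ 2 < σ ∧ C₁ * ρ < θ ^ 2 / 10 := by
    refine exists_pos_of_eventually ((eventually_lt_zero_of_continuous (by fun_prop) _ ?_).and
      ((eventually_lt_zero_of_continuous (by fun_prop) _ ?_).and
      ((eventually_lt_zero_of_continuous (by fun_prop) _ ?_).and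
      (eventually_lt_zero_of_continuous (by fun_prop) _ ?_)))) <;> simp [hϱ₀, hσ]
    positivity
  have hm : 0 < 4 / ρ ^ 2 := by positivity
  obtain ⟨ϱ, hϱ, h8, h9, h10⟩ : ∃ ϱ > 0, 4 * ϱ < ρ ∧ 12 * ϱ ^ 2 < σ ∧
      (4 / ρ ^ 2 + 1) * ϱ ^ 2 < 1 := by
    refine exists_pos_of_eventually ((eventually_lt_zero_of_continuous (by fun_prop) _ ?_).and
      ((eventually_lt_zero_of_continuous (by fun_prop) _ ?_).and
      (eventually_lt_zero_of_continuous (by fun_prop) _ ?_))) <;> simp [hρ, hσ]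
  have hϱ2 : 0 < ϱ ^ 2 := by positivity
  have key : ∀ A R v, LocSol T l r lam Lam F Lc M A R v → ∀ x ∈ Icc (x₀ - 2 * ϱ) (x₀ + 2 * ϱ),
      ∀ t ∈ Icc (σ - 3 * ϱ ^ 2) T, |pdtW T v x t| ≤ 4 / ρ ^ 2 := by
    intro A R v hv x hx t ht
    have hosc : ∀ x ∈ Icc (x₀ - ρ) (x₀ + ρ), ∀ t ∈ Icc (σ / 2) T, ∀ s ∈ Icc (σ / 2) t,
        t - s ≤ ρ ^ 2 → |v x t - v x s| < θ ^ 2 / 10 := by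
      intro x hx t ht s hs hts
      have := (hv.parabolicOn (l' := x - ϱ₀) (r' := x + ϱ₀) (s := t - 2 * ϱ₀ ^ 2) (t := t)
        (by linarith [hx.1]) (by linarith [hx.2]) (by linarith [ht.1]) ht.2).abs_sub_le_time
        hϱ₀ hlam hlL hF hM (s := s) ⟨by nlinarith, hs.2⟩
      refine this.trans_lt (lt_of_le_of_lt ?_ h7)
      exact mul_le_mul_of_nonneg_left (Real.sqrt_le_iff.2 ⟨hρ.le, hts⟩) hC₁0
    have := hv.sq_mul_abs_pdtW_le hlam hlL hF hLc h5.le (x₀ := x₀) (s₀ := σ / 2) (t₂ := T)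
      (by linarith) (by linarith) (by linarith) le_rfl hθ hθC hosc x
      ⟨by linarith [hx.1], by linarith [hx.2]⟩ t ⟨by linarith [ht.1], ht.2⟩
    have hmin : ρ / 2 ≤ min (ρ - |x - x₀|) √(t - σ / 2) := by
      refine le_min ?_ (Real.le_sqrt_of_sq_le ?_)
      · have : |x - x₀| ≤ 2 * ϱ := abs_le.2 ⟨by linarith [hx.1], by linarith [hx.2]⟩
        linarith
      · nlinarith [ht.1]
    have h11 : (ρ / 2) ^ 2 ≤ min (ρ - |x - x₀|) √(t - σ / 2) ^ 2 := by gcongr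
    have h12 := (mul_le_mul_of_nonneg_right h11 (abs_nonneg (pdtW T v x t))).trans this
    rw [le_div_iff₀ (by positivity)]
    linarith
  refine ⟨ϱ, hϱ, 4 / ρ ^ 2, hm, H * (4 / ρ ^ 2 / ϱ), by positivity,
    Icc_subset_Ioo (by linarith) (by linarith), by linarith, fun A R v hv x hx => ⟨fun t ht => ?_,
    fun t ht s hs => ?_⟩⟩
  · exact key A R v hv x ⟨by linarith [hx.1], by linarith [hx.2]⟩ t ⟨by linarith [ht.1], ht.2⟩
  · exact hv.abs_pdtW_sub_le hlam hlL hF hLc hϱ hm (by linarith [hx.1]) (by linarith [hx.2])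
      (by linarith [ht.1]) ht.2 (fun y hy τ hτ => key A R v hv y
        ⟨by linarith [hx.1, hy.1], by linarith [hx.2, hy.2]⟩ τ
        ⟨by linarith [hτ.1, ht.1], hτ.2.trans ht.2⟩) h10.le hs

theorem abs_le_of_hasDerivAt {g f : ℝ → ℝ} {t h δ ω : ℝ} (hh : 0 < h)
    (hg : ContinuousOn g (Icc (t - h) t)) (hd : ∀ s ∈ Ioo (t - h) t, HasDerivAt g (f s) s)
    (hδ : |g t - g (t - h)| ≤ δ) (hω : ∀ s ∈ Ioo (t - h) t, |f t - f s| ≤ ω) :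
    |f t| ≤ δ / h + ω := by
  obtain ⟨s, hs, he⟩ := exists_hasDerivAt_eq_slope g f (by linarith : t - h < t) hg hd
  have h1 : |f s| ≤ δ / h := by
    rw [he, sub_sub_cancel, abs_div, abs_of_pos hh]
    gcongr
  calc |f t| = |f s + (f t - f s)| := by ring_nf
    _ ≤ |f s| + |f t - f s| := abs_add_le _ _
    _ ≤ _ := add_le_add h1 (hω s hs)

theorem abs_le_of_integral {f : ℝ → ℝ} {t h δ ω : ℝ} (hh : 0 < h) (hht : h ≤ t)
    (hf : ContinuousOn f (Icc 0 t)) (h1 : |∫ s in (0:ℝ)..t, f s| ≤ δ)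
    (h2 : |∫ s in (0:ℝ)..(t - h), f s| ≤ δ) (hω : ∀ s ∈ Icc (t - h) t, |f t - f s| ≤ ω) :
    |f t| ≤ 2 * δ / h + ω := by
  have hi : ∀ p ∈ Icc 0 t, ∀ q ∈ Icc 0 t, IntervalIntegrable f volume p q := fun p hp q hq =>
    (hf.mono (uIcc_subset_Icc hp hq)).intervalIntegrable
  have m0 : (0:ℝ) ∈ Icc 0 t := ⟨le_rfl, hh.le.trans hht⟩
  have m1 : t - h ∈ Icc 0 t := ⟨by linarith, by linarith⟩
  have m2 : t ∈ Icc 0 t := ⟨hh.le.trans hht, le_rfl⟩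
  have e1 := intervalIntegral.integral_interval_sub_left (hi 0 m0 t m2) (hi 0 m0 _ m1)
  have e2 : ∫ s in (t - h)..t, (f t - f s) = h * f t - ∫ s in (t - h)..t, f s := by
    rw [intervalIntegral.integral_sub intervalIntegrable_const (hi _ m1 _ m2)]
    simp
  have e3 : |∫ s in (t - h)..t, (f t - f s)| ≤ ω * h := by
    have := intervalIntegral.norm_integral_le_of_norm_le_const (a := t - h) (b := t) (C := ω)
      (f := fun s => f t - f s) fun s hs => by
        rw [uIoc_of_le (by linarith)] at hs
        exact hω s (Ioc_subset_Icc_self hs)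
    rwa [sub_sub_cancel, abs_of_pos hh] at this
  have e4 : |h * f t| ≤ 2 * δ + ω * h := by
    have : h * f t = (∫ s in (t - h)..t, (f t - f s)) +
        ((∫ s in (0:ℝ)..t, f s) - ∫ s in (0:ℝ)..(t - h), f s) := by rw [e1, e2]; ring
    rw [this]
    refine (abs_add_le _ _).trans ?_
    linarith [abs_sub (∫ s in (0:ℝ)..t, f s) (∫ s in (0:ℝ)..(t - h), f s)]
  rw [abs_mul, abs_of_pos hh] at e4
  rw [div_add' _ _ _ hh.ne', le_div_iff₀ hh]
  linarith

namespace ConvData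

variable {a b T M : ℝ} {N₀ : Set ℝ} {u₀ : ℝ → ℝ} {A R : ℝ → ℝ → ℝ} {v : ℝ → ℝ → ℝ → ℝ}
  {u : ℝ → ℝ → ℝ}

theorem exists_locSol (h : ConvData a b T M N₀ u₀ A R v u) {x₀ : ℝ} (hx₀ : x₀ ∈ Ioo a b \ N₀) :
    ∃ l r c, x₀ ∈ Ioo l r ∧ Icc l r ⊆ Ioo a b \ N₀ ∧ 0 < c ∧ ∀ᶠ ε in 𝓝[>] (0:ℝ),
      LocSol T l r c (1 + M + c) ((1 + M) * (1 + M)) (1 + 3 * M) M (A ε) (R ε) (v ε) := by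
  obtain ⟨ρ, hρ, hsub⟩ := Metric.nhds_basis_closedBall.mem_iff.1 (h.isOpen_diff.mem_nhds hx₀)
  rw [Real.closedBall_eq_Icc] at hsub
  obtain ⟨c, hc, hev⟩ := h.exists_sign_lower isCompact_Icc hsub
  have hM := h.one_le
  refine ⟨x₀ - ρ, x₀ + ρ, c / 2, ⟨by linarith, by linarith⟩, hsub, by positivity, ?_⟩
  filter_upwards [hev, h.ev, h.c21v, h.eqv, self_mem_nhdsWithin,
    (tendsto_coefErr M).eventually_lt_const (half_pos hc),
    (tendsto_nhdsWithin_of_tendsto_nhds tendsto_id).eventually_lt_const (one_pos)]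
    with ε h1 h2 h3 h4 h5 h6 h7
  have hsub' : Ioo (x₀ - ρ) (x₀ + ρ) ⊆ Ioo a b \ N₀ := Ioo_subset_Icc_self.trans hsub
  have hbd : ∀ x ∈ Ioo (x₀ - ρ) (x₀ + ρ), ∀ t ∈ Ioc 0 T, |v ε x t| ≤ M := fun x hx t ht =>
    h2.bdd x (Ioo_subset_Icc_self (hsub' hx).1) t (Ioc_subset_Icc_self ht)
  have hA : ∀ x ∈ Ioo (x₀ - ρ) (x₀ + ρ), ∀ t ∈ Ioc 0 T, A ε (v ε x t) ≤ 1 + M :=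
    fun x hx t ht => by linarith [h2.coef.le (v ε x t), hbd x hx t ht, show ε < 1 from h7]
  exact
  { c21 := h3.mono fun x hx => (hsub' hx).1
    cont := h2.sol.cont.mono (prod_mono (fun x hx => Ioo_subset_Icc_self (hsub' hx).1)
      Ioc_subset_Icc_self)
    eq := fun x hx t ht => h4 x (hsub' hx).1 t ht
    le_A := fun x hx t ht => by
      obtain ⟨S, hS, hlow⟩ := h1 x (Ioo_subset_Icc_self hx)
      have e1 := (hlow t (Ioc_subset_Icc_self ht)).1
      have e2 := (abs_le.1 (h2.coef.abs_A_sub_le h5 hM (hbd x hx t ht))).1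
      rw [abs_eq_sign_mul hS (hc.trans_le e1)] at e2
      linarith
    A_le := fun x hx t ht => by linarith [hA x hx t ht]
    abs_R_le := fun x hx t ht => by
      refine (h2.coef.absR _).trans ?_
      have := hA x hx t ht
      have := hbd x hx t ht
      gcongr
    lipA := h2.coef.lipA
    lipR := fun x hx t ht s hs => by
      refine (h2.coef.lipR _ _).trans ?_
      have := hbd x hx t ht
      have := hbd x hx s hs
      exact mul_le_mul_of_nonneg_right (by linarith) (abs_nonneg _)
    bdd := hbd }

/-- Bounds for all derivatives in a space neighbourhood of `x₀`, uniformly in the parameter. -/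
theorem exists_bounds (h : ConvData a b T M N₀ u₀ A R v u) {x₀ : ℝ} (hx₀ : x₀ ∈ Ioo a b \ N₀)
    {σ : ℝ} (hσ : 0 < σ) :
    ∃ ϱ > 0, ∃ m > 0, ∃ C ≥ 0, ∃ c > 0, Icc (x₀ - ϱ) (x₀ + ϱ) ⊆ Ioo a b \ N₀ ∧ ϱ ^ 2 < σ ∧
      (∀ x ∈ Icc (x₀ - ϱ) (x₀ + ϱ), ∀ t ∈ Icc (σ - ϱ ^ 2) T,
        |pdtW T u x t| ≤ m ∧ |pdxx u x t| ≤ m) ∧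
      ∀ᶠ ε in 𝓝[>] (0:ℝ), ∀ x ∈ Icc (x₀ - ϱ) (x₀ + ϱ),
        (∀ t ∈ Icc (σ - ϱ ^ 2) T, |pdtW T (v ε) x t| ≤ m ∧ |pdxx (v ε) x t| ≤ m ∧
          c ≤ A ε (v ε x t)) ∧
        ∀ t ∈ Icc σ T, ∀ s ∈ Icc (t - ϱ ^ 2) t,
          |pdtW T (v ε) x t - pdtW T (v ε) x s| ≤ C * √(t - s) := by
  obtain ⟨l, r, c, hlr, hsub, hc, hev⟩ := h.exists_locSol hx₀
  have hM := h.one_le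
  obtain ⟨ϱ, hϱ, m, hm, C, hC, hI, hϱσ, H⟩ := LocSol.exists_uniform_bounds (T := T) hc
    (by linarith : c ≤ 1 + M + c) (F := (1 + M) * (1 + M)) (by positivity)
    (Lc := 1 + 3 * M) (by positivity) (M := M) (by linarith) hlr hσ
  have hI' : Icc (x₀ - ϱ) (x₀ + ϱ) ⊆ Ioo a b \ N₀ := hI.trans (Ioo_subset_Icc_self.trans hsub)
  have hcomp : IsCompact (Icc (x₀ - ϱ) (x₀ + ϱ) ×ˢ Icc (σ - ϱ ^ 2) T) :=
    isCompact_Icc.prod isCompact_Icc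
  have hbox : Icc (x₀ - ϱ) (x₀ + ϱ) ×ˢ Icc (σ - ϱ ^ 2) T ⊆ (Ioo a b \ N₀) ×ˢ Ioc 0 T :=
    prod_mono hI' fun t ht => ⟨by linarith [ht.1], ht.2⟩
  obtain ⟨B₁, hB₁⟩ := hcomp.exists_bound_of_continuousOn (h.c21u.cont_t.mono hbox)
  obtain ⟨B₂, hB₂⟩ := hcomp.exists_bound_of_continuousOn (h.c21u.cont_xx.mono hbox)
  set m' := max (max m ((m + (1 + M) * (1 + M)) / c)) (max B₁ B₂) with hm'
  have i1 : m ≤ m' := (le_max_left _ _).trans (le_max_left _ _)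
  have i2 : (m + (1 + M) * (1 + M)) / c ≤ m' := (le_max_right _ _).trans (le_max_left _ _)
  have i3 : B₁ ≤ m' := (le_max_left _ _).trans (le_max_right _ _)
  have i4 : B₂ ≤ m' := (le_max_right _ _).trans (le_max_right _ _)
  refine ⟨ϱ, hϱ, m', hm.trans_le i1, C, hC, c, hc, hI', hϱσ, fun x hx t ht =>
    ⟨(hB₁ (x, t) ⟨hx, ht⟩).trans i3, (hB₂ (x, t) ⟨hx, ht⟩).trans i4⟩,
    hev.mono fun ε hv x hx => ?_⟩
  obtain ⟨H1, H2⟩ := H _ _ _ hv x hx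
  refine ⟨fun t ht => ?_, H2⟩
  have ht' : t ∈ Ioc 0 T := ⟨by linarith [ht.1], ht.2⟩
  exact ⟨(H1 t ht).trans i1, (hv.abs_pdxx_le hc (hI hx) ht' (H1 t ht)).trans i2,
    hv.le_A x (hI hx) t ht'⟩

theorem eventually_abs_sub_lt_near (h : ConvData a b T M N₀ u₀ A R v u) {x₀ : ℝ}
    (hx₀ : x₀ ∈ Ioo a b \ N₀) {σ η : ℝ} (hσ : 0 < σ) (hη : 0 < η) :
    ∃ ϱ > 0, ∀ᶠ ε in 𝓝[>] (0:ℝ), ∀ x ∈ Icc (x₀ - ϱ) (x₀ + ϱ), ∀ t ∈ Icc σ T,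
      |v ε x t - u x t| < η := by
  obtain ⟨ϱ, hϱ, m, hm, C, hC, c, hc, hI, hϱσ, hu, hev⟩ := h.exists_bounds hx₀ hσ
  obtain ⟨k, hk, hk1, hk2⟩ : ∃ k > 0, k < ϱ ^ 2 ∧ 2 * m * k < η / 2 := by
    refine exists_pos_of_eventually ((eventually_lt_zero_of_continuous (by fun_prop) _ ?_).and
      (eventually_lt_zero_of_continuous (by fun_prop) _ ?_))
    · exact pow_pos hϱ 2
    · simp [hη]
  refine ⟨ϱ, hϱ, ?_⟩
  filter_upwards [hev, h.ev, h.c21v, h.eventually_abs_integral_le (δ := η * k / 8) (by positivity)]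
    with ε h1 h2 h3 h4 x hx t ht
  have hxI := hI hx
  have hxc := Ioo_subset_Icc_self hxI.1
  have htc : t ∈ Icc 0 T := ⟨by linarith [ht.1], ht.2⟩
  have key := abs_le_of_integral (f := fun s => v ε x s - u x s) (t := t) (h := k) (ω := 2 * m * k)
    hk (by linarith [ht.1]) ((h.continuousOn_sub_t h2 hxc).mono (Icc_subset_Icc_right ht.2))
    (h4 x hxc t htc) (h4 x hxc (t - k) ⟨by linarith [ht.1], by linarith [ht.2]⟩) (by
      intro s hs
      have hs0 : 0 < s := by linarith [hs.1, ht.1]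
      have b1 := h3.abs_sub_le hxI.1 hs0 hs.2 ht.2 fun τ hτ =>
        ((h1 x hx).1 τ ⟨by linarith [hτ.1, hs.1, ht.1], hτ.2.trans ht.2⟩).1
      have b2 := h.c21u.abs_sub_le hxI hs0 hs.2 ht.2 fun τ hτ =>
        (hu x hx τ ⟨by linarith [hτ.1, hs.1, ht.1], hτ.2.trans ht.2⟩).1
      have b3 : m * (t - s) ≤ m * k := by gcongr; linarith [hs.1]
      calc _ = |(v ε x t - v ε x s) - (u x t - u x s)| := by ring_nf
        _ ≤ _ := abs_sub _ _
        _ ≤ _ := by linarith)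
  have : 2 * (η * k / 8) / k = η / 4 := by field_simp; norm_num
  rw [this] at key
  refine key.trans_lt ?_
  linarith

theorem eventually_abs_sub_lt (h : ConvData a b T M N₀ u₀ A R v u) {δ : ℝ} (hδ : 0 < δ) :
    ∀ᶠ ε in 𝓝[>] (0:ℝ), ∀ x ∈ Icc a b, ∀ t ∈ Icc 0 T, |v ε x t - u x t| < δ := by
  obtain ⟨η, hη, i1⟩ := h.eventually_lt_initial hδ
  obtain ⟨η', hη', i2⟩ := h.neg.eventually_lt_initial hδ
  obtain ⟨K, hK, hKs, k1⟩ := h.exists_compact_lt hδ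
  obtain ⟨K', hK', hKs', k2⟩ := h.neg.exists_compact_lt hδ
  have hσ : 0 < min η η' := lt_min hη hη'
  have hloc : ∀ᶠ ε in 𝓝[>] (0:ℝ), ∀ x ∈ K ∪ K', ∀ t ∈ Icc (min η η') T,
      |v ε x t - u x t| < δ := by
    refine (hK.union hK').induction_on
      (p := fun S => ∀ᶠ ε in 𝓝[>] (0:ℝ), ∀ x ∈ S, ∀ t ∈ Icc (min η η') T, |v ε x t - u x t| < δ)
      (by simp) (fun S S' hS h1 => h1.mono fun ε h2 x hx => h2 x (hS hx)) ?_ fun x hx => ?_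
    · intro S S' h1 h2
      filter_upwards [h1, h2] with ε h3 h4 x hx
      exact hx.elim (h3 x) (h4 x)
    · obtain ⟨ϱ, hϱ, h1⟩ := h.eventually_abs_sub_lt_near (union_subset hKs hKs' hx) hσ hδ
      exact ⟨_, mem_nhdsWithin_of_mem_nhds (Icc_mem_nhds (by linarith) (by linarith)), h1⟩
  filter_upwards [i1, i2, k1, k2, hloc] with ε i1 i2 k1 k2 hloc x hx t ht
  by_cases hc : x ∈ K ∪ K' ∧ min η η' ≤ t
  · exact hloc x hc.1 t ⟨hc.2, ht.2⟩
  rw [not_and_or, not_le] at hc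
  rw [abs_lt]
  rcases hc with hc | hc
  · have e1 := k1 x hx (fun h => hc (Or.inl h)) t ht
    have e2 := k2 x hx (fun h => hc (Or.inr h)) t ht
    constructor <;> linarith
  · have e1 := i1 x hx t ht (hc.le.trans (min_le_left _ _))
    have e2 := i2 x hx t ht (hc.le.trans (min_le_right _ _))
    constructor <;> linarith

end ConvData

namespace ConvData

variable {a b T M : ℝ} {N₀ : Set ℝ} {u₀ : ℝ → ℝ} {A R : ℝ → ℝ → ℝ} {v : ℝ → ℝ → ℝ → ℝ}
  {u : ℝ → ℝ → ℝ} {x₀ σ η : ℝ}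

theorem eventually_abs_pdtW_sub_lt (h : ConvData a b T M N₀ u₀ A R v u)
    (hx₀ : x₀ ∈ Ioo a b \ N₀) (hσ : 0 < σ) (hη : 0 < η) :
    ∃ ϱ > 0, ∀ᶠ ε in 𝓝[>] (0:ℝ), ∀ x ∈ Icc (x₀ - ϱ) (x₀ + ϱ), ∀ t ∈ Icc σ T,
      |pdtW T (v ε) x t - pdtW T u x t| < η := by
  obtain ⟨ϱ, hϱ, m, hm, C, hC, c, hc, hI, hϱσ, hu, hev⟩ := h.exists_bounds hx₀ hσ
  have hbox : Icc (x₀ - ϱ) (x₀ + ϱ) ×ˢ Icc (σ - ϱ ^ 2) T ⊆ (Ioo a b \ N₀) ×ˢ Ioc 0 T :=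
    prod_mono hI fun t ht => ⟨by linarith [ht.1], ht.2⟩
  obtain ⟨r, hr, hunif⟩ := Metric.uniformContinuousOn_iff.1
    ((isCompact_Icc.prod isCompact_Icc).uniformContinuousOn_of_continuous
      (h.c21u.cont_t.mono hbox)) (η / 4) (by positivity)
  obtain ⟨k, hk, hk1, hk2, hk3⟩ : ∃ k > 0, k < ϱ ^ 2 ∧ k < r ∧ C * √k < η / 4 := by
    refine exists_pos_of_eventually ((eventually_lt_zero_of_continuous (by fun_prop) _ ?_).and
      ((eventually_lt_zero_of_continuous (by fun_prop) _ ?_).and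
      (eventually_lt_zero_of_continuous (by fun_prop) _ ?_)))
    · exact pow_pos hϱ 2
    · exact hr
    · simp [hη]
  refine ⟨ϱ, hϱ, ?_⟩
  filter_upwards [hev, h.c21v, h.eventually_abs_sub_lt (δ := η * k / 16) (by positivity)]
    with ε h1 h3 h4 x hx t ht
  have hxI := hI hx
  have hxc := Ioo_subset_Icc_self hxI.1
  have key := abs_le_of_hasDerivAt (g := fun s => v ε x s - u x s)
    (f := fun s => pdtW T (v ε) x s - pdtW T u x s) (t := t) (h := k) (δ := η * k / 8)
    (ω := η / 2) hk
    (((h3.continuousOn_t hxI.1).sub (h.c21u.continuousOn_t hxI)).mono fun s hs =>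
      ⟨by linarith [hs.1, ht.1], hs.2.trans ht.2⟩)
    (fun s hs => (h3.hasDerivAt_t hxI.1 ⟨by linarith [hs.1, ht.1], hs.2.trans_le ht.2⟩).sub
      (h.c21u.hasDerivAt_t hxI ⟨by linarith [hs.1, ht.1], hs.2.trans_le ht.2⟩))
    (by
      have b1 := h4 x hxc t ⟨by linarith [ht.1], ht.2⟩
      have b2 := h4 x hxc (t - k) ⟨by linarith [ht.1], by linarith [ht.2]⟩
      refine (abs_sub _ _).trans ?_
      linarith)
    (by
      intro s hs
      have b1 := (h1 x hx).2 t ht s ⟨by linarith [hs.1], hs.2.le⟩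
      have b2 : C * √(t - s) ≤ C * √k := by gcongr; linarith [hs.1]
      have b3 := hunif (x, t) ⟨hx, by linarith [ht.1, pow_pos hϱ 2], ht.2⟩ (x, s)
        ⟨hx, by linarith [hs.1, ht.1], hs.2.le.trans ht.2⟩ (by
          rw [Prod.dist_eq, Real.dist_eq, Real.dist_eq]
          refine max_lt (by simpa using hr) ?_
          rw [abs_of_pos (by linarith [hs.2])]
          linarith [hs.1])
      rw [Real.dist_eq] at b3
      calc _ = |(pdtW T (v ε) x t - pdtW T (v ε) x s) - (pdtW T u x t - pdtW T u x s)| := by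
            ring_nf
        _ ≤ _ := abs_sub _ _
        _ ≤ _ := by linarith)
  have : η * k / 8 / k = η / 8 := by field_simp
  rw [this] at key
  refine key.trans_lt ?_
  linarith

theorem eventually_abs_pdx_sub_lt (h : ConvData a b T M N₀ u₀ A R v u)
    (hx₀ : x₀ ∈ Ioo a b \ N₀) (hσ : 0 < σ) (hη : 0 < η) :
    ∃ ϱ > 0, ∀ᶠ ε in 𝓝[>] (0:ℝ), ∀ x ∈ Icc (x₀ - ϱ) (x₀ + ϱ), ∀ t ∈ Icc σ T,
      |pdx (v ε) x t - pdx u x t| < η := by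
  obtain ⟨ϱ, hϱ, m, hm, C, hC, c, hc, hI, hϱσ, hu, hev⟩ := h.exists_bounds hx₀ hσ
  obtain ⟨k, hk, hk1, hk2⟩ : ∃ k > 0, k < ϱ / 2 ∧ 2 * m * k < η / 2 := by
    refine exists_pos_of_eventually ((eventually_lt_zero_of_continuous (by fun_prop) _ ?_).and
      (eventually_lt_zero_of_continuous (by fun_prop) _ ?_)) <;> simp [hη, hϱ]
  refine ⟨ϱ / 2, half_pos hϱ, ?_⟩
  filter_upwards [hev, h.c21v, h.eventually_abs_sub_lt (δ := η * k / 16) (by positivity)]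
    with ε h1 h3 h4 x hx t ht
  have hIk : Icc (x - k) x ⊆ Icc (x₀ - ϱ) (x₀ + ϱ) :=
    Icc_subset_Icc (by linarith [hx.1]) (by linarith [hx.2])
  have ht' : t ∈ Ioc 0 T := ⟨hσ.trans_le ht.1, ht.2⟩
  have ht'' : t ∈ Icc (σ - ϱ ^ 2) T := ⟨by linarith [ht.1, pow_pos hϱ 2], ht.2⟩
  have htc := Ioc_subset_Icc_self ht'
  have hd : ∀ y ∈ Icc (x - k) x, HasDerivAt (fun y => v ε y t - u y t)
      (pdx (v ε) y t - pdx u y t) y := fun y hy =>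
    (h3.hasDerivAt_x (hI (hIk hy)).1 ht').sub (h.c21u.hasDerivAt_x (hI (hIk hy)) ht')
  have hdd : ∀ y ∈ Icc (x - k) x, HasDerivAt (fun y => pdx (v ε) y t - pdx u y t)
      (pdxx (v ε) y t - pdxx u y t) y := fun y hy =>
    (h3.hasDerivAt_xx (hI (hIk hy)).1 ht').sub (h.c21u.hasDerivAt_xx (hI (hIk hy)) ht')
  have hxk : x ∈ Icc (x - k) x := ⟨by linarith, le_rfl⟩
  have hxk' : x - k ∈ Icc (x - k) x := ⟨le_rfl, by linarith⟩
  have key := abs_le_of_hasDerivAt (g := fun y => v ε y t - u y t)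
    (f := fun y => pdx (v ε) y t - pdx u y t) (t := x) (h := k) (δ := η * k / 8)
    (ω := 2 * m * k) hk (fun y hy => (hd y hy).continuousAt.continuousWithinAt)
    (fun y hy => hd y (Ioo_subset_Icc_self hy))
    (by
      have b1 := h4 x (Ioo_subset_Icc_self (hI (hIk hxk)).1) t htc
      have b2 := h4 (x - k) (Ioo_subset_Icc_self (hI (hIk hxk')).1) t htc
      refine (abs_sub _ _).trans ?_
      linarith)
    (by
      intro y hy
      have b1 := (convex_Icc (x - k) x).norm_image_sub_le_of_norm_hasDerivWithin_le (C := 2 * m)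
        (fun y hy => (hdd y hy).hasDerivWithinAt) (fun y hy => by
          have c1 := ((h1 y (hIk hy)).1 t ht'').2.1
          have c2 := (hu y (hIk hy) t ht'').2
          exact (abs_sub _ _).trans (by linarith)) (Ioo_subset_Icc_self hy) hxk
      refine b1.trans ?_
      rw [Real.norm_eq_abs, abs_of_pos (by linarith [hy.2])]
      gcongr
      linarith [hy.1])
  have : η * k / 8 / k = η / 8 := by field_simp
  rw [this] at key
  refine key.trans_lt ?_
  linarith

theorem eventually_abs_pdxx_sub_lt (h : ConvData a b T M N₀ u₀ A R v u)
    (hx₀ : x₀ ∈ Ioo a b \ N₀) (hσ : 0 < σ) (hη : 0 < η) :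
    ∃ ϱ > 0, ∀ᶠ ε in 𝓝[>] (0:ℝ), ∀ x ∈ Icc (x₀ - ϱ) (x₀ + ϱ), ∀ t ∈ Icc σ T,
      |pdxx (v ε) x t - pdxx u x t| < η := by
  obtain ⟨ϱ, hϱ, m, hm, C, hC, c, hc, hI, hϱσ, hu, hev⟩ := h.exists_bounds hx₀ hσ
  have hM := h.one_le
  obtain ⟨ϱ', hϱ', hev'⟩ := h.eventually_abs_pdtW_sub_lt hx₀ hσ (η := c * η / 4) (by positivity)
  set δ := c * η / (4 * (1 + 2 * M + m)) with hδdef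
  have hδ : 0 < δ := by positivity
  have hδe : δ * (1 + 2 * M + m) = c * η / 4 := by rw [hδdef]; field_simp
  have hκ : 0 < c * η / (4 * (1 + m)) := by positivity
  refine ⟨min ϱ ϱ', lt_min hϱ hϱ', ?_⟩
  filter_upwards [hev, hev', h.ev, h.eqv, self_mem_nhdsWithin, h.eventually_abs_sub_lt hδ,
    (tendsto_coefErr M).eventually_lt_const hκ] with ε h1 h2 h3 h4 h5 h6 h7 x hx t ht
  have hx1 : x ∈ Icc (x₀ - ϱ) (x₀ + ϱ) :=
    ⟨by linarith [hx.1, min_le_left ϱ ϱ'], by linarith [hx.2, min_le_left ϱ ϱ']⟩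
  have hx2 : x ∈ Icc (x₀ - ϱ') (x₀ + ϱ') :=
    ⟨by linarith [hx.1, min_le_right ϱ ϱ'], by linarith [hx.2, min_le_right ϱ ϱ']⟩
  have ht' : t ∈ Ioc 0 T := ⟨hσ.trans_le ht.1, ht.2⟩
  have ht'' : t ∈ Icc (σ - ϱ ^ 2) T := ⟨by linarith [ht.1, pow_pos hϱ 2], ht.2⟩
  have htc := Ioc_subset_Icc_self ht'
  have hxc := Ioo_subset_Icc_self (hI hx1).1
  have hcA := ((h1 x hx1).1 t ht'').2.2
  have huxx := (hu x hx1 t ht'').2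
  have e1 := h4 x (hI hx1).1 t ht'
  have e2 := h.equ x (hI hx1) t ht'
  have g1 := h2 x hx2 t ht
  have hv := h3.bdd x hxc t htc
  have hub := h.ubdd x hxc t htc
  have g2 := h3.coef.abs_A_sub_le h5 hM hv
  have g3 := h3.coef.abs_R_sub_le h5 hM hv
  have g4 := h6 x hxc t htc
  generalize v ε x t = y at *
  generalize u x t = z at *
  generalize pdxx (v ε) x t = p at *
  generalize pdxx u x t = q at *
  have hsub : |(|y|) - (|z|)| ≤ |y - z| := abs_abs_sub_abs_le_abs_sub y z
  have g5 : |A ε y - (|z|)| ≤ coefErr M ε + δ :=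
    (abs_sub_le _ (|y|) _).trans (add_le_add g2 (hsub.trans g4.le))
  have g6 : |y * (1 - |y|) - z * (1 - |z|)| ≤ (1 + 2 * M) * δ := by
    have : y * (1 - |y|) - z * (1 - |z|) = (y - z) * (1 - |y|) - z * (|y| - |z|) := by ring
    rw [this]
    refine (abs_sub _ _).trans ?_
    rw [abs_mul, abs_mul]
    have c1 : |1 - (|y|)| ≤ 1 + M := abs_le.2 ⟨by linarith, by linarith [abs_nonneg y]⟩
    have c2 : |y - z| * |1 - (|y|)| ≤ δ * (1 + M) := by gcongr
    have c3 : |z| * |(|y|) - (|z|)| ≤ M * δ := by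
      have := hsub.trans g4.le
      gcongr
    linarith
  have g7 := (abs_sub_le (R ε y) (y * (1 - |y|)) (z * (1 - |z|))).trans (add_le_add g3 g6)
  have e3 : A ε y * (p - q) = (pdtW T (v ε) x t - pdtW T u x t) - (R ε y - z * (1 - |z|))
      - (A ε y - |z|) * q := by rw [e1, e2]; ring
  have g8 : |(A ε y - (|z|)) * q| ≤ (coefErr M ε + δ) * m := by
    rw [abs_mul]
    exact mul_le_mul g5 huxx (abs_nonneg _) ((abs_nonneg _).trans g5)
  have g9 : |A ε y * (p - q)| < c * η := by
    rw [e3]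
    have t1 := abs_sub ((pdtW T (v ε) x t - pdtW T u x t) - (R ε y - z * (1 - |z|)))
      ((A ε y - |z|) * q)
    have t2 := abs_sub (pdtW T (v ε) x t - pdtW T u x t) (R ε y - z * (1 - |z|))
    have t3 : coefErr M ε * (1 + m) < c * η / 4 := by
      rw [lt_div_iff₀ (by positivity)] at h7
      linarith
    have t4 : 0 < c * η := by positivity
    linarith
  rw [abs_mul, abs_of_pos (hc.trans_le hcA)] at g9
  exact lt_of_mul_lt_mul_left ((mul_le_mul_of_nonneg_right hcA (abs_nonneg _)).trans_lt g9) hc.le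

/-- Convergence near every point gives uniform convergence on compact subsets. -/
theorem tendstoUniformlyOn_of_near {T : ℝ} {D : Set ℝ} {F : ℝ → ℝ → ℝ → ℝ} {f : ℝ → ℝ → ℝ}
    (h : ∀ x ∈ D, ∀ σ > 0, ∀ η > 0, ∃ ϱ > 0, ∀ᶠ ε in 𝓝[>] (0:ℝ),
      ∀ y ∈ Icc (x - ϱ) (x + ϱ), ∀ t ∈ Icc σ T, |F ε y t - f y t| < η)
    {K : Set (ℝ × ℝ)} (hK : IsCompact K) (hKD : K ⊆ D ×ˢ Ioc 0 T) :
    TendstoUniformlyOn (fun ε p => F ε p.1 p.2) (fun p => f p.1 p.2) (𝓝[>] (0:ℝ)) K := by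
  rw [← tendstoLocallyUniformlyOn_iff_tendstoUniformlyOn_of_compact hK,
    Metric.tendstoLocallyUniformlyOn_iff]
  intro η hη p hp
  obtain ⟨ϱ, hϱ, hev⟩ := h p.1 (hKD hp).1 (p.2 / 2) (half_pos (hKD hp).2.1) η hη
  refine ⟨K ∩ Icc (p.1 - ϱ) (p.1 + ϱ) ×ˢ Ici (p.2 / 2), inter_mem_nhdsWithin _ ?_,
    hev.mono fun ε h1 q hq => ?_⟩
  · have := (hKD hp).2.1
    exact prod_mem_nhds (Icc_mem_nhds (by linarith) (by linarith)) (Ici_mem_nhds (by linarith))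
  · rw [dist_comm, Real.dist_eq]
    exact h1 q.1 hq.2.1 q.2 ⟨hq.2.2, (hKD hq.1).2.2⟩

end ConvData

section Translation

variable {a b T ε u1 : ℝ} {N₀ : Set ℝ} {u₀ u₀ε : ℝ → ℝ} {Φ : ℝ → ℝ} {u v : ℝ → ℝ → ℝ}

theorem QT_diff_NSet : QT a b T \ NSet N₀ T = (Ioo a b \ N₀) ×ˢ Ioc 0 T := by
  ext p
  constructor
  · rintro ⟨⟨h1, h2⟩, h3⟩
    exact ⟨⟨h1, fun h => h3 ⟨h, Ioc_subset_Icc_self h2⟩⟩, h2⟩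
  · rintro ⟨⟨h1, h2⟩, h3⟩
    exact ⟨⟨h1, h3⟩, fun h => h2 h.1⟩

theorem IsClassicalSol.c21On (h : IsClassicalSol a b T N₀ u₀ u) : C21On T (Ioo a b \ N₀) u where
  diff_x x hx t ht := h.diff_x (x, t) (by rw [QT_diff_NSet]; exact ⟨hx, ht⟩)
  diff_xx x hx t ht := h.diff_xx (x, t) (by rw [QT_diff_NSet]; exact ⟨hx, ht⟩)
  diff_t x hx t ht := h.diff_t (x, t) (by rw [QT_diff_NSet]; exact ⟨hx, ht⟩)
  cont_x := QT_diff_NSet (a := a) ▸ h.cont_x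
  cont_xx := QT_diff_NSet (a := a) ▸ h.cont_xx
  cont_t := QT_diff_NSet (a := a) ▸ h.cont_t

theorem IsRegSol.c21On (h : IsRegSol a b T ε Φ u1 u₀ε v) : C21On T (Ioo a b) v where
  diff_x x hx t ht := h.diff_x (x, t) ⟨hx, ht⟩
  diff_xx x hx t ht := h.diff_xx (x, t) ⟨hx, ht⟩
  diff_t x hx t ht := h.diff_t (x, t) ⟨hx, ht⟩
  cont_x := h.cont_x
  cont_xx := h.cont_xx
  cont_t := h.cont_t

theorem IsRegSol.regSol (hab : a ≤ b) (ha : u₀ε a = -u1) (hb : u₀ε b = u1)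
    (h : IsRegSol a b T ε Φ u1 u₀ε v) :
    RegSol a b T (fun w => ε + Φ w ^ 2) (fun w => Φ w * (1 - Φ w ^ 2) * √(ε + Φ w ^ 2)) v where
  cont := h.cont
  reg x hx t ht := ⟨_, _, h.c21On.c21At isOpen_Ioo hx ht, h.pde (x, t) ⟨hx, ht⟩⟩
  left t ht := by
    rcases ht.1.eq_or_lt with rfl | h0
    · rfl
    · rw [h.bdry_a t ⟨h0, ht.2⟩, h.init a ⟨le_rfl, hab⟩, ha]
  right t ht := by
    rcases ht.1.eq_or_lt with rfl | h0
    · rfl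
    · rw [h.bdry_b t ⟨h0, ht.2⟩, h.init b ⟨hab, le_rfl⟩, hb]

/-- A function which is continuous on `[0,T]` and constant on `(0,T]` has that value at `0`. -/
theorem eq_at_zero_of_eqOn_Ioc {f : ℝ → ℝ} {c : ℝ} (hT : 0 < T) (hf : ContinuousOn f (Icc 0 T))
    (hc : ∀ t ∈ Ioc 0 T, f t = c) : f 0 = c := by
  have h1 : Tendsto f (𝓝[Ioc 0 T] 0) (𝓝 (f 0)) :=
    (hf 0 ⟨le_rfl, hT.le⟩).mono_left (nhdsWithin_mono _ Ioc_subset_Icc_self)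
  have h2 : Tendsto f (𝓝[Ioc 0 T] 0) (𝓝 c) :=
    tendsto_const_nhds.congr' (by filter_upwards [self_mem_nhdsWithin] with t ht using (hc t ht).symm)
  rw [nhdsWithin_Ioc_eq_nhdsGT hT] at h1 h2
  exact tendsto_nhds_unique h1 h2

theorem IsClassicalSol.apply_zero (hab : a ≤ b) (hT : 0 < T) (h₀ : InitData a b N₀ u₀)
    (h : IsClassicalSol a b T N₀ u₀ u) : ∀ x ∈ Icc a b, u x 0 = u₀ x := by
  have hc : ∀ x ∈ Icc a b, ContinuousOn (fun t => u x t) (Icc 0 T) := fun x hx =>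
    h.cont.comp (f := fun s : ℝ => (x, s)) (by fun_prop) fun s hs => ⟨hx, hs⟩
  intro x hx
  rcases hx.1.eq_or_lt with rfl | hax
  · rw [h₀.bdry_a]
    exact eq_at_zero_of_eqOn_Ioc hT (hc _ hx) h.bdry_a
  rcases hx.2.eq_or_lt with rfl | hxb
  · rw [h₀.bdry_b]
    exact eq_at_zero_of_eqOn_Ioc hT (hc _ hx) h.bdry_b
  exact h.init x ⟨hax, hxb⟩

theorem IsClassicalSol.apply_lateral (hab : a ≤ b) (hT : 0 < T) (h₀ : InitData a b N₀ u₀)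
    (h : IsClassicalSol a b T N₀ u₀ u) :
    ∀ x ∈ insert a (insert b N₀), ∀ t ∈ Icc 0 T, u x t = u₀ x := by
  intro x hx t ht
  rcases ht.1.eq_or_lt with rfl | h0
  · refine h.apply_zero hab hT h₀ x ?_
    rcases hx with rfl | rfl | hx
    · exact ⟨le_rfl, hab⟩
    · exact ⟨hab, le_rfl⟩
    · exact Ioo_subset_Icc_self (h₀.sub hx)
  rcases hx with rfl | rfl | hx
  · rw [h.bdry_a t ⟨h0, ht.2⟩, h₀.bdry_a]
  · rw [h.bdry_b t ⟨h0, ht.2⟩, h₀.bdry_b]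
  · have hxI := Ioo_subset_Icc_self (h₀.sub hx)
    rw [(h.zero_iff x hxI t ht).2 hx, (h₀.zeros x hxI).2 hx]

theorem convData_of_solutions (hab : a < b) (hT : 0 < T) (h₀ : InitData a b N₀ u₀)
    {Φ : ℝ → ℝ → ℝ} (hΦ : ∀ ε > 0, Function.RightInverse (Φ ε) (Ureg ε)) {u1 : ℝ → ℝ}
    {u0e : ℝ → ℝ → ℝ} (h0a : ∀ ε > 0, u0e ε a = -u1 ε) (h0b : ∀ ε > 0, u0e ε b = u1 ε)
    (h0conv : TendstoUniformlyOn (fun ε => u0e ε) u₀ (𝓝[>] (0:ℝ)) (Icc a b))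
    {ue : ℝ → ℝ → ℝ → ℝ} (hue : ∀ ε > 0, IsRegSol a b T ε (Φ ε) (u1 ε) (u0e ε) (ue ε))
    (hu : IsClassicalSol a b T N₀ u₀ u) :
    ∃ M, ConvData a b T M N₀ u₀ (fun ε w => ε + Φ ε w ^ 2)
      (fun ε w => Φ ε w * (1 - Φ ε w ^ 2) * √(ε + Φ ε w ^ 2)) ue u := by
  obtain ⟨B₁, hB₁⟩ := (isCompact_Icc.prod isCompact_Icc).exists_bound_of_continuousOn hu.cont
  obtain ⟨B₂, hB₂⟩ := isCompact_Icc.exists_bound_of_continuousOn h₀.cont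
  set M := max 2 (max B₁ (B₂ + 1)) with hMdef
  have m1 : 2 ≤ M := le_max_left _ _
  have m2 : B₁ ≤ M := (le_max_left _ _).trans (le_max_right _ _)
  have m3 : B₂ + 1 ≤ M := (le_max_right _ _).trans (le_max_right _ _)
  have hsq : ∀ᶠ ε in 𝓝[>] (0:ℝ), 1 + 2 * √ε < 2 :=
    (eventually_lt_zero_of_continuous (by fun_prop) _ (by simp)).filter_mono nhdsWithin_le_nhds
  refine ⟨M, ?_⟩
  exact
  { lt := hab
    pos := hT
    one_le := by linarith
    ev := by
      filter_upwards [self_mem_nhdsWithin, hsq, Metric.tendstoUniformlyOn_iff.1 h0conv 1 one_pos]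
        with ε hε h1 h2
      have hc := regCoef hε (hΦ ε hε)
      have hs := (hue ε hε).regSol hab.le (h0a ε hε) (h0b ε hε)
      have hb0 : ∀ x ∈ Icc a b, |ue ε x 0| < M := fun x hx => by
        have e1 := h2 x hx
        have e2 := hB₂ x hx
        rw [Real.dist_eq] at e1
        rw [Real.norm_eq_abs] at e2
        rw [(hue ε hε).init x hx]
        have e3 := abs_sub_abs_le_abs_sub (u0e ε x) (u₀ x)
        rw [abs_sub_comm] at e3
        linarith
      refine ⟨hc, hs, fun x hx t ht => abs_le.2 ⟨?_, ?_⟩⟩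
      · have := (hs.neg hc).lt_const hab.le hc (h1.trans_le m1)
          (fun x hx => (neg_le_abs _).trans_lt (hb0 x hx)) x hx t ht
        linarith
      · exact (hs.lt_const hab.le hc (h1.trans_le m1)
          (fun x hx => (le_abs_self _).trans_lt (hb0 x hx)) x hx t ht).le
    cont := h₀.cont
    fin := h₀.fin
    sub := h₀.sub
    zero := fun x hx => (h₀.zeros x (Ioo_subset_Icc_self (h₀.sub hx))).2 hx
    sign_change := h₀.sign_change
    conv := h0conv.congr (by
      filter_upwards [self_mem_nhdsWithin] with ε hε x hx using ((hue ε hε).init x hx).symm)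
    c21v := by filter_upwards [self_mem_nhdsWithin] with ε hε using (hue ε hε).c21On
    eqv := by
      filter_upwards [self_mem_nhdsWithin] with ε hε x hx t ht
        using (hue ε hε).pde (x, t) ⟨hx, ht⟩
    ucont := hu.cont
    c21u := hu.c21On
    equ := fun x hx t ht => hu.pde (x, t) (by rw [QT_diff_NSet]; exact ⟨hx, ht⟩)
    ulat := hu.apply_lateral hab.le hT h₀
    uinit := hu.apply_zero hab.le hT h₀
    une := fun x hx t ht h => hx.2 ((hu.zero_iff x (Ioo_subset_Icc_self hx.1) t ht).1 h)
    ubdd := fun x hx t ht => (hB₁ (x, t) ⟨hx, ht⟩).trans m2 }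

end Translation

/-- Theorem 3.1 (first part): `u_ε → u` uniformly in `Q` and in `C^{2,1}_loc(Q ∖ N)`. -/
theorem stmt2 (a b T : ℝ) (hab : a < b) (hT : 0 < T)
    (N₀ : Set ℝ) (u₀ : ℝ → ℝ) (h₀ : InitData a b N₀ u₀)
    (Φ : ℝ → ℝ → ℝ)
    (hΦ : ∀ ε > (0:ℝ), Function.LeftInverse (Φ ε) (Ureg ε) ∧
      Function.RightInverse (Φ ε) (Ureg ε))
    (u1 : ℝ → ℝ) (hu1 : ∀ ε > (0:ℝ), 0 < u1 ε ∧ Φ ε (u1 ε) = 1)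
    (u0e : ℝ → ℝ → ℝ)
    (h0e : ∀ ε > (0:ℝ), ContDiffOn ℝ (⊤ : ℕ∞) (u0e ε) (Set.Icc a b) ∧
      u0e ε a = -u1 ε ∧ u0e ε b = u1 ε ∧
      ∀ x ∈ Set.Icc a b, (u0e ε x = 0 ↔ x ∈ N₀))
    (h0conv : TendstoUniformlyOn (fun ε => u0e ε) u₀ (𝓝[>] (0:ℝ)) (Set.Icc a b))
    (ue : ℝ → ℝ → ℝ → ℝ)
    (hue : ∀ ε > (0:ℝ), IsRegSol a b T ε (Φ ε) (u1 ε) (u0e ε) (ue ε))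
    (u : ℝ → ℝ → ℝ) (hu : IsClassicalSol a b T N₀ u₀ u) :
    TendstoUniformlyOn (fun ε p => ue ε p.1 p.2) (fun p => u p.1 p.2)
      (𝓝[>] (0:ℝ)) (QT a b T) ∧
    ∀ K : Set (ℝ × ℝ), IsCompact K → K ⊆ QT a b T \ NSet N₀ T →
      TendstoUniformlyOn (fun ε p => ue ε p.1 p.2) (fun p => u p.1 p.2) (𝓝[>] (0:ℝ)) K ∧
      TendstoUniformlyOn (fun ε p => pdx (ue ε) p.1 p.2) (fun p => pdx u p.1 p.2)
        (𝓝[>] (0:ℝ)) K ∧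
      TendstoUniformlyOn (fun ε p => pdxx (ue ε) p.1 p.2) (fun p => pdxx u p.1 p.2)
        (𝓝[>] (0:ℝ)) K ∧
      TendstoUniformlyOn (fun ε p => pdtW T (ue ε) p.1 p.2) (fun p => pdtW T u p.1 p.2)
        (𝓝[>] (0:ℝ)) K := by
  obtain ⟨M, h⟩ := convData_of_solutions hab hT h₀ (fun ε hε => (hΦ ε hε).2)
    (fun ε hε => (h0e ε hε).2.1) (fun ε hε => (h0e ε hε).2.2.1) h0conv hue hu
  refine ⟨Metric.tendstoUniformlyOn_iff.2 fun δ hδ => ?_, fun K hK hKs => ?_⟩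
  · filter_upwards [h.eventually_abs_sub_lt hδ] with ε hε p hp
    rw [dist_comm, Real.dist_eq]
    exact hε p.1 (Ioo_subset_Icc_self hp.1) p.2 (Ioc_subset_Icc_self hp.2)
  · rw [QT_diff_NSet] at hKs
    exact ⟨ConvData.tendstoUniformlyOn_of_near
        (fun x hx σ hσ η hη => h.eventually_abs_sub_lt_near hx hσ hη) hK hKs,
      ConvData.tendstoUniformlyOn_of_near
        (fun x hx σ hσ η hη => h.eventually_abs_pdx_sub_lt hx hσ hη) hK hKs,
      ConvData.tendstoUniformlyOn_of_near
        (fun x hx σ hσ η hη => h.eventually_abs_pdxx_sub_lt hx hσ hη) hK hKs,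
      ConvData.tendstoUniformlyOn_of_near (F := fun ε => pdtW T (ue ε)) (f := pdtW T u)
        (fun x hx σ hσ η hη => h.eventually_abs_pdtW_sub_lt hx hσ hη) hK hKs⟩
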